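/- Let s ∈ ℕ with s ≥ 13, let φ ∈ H^s(𝕋) be real-valued, and assume P_N(φ) > 0. Then there exist T > 0, which can be chosen depending only on P_N(φ) and ‖φ‖_{H^{12}}, and a real-valued solution u of ∂_t u + γ₀∂_x⁵u + γ₁∂_x³u + γ₂∂_x u = N(∂_x³u,∂_x²u,∂_xu,u) on [0,T]×𝕋 (in the sense of distributions) with u(0,·) = φ such that u ∈ C([0,T]; H^s(𝕋)) ∩ C^∞((0,T]×𝕋) and P_N(u(t)) ≥ P_N(φ)/2 for all t ∈ [0,T]. In particular the solution is smooth (parabolic smoothing) for positive times. -/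

import Mathlib

/- Fifth order dispersive equations on the torus: local well-posedness
   with parabolic smoothing for parabolic resonance type data with P_N(φ) > 0. -/

namespace FifthOrderStmt2

/-- Fourier coefficient of a `2π`-periodic function `f : ℝ → ℝ`:
`f̂(k) = (1/2π) ∫_0^{2π} f(x) e^{-ikx} dx`. -/
noncomputable def fc (f : ℝ → ℝ) (k : ℤ) : ℂ :=
  (Complex.ofReal (2 * Real.pi))⁻¹ *
    ∫ x in (0:ℝ)..(2 * Real.pi), (f x : ℂ) * Complex.exp (-Complex.I * (k : ℂ) * (x : ℂ))

/-- Sobolev norm `‖f‖_{H^s} = (Σ_k (1+k²)^s |f̂(k)|²)^{1/2}`. -/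
noncomputable def hsNorm (s : ℕ) (f : ℝ → ℝ) : ℝ :=
  Real.sqrt (∑' k : ℤ, (1 + (k : ℝ) ^ 2) ^ s * ‖fc f k‖ ^ 2)

/-- `f` belongs to `H^s(𝕋)` (continuous representative, `2π`-periodic, finite `H^s` norm). -/
def MemHs (s : ℕ) (f : ℝ → ℝ) : Prop :=
  Continuous f ∧ Function.Periodic f (2 * Real.pi) ∧
    Summable (fun k : ℤ => (1 + (k : ℝ) ^ 2) ^ s * ‖fc f k‖ ^ 2)

/-- The nonlinearity `N(∂_x³f, ∂_x²f, ∂_xf, f) = Σ_j λ_j (∂_x³f)^{a_j}(∂_x²f)^{b_j}(∂_xf)^{c_j}f^{d_j}`. -/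
noncomputable def Nfun (j0 : ℕ) (lam : Fin j0 → ℝ) (a b c d : Fin j0 → ℕ)
    (f : ℝ → ℝ) (x : ℝ) : ℝ :=
  ∑ j : Fin j0, lam j * (iteratedDeriv 3 f x) ^ (a j) * (iteratedDeriv 2 f x) ^ (b j) *
    (deriv f x) ^ (c j) * (f x) ^ (d j)

/-- The functional `P_N(f) = Σ_j (λ_j b_j / 2π) ∫_𝕋 (∂_x³f)^{a_j}(∂_x²f)^{b_j-1}(∂_xf)^{c_j}f^{d_j} dx`. -/
noncomputable def PN (j0 : ℕ) (lam : Fin j0 → ℝ) (a b c d : Fin j0 → ℕ) (f : ℝ → ℝ) : ℝ :=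
  ∑ j : Fin j0, (lam j * (b j : ℝ) / (2 * Real.pi)) *
    ∫ x in (0:ℝ)..(2 * Real.pi),
      (iteratedDeriv 3 f x) ^ (a j) * (iteratedDeriv 2 f x) ^ (b j - 1) *
        (deriv f x) ^ (c j) * (f x) ^ (d j)

/-- `u` is a (distributional) solution of
`∂_t u + γ₀∂_x⁵u + γ₁∂_x³u + γ₂∂_x u = N(∂_x³u,∂_x²u,∂_xu,u)` on `[T₁,T₂] × 𝕋`:
each `u(t)` is `2π`-periodic and `C³` in `x` (so that `N(u)` is defined pointwise), and for every
smooth test function `ψ`, `2π`-periodic in `x` and compactly supported in time inside `(T₁,T₂)`,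
the integrated-by-parts identity holds. -/
def IsSolution (γ0 γ1 γ2 : ℝ) (j0 : ℕ) (lam : Fin j0 → ℝ) (a b c d : Fin j0 → ℕ)
    (T1 T2 : ℝ) (u : ℝ → ℝ → ℝ) : Prop :=
  (∀ t ∈ Set.Icc T1 T2, ContDiff ℝ 3 (u t) ∧ Function.Periodic (u t) (2 * Real.pi)) ∧
  ∀ ψ : ℝ → ℝ → ℝ, ContDiff ℝ (⊤ : ℕ∞) (Function.uncurry ψ) →
    (∀ t : ℝ, Function.Periodic (ψ t) (2 * Real.pi)) →
    (∀ t : ℝ, t ∉ Set.Ioo T1 T2 → ∀ x : ℝ, ψ t x = 0) →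
    (∫ t in T1..T2, ∫ x in (0:ℝ)..(2 * Real.pi),
      (u t x * (deriv (fun τ : ℝ => ψ τ x) t
        + γ0 * iteratedDeriv 5 (ψ t) x
        + γ1 * iteratedDeriv 3 (ψ t) x
        + γ2 * deriv (ψ t) x)
      + Nfun j0 lam a b c d (u t) x * ψ t x)) = 0

/-- `t ↦ u(t)` is continuous from `A` into `H^s(𝕋)`. -/
def ContInHs (s : ℕ) (A : Set ℝ) (u : ℝ → ℝ → ℝ) : Prop :=
  ∀ t₀ ∈ A, ∀ ε > 0, ∃ δ > 0, ∀ t ∈ A, |t - t₀| < δ →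
    hsNorm s (fun x => u t x - u t₀ x) < ε

section

open MvPolynomial

/-- The total derivative `X_j ↦ X_{j+1}` on differential polynomials in one unknown function;
the variable `X_j` stands for the `j`-th derivative. -/
noncomputable def totalD : Derivation ℝ (MvPolynomial ℕ ℝ) (MvPolynomial ℕ ℝ) :=
  mkDerivation ℝ fun j => X (j + 1)

/-- Differential polynomials of order at most `r`. -/
noncomputable def ordLE (r : ℕ) : Subalgebra ℝ (MvPolynomial ℕ ℝ) := supported ℝ (Set.Iic r)

lemma totalD_X (j : ℕ) : totalD (X j) = X (j + 1) := mkDerivation_X _ _ _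

lemma ordLE_mono {r r' : ℕ} (h : r ≤ r') : ordLE r ≤ ordLE r' :=
  supported_mono (Set.Iic_subset_Iic.2 h)

lemma X_mem_ordLE {j r : ℕ} (h : j ≤ r) : (X j : MvPolynomial ℕ ℝ) ∈ ordLE r :=
  X_mem_supported.2 h

lemma C_mem_ordLE (c : ℝ) (r : ℕ) : (C c : MvPolynomial ℕ ℝ) ∈ ordLE r :=
  (ordLE r).algebraMap_mem c

lemma ordLE_induction {r : ℕ} {motive : MvPolynomial ℕ ℝ → Prop}
    (hX : ∀ j ≤ r, motive (X j)) (hC : ∀ c, motive (C c))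
    (hadd : ∀ p q, p ∈ ordLE r → q ∈ ordLE r → motive p → motive q → motive (p + q))
    (hmul : ∀ p q, p ∈ ordLE r → q ∈ ordLE r → motive p → motive q → motive (p * q))
    {p : MvPolynomial ℕ ℝ} (hp : p ∈ ordLE r) : motive p := by
  unfold ordLE at hp
  rw [supported_eq_adjoin_X] at hp
  induction hp using Algebra.adjoin_induction with
  | mem x hx =>
    obtain ⟨j, hj, rfl⟩ := hx
    exact hX j hj
  | algebraMap c => exact hC c
  | add p q hp hq h1 h2 => exact hadd p q hp hq h1 h2
  | mul p q hp hq h1 h2 => exact hmul p q hp hq h1 h2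

lemma pderiv_mem_ordLE {r : ℕ} {p : MvPolynomial ℕ ℝ} (hp : p ∈ ordLE r) (j : ℕ) :
    pderiv j p ∈ ordLE r := by
  refine ordLE_induction (motive := fun p => pderiv j p ∈ ordLE r) ?_ ?_ ?_ ?_ hp
  · intro i hi
    rw [pderiv_X]
    by_cases h : j = i
    · subst h; simp
    · simp [Ne.symm h]
  · intro c
    simp
  · intro p q _ _ h1 h2
    rw [map_add]; exact add_mem h1 h2
  · intro p q hp hq h1 h2
    rw [pderiv_mul]; exact add_mem (mul_mem h1 hq) (mul_mem hp h2)

lemma pderiv_eq_zero_of_ordLE {r j : ℕ} (hj : r < j) {p : MvPolynomial ℕ ℝ} (hp : p ∈ ordLE r) :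
    pderiv j p = 0 := by
  apply pderiv_eq_zero_of_notMem_vars
  intro h
  exact absurd (mem_supported.1 hp h) (by simpa using hj)

lemma totalD_split {r : ℕ} {p : MvPolynomial ℕ ℝ} (hp : p ∈ ordLE r) :
    ∃ q ∈ ordLE r, totalD p = pderiv r p * X (r + 1) + q := by
  refine ordLE_induction (motive := fun p => ∃ q ∈ ordLE r,
    totalD p = pderiv r p * X (r + 1) + q) ?_ ?_ ?_ ?_ hp
  · intro i hi
    rcases hi.eq_or_lt with rfl | h
    · exact ⟨0, zero_mem _, by simp [totalD_X]⟩
    · exact ⟨X (i + 1), X_mem_ordLE h, by simp [totalD_X, pderiv_X_of_ne h.ne]⟩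
  · exact fun c => ⟨0, zero_mem _, by simp [derivation_C]⟩
  · intro p q hp hq h1 h2
    obtain ⟨p', hp', e1⟩ := h1
    obtain ⟨q', hq', e2⟩ := h2
    exact ⟨p' + q', add_mem hp' hq', by rw [map_add, map_add, e1, e2]; ring⟩
  · intro p q hp hq h1 h2
    obtain ⟨p', hp', e1⟩ := h1
    obtain ⟨q', hq', e2⟩ := h2
    refine ⟨p * q' + q * p', add_mem (mul_mem hp hq') (mul_mem hq hp'), ?_⟩
    rw [Derivation.leibniz, pderiv_mul, e1, e2]
    simp only [smul_eq_mul]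
    ring

lemma totalD_mem_ordLE {r : ℕ} {p : MvPolynomial ℕ ℝ} (hp : p ∈ ordLE r) :
    totalD p ∈ ordLE (r + 1) := by
  obtain ⟨q, hq, e⟩ := totalD_split hp
  rw [e]
  exact add_mem (mul_mem (ordLE_mono (by omega) (pderiv_mem_ordLE hp r)) (X_mem_ordLE le_rfl))
    (ordLE_mono (by omega) hq)

lemma iterate_totalD_mem_ordLE {r : ℕ} {p : MvPolynomial ℕ ℝ} (hp : p ∈ ordLE r) (m : ℕ) :
    totalD^[m] p ∈ ordLE (r + m) := by
  induction m with
  | zero => exact hp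
  | succ m ih =>
    rw [Function.iterate_succ_apply']
    exact totalD_mem_ordLE ih

lemma pderiv_succ_totalD (j : ℕ) (p : MvPolynomial ℕ ℝ) :
    pderiv (j + 1) (totalD p) = totalD (pderiv (j + 1) p) + pderiv j p := by
  induction p using MvPolynomial.induction_on with
  | C a => simp [derivation_C]
  | add p q h1 h2 => simp only [map_add, h1, h2]; ring
  | mul_X p i h =>
    by_cases h1 : i = j + 1
    · subst h1
      simp [totalD_X, h]
      ring
    · by_cases h2 : i = j
      · subst h2
        simp [totalD_X, h]
        ring
      · simp [totalD_X, h, h1, h2]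
        ring

/-- `D^m N` is affine in its `I` highest order derivatives, with coefficients of low order. -/
lemma iterate_totalD_affine {N : MvPolynomial ℕ ℝ} (hN : N ∈ ordLE 3) (m I : ℕ)
    (h : 2 * I ≤ m + 1) :
    ∃ c : ℕ → MvPolynomial ℕ ℝ, (∀ i, c i ∈ ordLE (3 + i)) ∧
      ∃ r ∈ ordLE (m + 3 - I),
        totalD^[m] N = ∑ i ∈ Finset.range I, c i * X (m + 3 - i) + r := by
  induction m generalizing I with
  | zero =>
    obtain rfl : I = 0 := by omega
    exact ⟨0, fun i => zero_mem _, N, hN, by simp⟩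
  | succ m ih =>
    have key : ∀ J : ℕ, 2 * J ≤ m + 2 → ∀ c : ℕ → MvPolynomial ℕ ℝ, ∀ r,
        totalD (∑ i ∈ Finset.range J, c i * X (m + 3 - i) + r) =
        ∑ i ∈ Finset.range J, c i * X (m + 1 + 3 - i) +
        ∑ i ∈ Finset.range (J + 1), (if i = 0 then 0 else totalD (c (i - 1))) * X (m + 1 + 3 - i)
          + totalD r := by
      intro J hJ c r
      rw [map_add, map_sum, Finset.sum_range_succ', ← add_assoc, ← Finset.sum_add_distrib]
      congr 1
      simp only [if_true, zero_mul, add_zero]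
      refine Finset.sum_congr rfl fun i hi => ?_
      have hi' := Finset.mem_range.1 hi
      rw [Derivation.leibniz, totalD_X, show m + 3 - i + 1 = m + 1 + 3 - i by omega,
        show m + 1 + 3 - (i + 1) = m + 3 - i by omega]
      simp only [smul_eq_mul, Nat.add_sub_cancel, Nat.succ_ne_zero, if_false]
      ring
    have hd : ∀ c : ℕ → MvPolynomial ℕ ℝ, (∀ i, c i ∈ ordLE (3 + i)) → ∀ i,
        (if i = 0 then 0 else totalD (c (i - 1))) ∈ ordLE (3 + i) := by
      intro c hc i
      rcases i with _ | i
      · simp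
      · have h := totalD_mem_ordLE (hc i)
        rw [add_assoc] at h
        simpa using h
    by_cases h2 : 2 * I ≤ m + 1
    · obtain ⟨c, hc, r, hr, e⟩ := ih I h2
      refine ⟨fun i => c i + (if i = 0 then 0 else totalD (c (i - 1))),
        fun i => add_mem (hc i) (hd c hc i),
        (if I = 0 then 0 else totalD (c (I - 1))) * X (m + 1 + 3 - I) + totalD r, ?_, ?_⟩
      · refine add_mem (mul_mem (ordLE_mono (by omega) (hd c hc I)) (X_mem_ordLE le_rfl)) ?_
        exact ordLE_mono (by omega) (totalD_mem_ordLE hr)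
      · rw [Function.iterate_succ_apply', e, key I (by omega), Finset.sum_range_succ]
        simp only [add_mul, Finset.sum_add_distrib]
        ring
    · obtain ⟨J, rfl⟩ : ∃ J, I = J + 1 := ⟨I - 1, by omega⟩
      obtain ⟨c, hc, r, hr, e⟩ := ih J (by omega)
      obtain ⟨r', hr', e'⟩ := totalD_split hr
      refine ⟨fun i => (if i = J then pderiv (m + 3 - J) r else c i) +
        (if i = 0 then 0 else totalD (c (i - 1))), fun i => add_mem ?_ (hd c hc i), r', ?_, ?_⟩
      · split_ifs with hi
        · exact ordLE_mono (by omega) (pderiv_mem_ordLE hr _)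
        · exact hc i
      · exact ordLE_mono (by omega) hr'
      · rw [Function.iterate_succ_apply', e, key J (by omega), e']
        simp only [add_mul, Finset.sum_add_distrib]
        rw [Finset.sum_range_succ (fun i => (if i = J then _ else c i) * _)]
        have : ∑ i ∈ Finset.range J, (if i = J then pderiv (m + 3 - J) r else c i) *
            X (m + 1 + 3 - i) = ∑ i ∈ Finset.range J, c i * X (m + 1 + 3 - i) := by
          refine Finset.sum_congr rfl fun i hi => ?_
          rw [if_neg (Finset.mem_range.1 hi).ne]
        rw [this, if_pos rfl, show m + 3 - J + 1 = m + 1 + 3 - J by omega]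
        ring

lemma pderiv_iterate_totalD_eq_zero {N : MvPolynomial ℕ ℝ} (hN : N ∈ ordLE 3) (m k : ℕ)
    (hk : m + 3 < k) : pderiv k (totalD^[m] N) = 0 :=
  pderiv_eq_zero_of_ordLE (by omega) (iterate_totalD_mem_ordLE hN m)

lemma pderiv_top_iterate_totalD {N : MvPolynomial ℕ ℝ} (hN : N ∈ ordLE 3) (m : ℕ) :
    pderiv (m + 3) (totalD^[m] N) = pderiv 3 N := by
  induction m with
  | zero => simp
  | succ m ih =>
    rw [Function.iterate_succ_apply', show m + 1 + 3 = m + 3 + 1 by ring, pderiv_succ_totalD,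
      pderiv_iterate_totalD_eq_zero hN _ _ (by omega), ih, map_zero, zero_add]

lemma pderiv_subtop_iterate_totalD {N : MvPolynomial ℕ ℝ} (hN : N ∈ ordLE 3) (m : ℕ) :
    pderiv (m + 2) (totalD^[m] N) = pderiv 2 N + C (m : ℝ) * totalD (pderiv 3 N) := by
  induction m with
  | zero => simp
  | succ m ih =>
    rw [Function.iterate_succ_apply', show m + 1 + 2 = m + 2 + 1 by ring, pderiv_succ_totalD,
      ih, show m + 2 + 1 = m + 3 by ring, pderiv_top_iterate_totalD hN]
    push_cast
    rw [C_add, C_1]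
    ring

/-- The structure of `D^m N` used in the energy estimate at level `m`. -/
lemma iterate_totalD_structure {N : MvPolynomial ℕ ℝ} (hN : N ∈ ordLE 3) (m : ℕ) (hm : 9 ≤ m) :
    ∃ c2 c3 c4 r : MvPolynomial ℕ ℝ, c2 ∈ ordLE 7 ∧ c3 ∈ ordLE 7 ∧ c4 ∈ ordLE 7 ∧
      r ∈ ordLE (m - 2) ∧
      totalD^[m] N = pderiv 3 N * X (m + 3) +
        (pderiv 2 N + C (m : ℝ) * totalD (pderiv 3 N)) * X (m + 2) +
        c2 * X (m + 1) + c3 * X m + c4 * X (m - 1) + r := by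
  obtain ⟨c, hc, r, hr, e⟩ := iterate_totalD_affine hN m 5 (by omega)
  simp only [Finset.sum_range_succ, Finset.sum_range_zero, zero_add, Nat.sub_zero,
    show m + 3 - 1 = m + 2 by omega, show m + 3 - 2 = m + 1 by omega,
    show m + 3 - 3 = m by omega, show m + 3 - 4 = m - 1 by omega] at e
  have hz : ∀ i k, i ≤ 4 → m + 1 < k → pderiv k (c i) = 0 := fun i k hi hk =>
    pderiv_eq_zero_of_ordLE (r := 3 + i) (by omega) (hc i)
  have hrz : ∀ k, m + 1 < k → pderiv k r = 0 := fun k hk =>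
    pderiv_eq_zero_of_ordLE (by omega) hr
  have e0 : pderiv 3 N = c 0 := by
    rw [← pderiv_top_iterate_totalD hN m, e]
    simp only [map_add, pderiv_mul, hz _ (m + 3) (by norm_num : 0 ≤ 4) (by omega),
      hz _ (m + 3) (by norm_num : 1 ≤ 4) (by omega), hz _ (m + 3) (by norm_num : 2 ≤ 4) (by omega),
      hz _ (m + 3) (by norm_num : 3 ≤ 4) (by omega), hz _ (m + 3) (by norm_num : 4 ≤ 4) (by omega),
      hrz (m + 3) (by omega), pderiv_X_self,
      pderiv_X_of_ne (show m + 2 ≠ m + 3 by omega), pderiv_X_of_ne (show m + 1 ≠ m + 3 by omega),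
      pderiv_X_of_ne (show m ≠ m + 3 by omega), pderiv_X_of_ne (show m - 1 ≠ m + 3 by omega)]
    ring
  have e1 : pderiv 2 N + C (m : ℝ) * totalD (pderiv 3 N) = c 1 := by
    rw [← pderiv_subtop_iterate_totalD hN m, e]
    simp only [map_add, pderiv_mul, hz _ (m + 2) (by norm_num : 0 ≤ 4) (by omega),
      hz _ (m + 2) (by norm_num : 1 ≤ 4) (by omega), hz _ (m + 2) (by norm_num : 2 ≤ 4) (by omega),
      hz _ (m + 2) (by norm_num : 3 ≤ 4) (by omega), hz _ (m + 2) (by norm_num : 4 ≤ 4) (by omega),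
      hrz (m + 2) (by omega), pderiv_X_self,
      pderiv_X_of_ne (show m + 3 ≠ m + 2 by omega), pderiv_X_of_ne (show m + 1 ≠ m + 2 by omega),
      pderiv_X_of_ne (show m ≠ m + 2 by omega), pderiv_X_of_ne (show m - 1 ≠ m + 2 by omega)]
    ring
  refine ⟨c 2, c 3, c 4, r, ordLE_mono (by omega) (hc 2), ordLE_mono (by omega) (hc 3),
    ordLE_mono (by omega) (hc 4), ordLE_mono (by omega) hr, ?_⟩
  rw [e, e1, e0]

/-- `D^m N` is affine in its three highest order derivatives. -/
lemma iterate_totalD_structure_low {N : MvPolynomial ℕ ℝ} (hN : N ∈ ordLE 3) (m : ℕ)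
    (hm : 5 ≤ m) :
    ∃ c0 c1 c2 r : MvPolynomial ℕ ℝ, c0 ∈ ordLE 5 ∧ c1 ∈ ordLE 5 ∧ c2 ∈ ordLE 5 ∧
      r ∈ ordLE m ∧
      totalD^[m] N = c0 * X (m + 3) + c1 * X (m + 2) + c2 * X (m + 1) + r := by
  obtain ⟨c, hc, r, hr, e⟩ := iterate_totalD_affine hN m 3 (by omega)
  refine ⟨c 0, c 1, c 2, r, ordLE_mono (by omega) (hc 0), ordLE_mono (by omega) (hc 1),
    hc 2, by simpa using hr, ?_⟩
  simp only [Finset.sum_range_succ, Finset.sum_range_zero, zero_add, Nat.sub_zero,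
    show m + 3 - 1 = m + 2 by omega, show m + 3 - 2 = m + 1 by omega] at e
  exact e

/-- Differential polynomials are bounded on bounded jets. -/
lemma exists_bound_eval {r : ℕ} {p : MvPolynomial ℕ ℝ} (hp : p ∈ ordLE r) (K : ℝ) :
    ∃ B : ℝ, 0 ≤ B ∧ ∀ y : ℕ → ℝ, (∀ j ≤ r, |y j| ≤ K) → |eval y p| ≤ B := by
  refine ordLE_induction (motive := fun p => ∃ B : ℝ, 0 ≤ B ∧ ∀ y : ℕ → ℝ,
    (∀ j ≤ r, |y j| ≤ K) → |eval y p| ≤ B) ?_ ?_ ?_ ?_ hp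
  · intro j hj
    refine ⟨|K|, abs_nonneg _, fun y hy => ?_⟩
    rw [eval_X]
    exact (hy j hj).trans (le_abs_self K)
  · intro c
    exact ⟨|c|, abs_nonneg _, fun y _ => by rw [eval_C]⟩
  · rintro p q - - ⟨B, hB, h1⟩ ⟨B', hB', h2⟩
    refine ⟨B + B', by positivity, fun y hy => ?_⟩
    rw [map_add]
    exact (abs_add_le _ _).trans (add_le_add (h1 y hy) (h2 y hy))
  · rintro p q - - ⟨B, hB, h1⟩ ⟨B', hB', h2⟩
    refine ⟨B * B', by positivity, fun y hy => ?_⟩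
    rw [map_mul, abs_mul]
    exact mul_le_mul (h1 y hy) (h2 y hy) (abs_nonneg _) hB

/-- The linearization of a differential polynomial `p` of order `r` at the jet `y` in the
direction `v`. -/
noncomputable def lin (r : ℕ) (p : MvPolynomial ℕ ℝ) (y v : ℕ → ℝ) : ℝ :=
  ∑ j ∈ Finset.range (r + 1), eval y (pderiv j p) * v j

lemma lin_mul (r : ℕ) (p q : MvPolynomial ℕ ℝ) (y v : ℕ → ℝ) :
    lin r (p * q) y v = lin r p y v * eval y q + eval y p * lin r q y v := by
  simp only [lin, pderiv_mul, map_add, map_mul, Finset.sum_mul, Finset.mul_sum]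
  rw [← Finset.sum_add_distrib]
  exact Finset.sum_congr rfl fun j _ => by ring

lemma lin_add (r : ℕ) (p q : MvPolynomial ℕ ℝ) (y v : ℕ → ℝ) :
    lin r (p + q) y v = lin r p y v + lin r q y v := by
  simp only [lin, map_add, add_mul, Finset.sum_add_distrib]

lemma lin_X {r j : ℕ} (h : j ≤ r) (y v : ℕ → ℝ) : lin r (X j) y v = v j := by
  simp only [lin, pderiv_X]
  rw [Finset.sum_eq_single j]
  · simp
  · intro i _ hi
    simp [hi]
  · intro h'
    exact absurd (Finset.mem_range.2 (by omega)) h'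

lemma lin_C (r : ℕ) (c : ℝ) (y v : ℕ → ℝ) : lin r (C c) y v = 0 := by
  simp [lin]

lemma eval_totalD {r : ℕ} {p : MvPolynomial ℕ ℝ} (hp : p ∈ ordLE r) (y : ℕ → ℝ) :
    eval y (totalD p) = lin r p y (fun j => y (j + 1)) := by
  refine ordLE_induction (motive := fun p => eval y (totalD p) = lin r p y (fun j => y (j + 1)))
    ?_ ?_ ?_ ?_ hp
  · intro j hj
    rw [totalD_X, lin_X hj, eval_X]
  · intro c
    simp [lin_C, derivation_C]
  · intro p q _ _ h1 h2
    rw [map_add, map_add, lin_add, h1, h2]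
  · intro p q _ _ h1 h2
    rw [Derivation.leibniz, lin_mul, ← h1, ← h2]
    simp only [smul_eq_mul, map_add, map_mul]
    ring

/-- Chain rule for differential polynomials. -/
lemma hasDerivAt_eval {r : ℕ} {p : MvPolynomial ℕ ℝ} (hp : p ∈ ordLE r) {y : ℝ → ℕ → ℝ}
    {v : ℕ → ℝ} {t : ℝ} (h : ∀ j ≤ r, HasDerivAt (fun t => y t j) (v j) t) :
    HasDerivAt (fun t => eval (y t) p) (lin r p (y t) v) t := by
  refine ordLE_induction (motive := fun p => HasDerivAt (fun t => eval (y t) p)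
    (lin r p (y t) v) t) ?_ ?_ ?_ ?_ hp
  · intro j hj
    simpa only [eval_X, lin_X hj] using h j hj
  · intro c
    simpa only [eval_C, lin_C] using hasDerivAt_const t c
  · intro p q _ _ h1 h2
    simpa only [map_add, lin_add] using h1.fun_add h2
  · intro p q _ _ h1 h2
    simpa only [map_mul, lin_mul] using h1.fun_mul h2

lemma contDiff_eval {E : Type*} [NormedAddCommGroup E] [NormedSpace ℝ E] {n : WithTop ℕ∞}
    {r : ℕ} {p : MvPolynomial ℕ ℝ} (hp : p ∈ ordLE r) {y : E → ℕ → ℝ}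
    (h : ∀ j ≤ r, ContDiff ℝ n fun x => y x j) : ContDiff ℝ n fun x => eval (y x) p := by
  refine ordLE_induction (motive := fun p => ContDiff ℝ n fun x => eval (y x) p) ?_ ?_ ?_ ?_ hp
  · intro j hj
    simpa only [eval_X] using h j hj
  · intro c
    simpa only [eval_C] using contDiff_const
  · intro p q _ _ h1 h2
    simpa only [map_add] using h1.add h2
  · intro p q _ _ h1 h2
    simpa only [map_mul] using h1.mul h2

lemma continuousOn_eval {E : Type*} [TopologicalSpace E] {s : Set E}
    {r : ℕ} {p : MvPolynomial ℕ ℝ} (hp : p ∈ ordLE r) {y : E → ℕ → ℝ}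
    (h : ∀ j ≤ r, ContinuousOn (fun x => y x j) s) : ContinuousOn (fun x => eval (y x) p) s := by
  refine ordLE_induction (motive := fun p => ContinuousOn (fun x => eval (y x) p) s)
    ?_ ?_ ?_ ?_ hp
  · intro j hj
    simpa only [eval_X] using h j hj
  · intro c
    simpa only [eval_C] using continuousOn_const
  · intro p q _ _ h1 h2
    simp only [map_add]
    exact h1.add h2
  · intro p q _ _ h1 h2
    simp only [map_mul]
    exact h1.mul h2

lemma continuous_eval_jet {E : Type*} [TopologicalSpace E]
    {r : ℕ} {p : MvPolynomial ℕ ℝ} (hp : p ∈ ordLE r) {y : E → ℕ → ℝ}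
    (h : ∀ j ≤ r, Continuous fun x => y x j) : Continuous fun x => eval (y x) p := by
  rw [← continuousOn_univ]
  exact continuousOn_eval hp fun j hj => (h j hj).continuousOn

lemma exists_ordLE (p : MvPolynomial ℕ ℝ) : ∃ r, p ∈ ordLE r := by
  refine ⟨p.vars.sup id, mem_supported.2 fun j hj => ?_⟩
  exact Finset.le_sup (f := id) hj

end

section

open MvPolynomial Real

/-- Smooth `2π`-periodic functions. -/
def SmoothPer (u : ℝ → ℝ) : Prop :=
  ContDiff ℝ (⊤ : ℕ∞) u ∧ Function.Periodic u (2 * π)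

/-- The jet of a function at a point. -/
noncomputable def jet (u : ℝ → ℝ) (x : ℝ) (j : ℕ) : ℝ := iteratedDeriv j u x

/-- The differential operator defined by a differential polynomial. -/
noncomputable def ev (p : MvPolynomial ℕ ℝ) (u : ℝ → ℝ) (x : ℝ) : ℝ := eval (jet u x) p

/-- The square of the `L²` norm of the `j`-th derivative. -/
noncomputable def sob (j : ℕ) (u : ℝ → ℝ) : ℝ := ∫ x in (0:ℝ)..(2 * π), jet u x j ^ 2

lemma two_pi_nonneg : (0:ℝ) ≤ 2 * π := by positivity

lemma SmoothPer.hasDerivAt {u : ℝ → ℝ} (hu : SmoothPer u) (j : ℕ) (x : ℝ) :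
    HasDerivAt (fun x => jet u x j) (jet u x (j + 1)) x := by
  have h : Differentiable ℝ (iteratedDeriv j u) :=
    hu.1.differentiable_iteratedDeriv j (by exact_mod_cast WithTop.coe_lt_top _)
  simpa only [jet, iteratedDeriv_succ] using (h x).hasDerivAt

lemma SmoothPer.continuous {u : ℝ → ℝ} (hu : SmoothPer u) (j : ℕ) :
    Continuous fun x => jet u x j :=
  continuous_iff_continuousAt.2 fun x => (hu.hasDerivAt j x).continuousAt

lemma SmoothPer.periodic {u : ℝ → ℝ} (hu : SmoothPer u) (j : ℕ) :
    Function.Periodic (fun x => jet u x j) (2 * π) := by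
  induction j with
  | zero => simpa only [jet, iteratedDeriv_zero] using hu.2
  | succ j ih =>
    intro x
    have h := (hu.hasDerivAt j (x + 2 * π)).comp_add_const x (2 * π)
    rw [show (fun x => jet u (x + 2 * π) j) = fun x => jet u x j from funext ih] at h
    exact h.unique (hu.hasDerivAt j x)

lemma SmoothPer.jet_periodic {u : ℝ → ℝ} (hu : SmoothPer u) : Function.Periodic (jet u) (2 * π) :=
  fun x => funext fun j => hu.periodic j x

lemma SmoothPer.ev_periodic {u : ℝ → ℝ} (hu : SmoothPer u) (p : MvPolynomial ℕ ℝ) :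
    Function.Periodic (ev p u) (2 * π) := fun x => by
  simp only [ev, hu.jet_periodic x]

lemma SmoothPer.ev_hasDerivAt {u : ℝ → ℝ} (hu : SmoothPer u) (p : MvPolynomial ℕ ℝ) (x : ℝ) :
    HasDerivAt (ev p u) (ev (totalD p) u x) x := by
  obtain ⟨r, hp⟩ := exists_ordLE p
  have h := hasDerivAt_eval hp (y := jet u) (v := fun j => jet u x (j + 1)) (t := x)
    fun j _ => hu.hasDerivAt j x
  rw [← eval_totalD hp] at h
  exact h

lemma SmoothPer.ev_continuous {u : ℝ → ℝ} (hu : SmoothPer u) (p : MvPolynomial ℕ ℝ) :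
    Continuous (ev p u) :=
  continuous_iff_continuousAt.2 fun x => (hu.ev_hasDerivAt p x).continuousAt

lemma SmoothPer.iteratedDeriv_ev {u : ℝ → ℝ} (hu : SmoothPer u) (p : MvPolynomial ℕ ℝ) (j : ℕ) :
    iteratedDeriv j (ev p u) = ev (totalD^[j] p) u := by
  induction j with
  | zero => simp
  | succ j ih =>
    rw [iteratedDeriv_succ, ih, Function.iterate_succ_apply']
    exact funext fun x => (hu.ev_hasDerivAt _ x).deriv

lemma SmoothPer.ev_smoothPer {u : ℝ → ℝ} (hu : SmoothPer u) (p : MvPolynomial ℕ ℝ) :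
    SmoothPer (ev p u) := by
  refine ⟨?_, hu.ev_periodic p⟩
  obtain ⟨r, hp⟩ := exists_ordLE p
  refine contDiff_eval hp fun j _ => ?_
  have h := ContDiff.iterate_deriv j hu.1
  simpa only [jet, iteratedDeriv_eq_iterate] using h

lemma integral_mono_of_continuous {f g : ℝ → ℝ} (hf : Continuous f) (hg : Continuous g)
    (h : ∀ x, f x ≤ g x) : ∫ x in (0:ℝ)..(2 * π), f x ≤ ∫ x in (0:ℝ)..(2 * π), g x :=
  intervalIntegral.integral_mono_on two_pi_nonneg (hf.intervalIntegrable _ _)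
    (hg.intervalIntegrable _ _) fun x _ => h x

lemma integral_hasDerivAt_eq_zero {F f : ℝ → ℝ} (h : ∀ x, HasDerivAt F (f x) x)
    (hf : Continuous f) (hF : Function.Periodic F (2 * π)) :
    ∫ x in (0:ℝ)..(2 * π), f x = 0 := by
  rw [intervalIntegral.integral_eq_sub_of_hasDerivAt (fun x _ => h x)
    (hf.intervalIntegrable _ _)]
  have := hF 0
  rw [zero_add] at this
  rw [this, sub_self]

/-- If `f - g` is the derivative of a periodic function, then `f` and `g` have equal integrals. -/
lemma integral_eq_of_hasDerivAt {F f g : ℝ → ℝ} (hf : Continuous f) (hg : Continuous g)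
    (hF : Function.Periodic F (2 * π)) (h : ∀ x, HasDerivAt F (f x - g x) x) :
    ∫ x in (0:ℝ)..(2 * π), f x = ∫ x in (0:ℝ)..(2 * π), g x := by
  have := integral_hasDerivAt_eq_zero h (hf.sub hg) hF
  rwa [intervalIntegral.integral_sub (hf.intervalIntegrable _ _) (hg.intervalIntegrable _ _),
    sub_eq_zero] at this

/-- One dimensional Sobolev embedding. -/
lemma sq_le_integral {f f' : ℝ → ℝ} (h : ∀ x, HasDerivAt f (f' x) x) (hf' : Continuous f')
    (hp : Function.Periodic f (2 * π)) (x : ℝ) :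
    f x ^ 2 ≤ 2 * ((∫ y in (0:ℝ)..(2 * π), f y ^ 2) + ∫ y in (0:ℝ)..(2 * π), f' y ^ 2) := by
  have hf : Continuous f := continuous_iff_continuousAt.2 fun x => (h x).continuousAt
  obtain ⟨x', hx', e⟩ : ∃ x' ∈ Set.Ico 0 (2 * π), f x = f x' :=
    hp.exists_mem_Ico₀ two_pi_pos x
  rw [e]
  set A := ∫ y in (0:ℝ)..(2 * π), f y ^ 2
  set B := ∫ y in (0:ℝ)..(2 * π), f' y ^ 2
  have hA : 0 ≤ A := intervalIntegral.integral_nonneg two_pi_nonneg fun y _ => sq_nonneg _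
  have key : ∀ y ∈ Set.Icc 0 (2 * π), f x' ^ 2 ≤ f y ^ 2 + (A + B) := by
    intro y hy
    have e1 : ∫ z in y..x', 2 * f z * f' z = f x' ^ 2 - f y ^ 2 := by
      refine intervalIntegral.integral_eq_sub_of_hasDerivAt (f := fun z => f z ^ 2) (fun z _ => ?_)
        ((by fun_prop : Continuous fun z => 2 * f z * f' z).intervalIntegrable _ _)
      simpa using (h z).fun_pow 2
    have e2 : |∫ z in y..x', 2 * f z * f' z| ≤ |∫ z in y..x', (f z ^ 2 + f' z ^ 2)| := by
      rw [← Real.norm_eq_abs]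
      refine intervalIntegral.norm_integral_le_abs_of_norm_le ?_
        ((by fun_prop : Continuous fun z => f z ^ 2 + f' z ^ 2).intervalIntegrable _ _)
      refine Filter.Eventually.of_forall fun z => ?_
      rw [Real.norm_eq_abs, abs_le]
      constructor <;> nlinarith [sq_nonneg (f z + f' z), sq_nonneg (f z - f' z)]
    have e3 : |∫ z in y..x', (f z ^ 2 + f' z ^ 2)| ≤ |∫ z in (0:ℝ)..(2 * π), (f z ^ 2 + f' z ^ 2)| := by
      refine intervalIntegral.abs_integral_mono_interval ?_
        (Filter.Eventually.of_forall fun z => by positivity)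
        ((by fun_prop : Continuous fun z => f z ^ 2 + f' z ^ 2).intervalIntegrable _ _)
      rw [Set.uIoc, Set.uIoc_of_le two_pi_nonneg]
      exact Set.Ioc_subset_Ioc (le_min hy.1 hx'.1) (max_le hy.2 hx'.2.le)
    have e4 : ∫ z in (0:ℝ)..(2 * π), (f z ^ 2 + f' z ^ 2) = A + B :=
      intervalIntegral.integral_add ((hf.pow 2).intervalIntegrable _ _)
        ((hf'.pow 2).intervalIntegrable _ _)
    have hB : 0 ≤ B := intervalIntegral.integral_nonneg two_pi_nonneg fun y _ => sq_nonneg _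
    rw [e4, abs_of_nonneg (add_nonneg hA hB)] at e3
    rw [e1] at e2
    have := le_abs_self (f x' ^ 2 - f y ^ 2)
    linarith
  have h2 : ∫ _ in (0:ℝ)..(2 * π), f x' ^ 2 ≤ ∫ y in (0:ℝ)..(2 * π), (f y ^ 2 + (A + B)) :=
    intervalIntegral.integral_mono_on two_pi_nonneg
    (continuous_const.intervalIntegrable _ _)
    ((by fun_prop : Continuous fun y => f y ^ 2 + (A + B)).intervalIntegrable _ _) key
  rw [intervalIntegral.integral_add ((hf.fun_pow 2).intervalIntegrable _ _)
    (continuous_const.intervalIntegrable _ _)] at h2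
  simp only [intervalIntegral.integral_const, smul_eq_mul, sub_zero] at h2
  have hB : 0 ≤ B := intervalIntegral.integral_nonneg two_pi_nonneg fun y _ => sq_nonneg _
  have h3 : A ≤ 2 * π * A := by nlinarith [Real.pi_gt_three]
  have : 2 * π * f x' ^ 2 ≤ 2 * π * (2 * (A + B)) := by
    change 2 * π * f x' ^ 2 ≤ A + 2 * π * (A + B) at h2
    nlinarith [mul_nonneg Real.pi_pos.le hB]
  exact le_of_mul_le_mul_left this two_pi_pos

lemma sob_nonneg (j : ℕ) (u : ℝ → ℝ) : 0 ≤ sob j u :=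
  intervalIntegral.integral_nonneg two_pi_nonneg fun _ _ => sq_nonneg _

lemma SmoothPer.jet_sq_le {u : ℝ → ℝ} (hu : SmoothPer u) (j : ℕ) (x : ℝ) :
    jet u x j ^ 2 ≤ 2 * (sob j u + sob (j + 1) u) :=
  sq_le_integral (hu.hasDerivAt j) (hu.continuous (j + 1)) (hu.periodic j) x

/-- Bounds for the derivatives of order at most `m` in `L²`. -/
def SobLE (m : ℕ) (M : ℝ) (u : ℝ → ℝ) : Prop := ∀ j ≤ m, sob j u ≤ M

lemma SobLE.mono {m m' : ℕ} {M M' : ℝ} {u : ℝ → ℝ} (h : SobLE m M u) (hm : m' ≤ m)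
    (hM : M ≤ M') : SobLE m' M' u := fun j hj => (h j (hj.trans hm)).trans hM

lemma SmoothPer.abs_jet_le {u : ℝ → ℝ} (hu : SmoothPer u) {m : ℕ} {M : ℝ} (h : SobLE m M u)
    {j : ℕ} (hj : j + 1 ≤ m) (x : ℝ) : |jet u x j| ≤ 1 + 4 * M := by
  have h1 := hu.jet_sq_le j x
  have h2 := h j (by omega)
  have h3 := h (j + 1) hj
  have h0 := sob_nonneg j u
  refine abs_le_of_sq_le_sq ?_ (by linarith)
  nlinarith

/-- Differential polynomials of low order are bounded in terms of Sobolev norms. -/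
lemma exists_bound_ev {r : ℕ} {p : MvPolynomial ℕ ℝ} (hp : p ∈ ordLE r) (M : ℝ) :
    ∃ B : ℝ, 0 ≤ B ∧ ∀ u, SmoothPer u → ∀ m, r + 1 ≤ m → SobLE m M u → ∀ x, |ev p u x| ≤ B := by
  obtain ⟨B, hB, h⟩ := exists_bound_eval hp (1 + 4 * M)
  exact ⟨B, hB, fun u hu m hm hM x => h _ fun j hj => hu.abs_jet_le hM (by omega) x⟩

/-- Integration by parts for the dispersive part of the weighted energy. -/
lemma integral_weighted_energy {z f g : ℕ → ℝ → ℝ} {gv : ℝ → ℝ} (γ0 γ1 γ2 : ℝ)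
    (hz : ∀ i x, HasDerivAt (z i) (z (i + 1) x) x) (hzp : ∀ i, Function.Periodic (z i) (2 * π))
    (hf : ∀ i x, HasDerivAt (f i) (f (i + 1) x) x) (hfp : ∀ i, Function.Periodic (f i) (2 * π))
    (hg : ∀ i x, HasDerivAt (g i) (g (i + 1) x) x) (hgp : ∀ i, Function.Periodic (g i) (2 * π))
    (hgv : Continuous gv) :
    ∫ x in (0:ℝ)..(2 * π), (2 * z 1 x * (-γ0 * z 6 x - γ1 * z 4 x - γ2 * z 2 x + f 2 x)
      + 2 * g 0 x * z 0 x * (-γ0 * z 5 x - γ1 * z 3 x - γ2 * z 1 x + f 1 x) + gv x * z 0 x ^ 2) =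
    (∫ x in (0:ℝ)..(2 * π), 2 * (z 1 x * f 2 x)) +
    ∫ x in (0:ℝ)..(2 * π), (2 * γ0 * (g 3 x * z 0 x * z 2 x + 3 * g 2 x * z 1 x * z 2 x)
      + 5 * γ0 * g 1 x * z 2 x ^ 2 + 2 * γ1 * (g 1 x * z 0 x * z 2 x + g 0 x * z 1 x * z 2 x)
      - 2 * γ2 * g 0 x * z 0 x * z 1 x - 2 * (g 1 x * z 0 x + g 0 x * z 1 x) * f 0 x
      + gv x * z 0 x ^ 2) := by
  have cz : ∀ i, Continuous (z i) := fun i =>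
    continuous_iff_continuousAt.2 fun x => (hz i x).continuousAt
  have cf : ∀ i, Continuous (f i) := fun i =>
    continuous_iff_continuousAt.2 fun x => (hf i x).continuousAt
  have cg : ∀ i, Continuous (g i) := fun i =>
    continuous_iff_continuousAt.2 fun x => (hg i x).continuousAt
  rw [← intervalIntegral.integral_add
    ((by fun_prop : Continuous fun x => 2 * (z 1 x * f 2 x)).intervalIntegrable _ _)
    (Continuous.intervalIntegrable (by fun_prop) _ _)]
  refine integral_eq_of_hasDerivAt
    (F := fun x => -2 * γ0 * (z 1 x * z 5 x - z 2 x * z 4 x + 1 / 2 * (z 3 x * z 3 x))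
      - 2 * γ1 * (z 1 x * z 3 x - 1 / 2 * (z 2 x * z 2 x)) - γ2 * (z 1 x * z 1 x)
      - 2 * γ0 * (g 0 x * z 0 x * z 4 x - (g 1 x * z 0 x + g 0 x * z 1 x) * z 3 x
        + (g 2 x * z 0 x + 2 * g 1 x * z 1 x + g 0 x * z 2 x) * z 2 x
        - 1 / 2 * (g 0 x * z 2 x * z 2 x))
      - 2 * γ1 * (g 0 x * z 0 x * z 2 x) + 2 * (g 0 x * z 0 x * f 0 x))
    (by fun_prop) (by fun_prop) ?_ ?_
  · intro x
    simp only [hzp _ x, hgp _ x, hfp _ x]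
  · intro x
    have h0 := hz 0 x
    have h1 := hz 1 x
    have h2 := hz 2 x
    have h3 := hz 3 x
    have h4 := hz 4 x
    have h5 := hz 5 x
    have g0 := hg 0 x
    have g1 := hg 1 x
    have g2 := hg 2 x
    have f0 := hf 0 x
    refine (((((((((h1.fun_mul h5).fun_sub (h2.fun_mul h4)).fun_add
      ((h3.fun_mul h3).const_mul (1 / 2))).const_mul (-2 * γ0)).fun_sub
      (((h1.fun_mul h3).fun_sub ((h2.fun_mul h2).const_mul (1 / 2))).const_mul (2 * γ1))).fun_sub
      ((h1.fun_mul h1).const_mul γ2)).fun_sub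
      ((((((g0.fun_mul h0).fun_mul h4).fun_sub
        (((g1.fun_mul h0).fun_add (g0.fun_mul h1)).fun_mul h3)).fun_add
        ((((g2.fun_mul h0).fun_add ((g1.const_mul 2).fun_mul h1)).fun_add
          (g0.fun_mul h2)).fun_mul h2)).fun_sub
        (((g0.fun_mul h2).fun_mul h2).const_mul (1 / 2))).const_mul (2 * γ0))).fun_sub
      (((g0.fun_mul h0).fun_mul h2).const_mul (2 * γ1))).fun_add
      (((g0.fun_mul h0).fun_mul f0).const_mul 2)).congr_deriv ?_
    ring

/-- Integration by parts for the nonlinear part of the energy. -/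
lemma integral_nonlinear_energy {z : ℕ → ℝ → ℝ} {a a' b b' c2 c3 c4 r : ℝ → ℝ}
    (hz : ∀ i x, HasDerivAt (z i) (z (i + 1) x) x) (hzp : ∀ i, Function.Periodic (z i) (2 * π))
    (ha : ∀ x, HasDerivAt a (a' x) x) (hb : ∀ x, HasDerivAt b (b' x) x)
    (hap : Function.Periodic a (2 * π)) (hbp : Function.Periodic b (2 * π))
    (ca' : Continuous a') (cb' : Continuous b') (hc2 : Continuous c2) (hc3 : Continuous c3)
    (hc4 : Continuous c4) (hr : Continuous r) :
    ∫ x in (0:ℝ)..(2 * π), 2 * (z 1 x * (a x * z 4 x + (b x + a' x) * z 3 x + c2 x * z 2 x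
      + c3 x * z 1 x + c4 x * z 0 x + r x)) =
    ∫ x in (0:ℝ)..(2 * π), 2 * (-(b x - 1 / 2 * a' x) * z 2 x ^ 2
      + (c2 x - b' x) * (z 1 x * z 2 x) + c3 x * z 1 x ^ 2 + c4 x * (z 0 x * z 1 x)
      + r x * z 1 x) := by
  have cz : ∀ i, Continuous (z i) := fun i =>
    continuous_iff_continuousAt.2 fun x => (hz i x).continuousAt
  have ca : Continuous a := continuous_iff_continuousAt.2 fun x => (ha x).continuousAt
  have cb : Continuous b := continuous_iff_continuousAt.2 fun x => (hb x).continuousAt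
  refine integral_eq_of_hasDerivAt
    (F := fun x => 2 * (a x * z 1 x * z 3 x - 1 / 2 * (a x * z 2 x * z 2 x)
      + b x * z 1 x * z 2 x)) (by fun_prop) (by fun_prop) ?_ ?_
  · intro x
    simp only [hzp _ x, hap x, hbp x]
  · intro x
    have h1 := hz 1 x
    have h2 := hz 2 x
    have h3 := hz 3 x
    refine ((((((ha x).fun_mul h1).fun_mul h3).fun_sub
      ((((ha x).fun_mul h2).fun_mul h2).const_mul (1 / 2))).fun_add
      (((hb x).fun_mul h1).fun_mul h2)).const_mul 2).congr_deriv ?_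
    ring

/-- The relation between a function `u`, its velocity `v` and the (projected) nonlinearity `f`. -/
structure Flow (γ0 γ1 γ2 : ℝ) (N : MvPolynomial ℕ ℝ) (u v f : ℝ → ℝ) : Prop where
  hu : SmoothPer u
  hv : SmoothPer v
  hf : SmoothPer f
  eq : ∀ x, v x = -γ0 * jet u x 5 - γ1 * jet u x 3 - γ2 * jet u x 1 + f x
  orth : ∀ j, ∫ x in (0:ℝ)..(2 * π), jet u x j * jet f x j =
    ∫ x in (0:ℝ)..(2 * π), jet u x j * ev (totalD^[j] N) u x
  le : ∀ j, sob j f ≤ ∫ x in (0:ℝ)..(2 * π), ev (totalD^[j] N) u x ^ 2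

lemma jet_zero (u : ℝ → ℝ) (x : ℝ) : jet u x 0 = u x := by simp [jet]

section

variable {γ0 γ1 γ2 : ℝ} {N : MvPolynomial ℕ ℝ} {u v f : ℝ → ℝ}

lemma Flow.jet_eq (h : Flow γ0 γ1 γ2 N u v f) (j : ℕ) (x : ℝ) :
    jet v x j = -γ0 * jet u x (j + 5) - γ1 * jet u x (j + 3) - γ2 * jet u x (j + 1)
      + jet f x j := by
  induction j generalizing x with
  | zero => simpa [jet_zero] using h.eq x
  | succ j ih =>
    have h1 := ((((h.hu.hasDerivAt (j + 5) x).const_mul (-γ0)).fun_sub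
      ((h.hu.hasDerivAt (j + 3) x).const_mul γ1)).fun_sub
      ((h.hu.hasDerivAt (j + 1) x).const_mul γ2)).fun_add (h.hf.hasDerivAt j x)
    rw [show (fun x => -γ0 * jet u x (j + 5) - γ1 * jet u x (j + 3) - γ2 * jet u x (j + 1)
      + jet f x j) = fun x => jet v x j from funext fun x => (ih x).symm] at h1
    have h2 := (h.hv.hasDerivAt j x).unique h1
    rw [h2]

end

/-- The parabolicity functional. -/
noncomputable def mean (p : MvPolynomial ℕ ℝ) (u : ℝ → ℝ) : ℝ :=
  (2 * π)⁻¹ * ∫ x in (0:ℝ)..(2 * π), ev p u x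

/-- The coefficient of the parabolic term in the energy identity at level `m`. -/
noncomputable def parab (N : MvPolynomial ℕ ℝ) (m : ℕ) : MvPolynomial ℕ ℝ :=
  pderiv 2 N + C ((m : ℝ) - 3 / 2) * totalD (pderiv 3 N)

lemma parab_mem {N : MvPolynomial ℕ ℝ} (hN : N ∈ ordLE 3) (m : ℕ) : parab N m ∈ ordLE 4 :=
  add_mem (ordLE_mono (by omega) (pderiv_mem_ordLE hN 2))
    (mul_mem (C_mem_ordLE _ _) (totalD_mem_ordLE (pderiv_mem_ordLE hN 3)))

lemma integral_ev_totalD {u : ℝ → ℝ} (hu : SmoothPer u) (p : MvPolynomial ℕ ℝ) :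
    ∫ x in (0:ℝ)..(2 * π), ev (totalD p) u x = 0 :=
  integral_hasDerivAt_eq_zero (hu.ev_hasDerivAt p) (hu.ev_continuous _) (hu.ev_periodic p)

lemma ev_add (p q : MvPolynomial ℕ ℝ) (u : ℝ → ℝ) (x : ℝ) :
    ev (p + q) u x = ev p u x + ev q u x := by simp [ev]

lemma ev_mul (p q : MvPolynomial ℕ ℝ) (u : ℝ → ℝ) (x : ℝ) :
    ev (p * q) u x = ev p u x * ev q u x := by simp [ev]

lemma ev_C (c : ℝ) (u : ℝ → ℝ) (x : ℝ) : ev (C c) u x = c := by simp [ev]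

lemma ev_X (j : ℕ) (u : ℝ → ℝ) (x : ℝ) : ev (X j) u x = jet u x j := by simp [ev]

lemma mean_parab {u : ℝ → ℝ} (hu : SmoothPer u) (N : MvPolynomial ℕ ℝ) (m : ℕ) :
    mean (parab N m) u = mean (pderiv 2 N) u := by
  unfold mean parab
  simp only [ev_add, ev_mul, ev_C]
  rw [intervalIntegral.integral_add ((hu.ev_continuous _).intervalIntegrable _ _)
    (((hu.ev_continuous _).const_mul _).intervalIntegrable _ _),
    intervalIntegral.integral_const_mul, integral_ev_totalD hu, mul_zero, add_zero]

/-- The weight in the modified energy. -/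
noncomputable def weight (γ0 : ℝ) (p : MvPolynomial ℕ ℝ) (u : ℝ → ℝ) (x : ℝ) : ℝ :=
  2 / (5 * γ0) * ∫ y in (0:ℝ)..x, (ev p u y - mean p u)

/-- The weight in the modified energy and its derivatives. -/
noncomputable def weightJet (γ0 : ℝ) (p : MvPolynomial ℕ ℝ) (u : ℝ → ℝ) : ℕ → ℝ → ℝ
  | 0 => weight γ0 p u
  | 1 => fun x => 2 / (5 * γ0) * (ev p u x - mean p u)
  | (i + 2) => fun x => 2 / (5 * γ0) * ev (totalD^[i + 1] p) u x

lemma weightJet_hasDerivAt (γ0 : ℝ) (p : MvPolynomial ℕ ℝ) {u : ℝ → ℝ} (hu : SmoothPer u)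
    (i : ℕ) (x : ℝ) : HasDerivAt (weightJet γ0 p u i) (weightJet γ0 p u (i + 1) x) x := by
  match i with
  | 0 =>
    have hc : Continuous fun y => ev p u y - mean p u := (hu.ev_continuous p).sub continuous_const
    exact (intervalIntegral.integral_hasDerivAt_right (hc.intervalIntegrable _ _)
      (hc.stronglyMeasurableAtFilter _ _) hc.continuousAt).const_mul _
  | 1 => exact ((hu.ev_hasDerivAt p x).sub_const _).const_mul _
  | (i + 2) =>
    have h := (hu.ev_hasDerivAt (totalD^[i + 1] p) x).const_mul (2 / (5 * γ0))
    simp only [weightJet]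
    rw [Function.iterate_succ_apply' _ (i + 1)]
    exact h

lemma integral_sub_mean (f : ℝ → ℝ) (hf : Continuous f) :
    ∫ y in (0:ℝ)..(2 * π), (f y - (2 * π)⁻¹ * ∫ x in (0:ℝ)..(2 * π), f x) = 0 := by
  rw [intervalIntegral.integral_sub (hf.intervalIntegrable _ _)
    (continuous_const.intervalIntegrable _ _), intervalIntegral.integral_const, smul_eq_mul,
    sub_zero, mul_inv_cancel_left₀ two_pi_pos.ne', sub_self]

lemma weightJet_periodic (γ0 : ℝ) (p : MvPolynomial ℕ ℝ) {u : ℝ → ℝ} (hu : SmoothPer u)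
    (i : ℕ) : Function.Periodic (weightJet γ0 p u i) (2 * π) := by
  match i with
  | 0 =>
    intro x
    have hc : Continuous fun y => ev p u y - mean p u := (hu.ev_continuous p).sub continuous_const
    have hp : Function.Periodic (fun y => ev p u y - mean p u) (2 * π) := fun y => by
      simp only [hu.ev_periodic p y]
    simp only [weightJet, weight]
    rw [← intervalIntegral.integral_add_adjacent_intervals (b := x)
      (hc.intervalIntegrable _ _) (hc.intervalIntegrable _ _),
      hp.intervalIntegral_add_eq x 0, zero_add, mean,
      integral_sub_mean _ (hu.ev_continuous p), add_zero]
  | 1 => intro x; simp only [weightJet, hu.ev_periodic p x]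
  | (i + 2) => intro x; simp only [weightJet, hu.ev_periodic _ x]

/-- The time derivative of the weight. -/
noncomputable def weightDot (γ0 : ℝ) (r : ℕ) (p : MvPolynomial ℕ ℝ) (u v : ℝ → ℝ) (x : ℝ) : ℝ :=
  2 / (5 * γ0) * ∫ y in (0:ℝ)..x, (lin r p (jet u y) (jet v y) -
    (2 * π)⁻¹ * ∫ x in (0:ℝ)..(2 * π), lin r p (jet u x) (jet v x))

/-- The time derivative of the modified energy. -/
noncomputable def energyDot (γ0 : ℝ) (N : MvPolynomial ℕ ℝ) (m : ℕ) (u v : ℝ → ℝ) : ℝ :=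
  ∫ x in (0:ℝ)..(2 * π), (2 * jet u x m * jet v x m
    + 2 * weight γ0 (parab N m) u x * jet u x (m - 1) * jet v x (m - 1)
    + weightDot γ0 4 (parab N m) u v x * jet u x (m - 1) ^ 2)

lemma lin_jet_continuous {u v : ℝ → ℝ} (hu : SmoothPer u) (hv : SmoothPer v) (r : ℕ)
    (p : MvPolynomial ℕ ℝ) : Continuous fun x => lin r p (jet u x) (jet v x) := by
  unfold lin
  exact continuous_finsetSum _ fun j _ => (hu.ev_continuous (pderiv j p)).mul (hv.continuous j)

lemma weightDot_continuous {u v : ℝ → ℝ} (hu : SmoothPer u) (hv : SmoothPer v) (γ0 : ℝ) (r : ℕ)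
    (p : MvPolynomial ℕ ℝ) : Continuous (weightDot γ0 r p u v) := by
  have hc : Continuous fun y => lin r p (jet u y) (jet v y) -
      (2 * π)⁻¹ * ∫ x in (0:ℝ)..(2 * π), lin r p (jet u x) (jet v x) :=
    (lin_jet_continuous hu hv r p).sub continuous_const
  exact (intervalIntegral.continuous_primitive (fun a b => hc.intervalIntegrable a b) 0).const_mul _

lemma abs_integral_le {f : ℝ → ℝ} {B : ℝ} (h : ∀ x, |f x| ≤ B) {x : ℝ} (hx : x ∈ Set.Icc 0 (2 * π)) :
    |∫ y in (0:ℝ)..x, f y| ≤ 2 * π * B := by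
  have h1 := intervalIntegral.norm_integral_le_of_norm_le_const (a := 0) (b := x) (f := f) (C := B)
    fun y _ => h y
  rw [Real.norm_eq_abs, sub_zero, abs_of_nonneg hx.1] at h1
  have hB : 0 ≤ B := (abs_nonneg _).trans (h 0)
  nlinarith [mul_le_mul_of_nonneg_left hx.2 hB]

lemma abs_mean_le {f : ℝ → ℝ} {B : ℝ} (h : ∀ x, |f x| ≤ B) :
    |(2 * π)⁻¹ * ∫ y in (0:ℝ)..(2 * π), f y| ≤ B := by
  have h1 := abs_integral_le h (x := 2 * π) ⟨two_pi_nonneg, le_rfl⟩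
  rw [abs_mul, abs_of_nonneg (inv_nonneg.2 two_pi_nonneg), inv_mul_le_iff₀ two_pi_pos]
  exact h1

lemma abs_primitive_le {f : ℝ → ℝ} (hf : Continuous f) (hp : Function.Periodic f (2 * π))
    {B : ℝ} (h : ∀ x, |f x| ≤ B) (x : ℝ) :
    |∫ y in (0:ℝ)..x, (f y - (2 * π)⁻¹ * ∫ z in (0:ℝ)..(2 * π), f z)| ≤ 4 * π * B := by
  set g := fun y => f y - (2 * π)⁻¹ * ∫ z in (0:ℝ)..(2 * π), f z
  have hg : Continuous g := hf.sub continuous_const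
  have hgp : Function.Periodic g (2 * π) := fun y => by simp only [g, hp y]
  have hG : Function.Periodic (fun x => ∫ y in (0:ℝ)..x, g y) (2 * π) := by
    intro x
    simp only
    rw [← intervalIntegral.integral_add_adjacent_intervals (b := x)
      (hg.intervalIntegrable _ _) (hg.intervalIntegrable _ _),
      hgp.intervalIntegral_add_eq x 0, zero_add, integral_sub_mean f hf, add_zero]
  obtain ⟨x', hx', e⟩ := hG.exists_mem_Ico₀ two_pi_pos x
  rw [e]
  have := abs_integral_le (f := g) (B := 2 * B) (fun y => by
    refine (abs_sub _ _).trans ?_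
    linarith [h y, abs_mean_le h]) ⟨hx'.1, hx'.2.le⟩
  linarith

lemma lin_jet_periodic {u v : ℝ → ℝ} (hu : SmoothPer u) (hv : SmoothPer v) (r : ℕ)
    (p : MvPolynomial ℕ ℝ) : Function.Periodic (fun x => lin r p (jet u x) (jet v x)) (2 * π) :=
  fun x => by simp only [hu.jet_periodic x, hv.jet_periodic x]

lemma exists_bound_weight (γ0 : ℝ) {r : ℕ} {p : MvPolynomial ℕ ℝ} (hp : p ∈ ordLE r) (M : ℝ) :
    ∃ B : ℝ, 0 ≤ B ∧ ∀ u, SmoothPer u → ∀ m, r + 1 ≤ m → SobLE m M u →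
      ∀ x, |weight γ0 p u x| ≤ B := by
  obtain ⟨B, hB, h⟩ := exists_bound_ev hp M
  refine ⟨|2 / (5 * γ0)| * (4 * π * B), by positivity, fun u hu m hm hM x => ?_⟩
  rw [weight, abs_mul]
  exact mul_le_mul_of_nonneg_left (abs_primitive_le (hu.ev_continuous p) (hu.ev_periodic p)
    (h u hu m hm hM) x) (abs_nonneg _)

lemma exists_bound_weightJet (γ0 : ℝ) {r : ℕ} {p : MvPolynomial ℕ ℝ} (hp : p ∈ ordLE r) (i : ℕ)
    (M : ℝ) : ∃ B : ℝ, 0 ≤ B ∧ ∀ u, SmoothPer u → ∀ m, r + i + 1 ≤ m → SobLE m M u →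
      ∀ x, |weightJet γ0 p u i x| ≤ B := by
  match i with
  | 0 => exact exists_bound_weight γ0 hp M
  | 1 =>
    obtain ⟨B, hB, h⟩ := exists_bound_ev hp M
    refine ⟨|2 / (5 * γ0)| * (2 * B), by positivity, fun u hu m hm hM x => ?_⟩
    rw [weightJet, abs_mul]
    refine mul_le_mul_of_nonneg_left ((abs_sub _ _).trans ?_) (abs_nonneg _)
    have h' := h u hu m (by omega) hM
    have := abs_mean_le h'
    rw [mean]
    linarith [h' x]
  | (i + 2) =>
    obtain ⟨B, hB, h⟩ := exists_bound_ev (iterate_totalD_mem_ordLE hp (i + 1)) M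
    refine ⟨|2 / (5 * γ0)| * B, by positivity, fun u hu m hm hM x => ?_⟩
    rw [weightJet, abs_mul]
    exact mul_le_mul_of_nonneg_left (h u hu m (by omega) hM x) (abs_nonneg _)

section

variable (γ0 γ1 γ2 : ℝ) {N : MvPolynomial ℕ ℝ}

/-- Pointwise bounds for the velocity. -/
lemma exists_bound_velocity (hN : N ∈ ordLE 3) (j : ℕ) (M : ℝ) :
    ∃ B : ℝ, 0 ≤ B ∧ ∀ u v f, Flow γ0 γ1 γ2 N u v f → ∀ m, j + 6 ≤ m → SobLE m M u →
      ∀ x, |jet v x j| ≤ B := by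
  obtain ⟨B1, hB1, h1⟩ := exists_bound_ev (iterate_totalD_mem_ordLE hN j) M
  obtain ⟨B2, hB2, h2⟩ := exists_bound_ev (iterate_totalD_mem_ordLE hN (j + 1)) M
  refine ⟨(|γ0| + |γ1| + |γ2|) * (1 + |4 * M|) + (1 + 4 * π * (B1 ^ 2 + B2 ^ 2)), by positivity,
    fun u v f h m hm hM x => ?_⟩
  have b0 := h.hu.abs_jet_le hM (j := j + 5) (by omega) x
  have b1 := h.hu.abs_jet_le hM (j := j + 3) (by omega) x
  have b2 := h.hu.abs_jet_le hM (j := j + 1) (by omega) x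
  have l : ∀ {p : MvPolynomial ℕ ℝ} {B : ℝ}, (∀ x, |ev p u x| ≤ B) →
      ∫ x in (0:ℝ)..(2 * π), ev p u x ^ 2 ≤ 2 * π * B ^ 2 := by
    intro p B hB
    have := abs_integral_le (f := fun x => ev p u x ^ 2) (B := B ^ 2)
      (fun x => by rw [abs_pow]; exact pow_le_pow_left₀ (abs_nonneg _) (hB x) 2)
      (x := 2 * π) ⟨two_pi_nonneg, le_rfl⟩
    exact (le_abs_self _).trans this
  have b3 : |jet f x j| ≤ 1 + 4 * π * (B1 ^ 2 + B2 ^ 2) := by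
    have e1 := (h.le j).trans (l (h1 u h.hu m (by omega) hM))
    have e2 := (h.le (j + 1)).trans (l (h2 u h.hu m (by omega) hM))
    have e3 := h.hf.jet_sq_le j x
    have e4 : 0 ≤ 4 * π * (B1 ^ 2 + B2 ^ 2) := by positivity
    refine abs_le_of_sq_le_sq ?_ (by linarith)
    nlinarith
  have c := le_abs_self (4 * M)
  rw [h.jet_eq]
  have t1 : |-γ0 * jet u x (j + 5)| ≤ |γ0| * (1 + |4 * M|) := by
    rw [abs_mul, abs_neg]
    exact mul_le_mul_of_nonneg_left (by linarith) (abs_nonneg _)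
  have t2 : |γ1 * jet u x (j + 3)| ≤ |γ1| * (1 + |4 * M|) := by
    rw [abs_mul]
    exact mul_le_mul_of_nonneg_left (by linarith) (abs_nonneg _)
  have t3 : |γ2 * jet u x (j + 1)| ≤ |γ2| * (1 + |4 * M|) := by
    rw [abs_mul]
    exact mul_le_mul_of_nonneg_left (by linarith) (abs_nonneg _)
  rw [abs_le] at t1 t2 t3 b3 ⊢
  constructor <;> linarith [t1.1, t1.2, t2.1, t2.2, t3.1, t3.2, b3.1, b3.2]

lemma exists_bound_lin (hN : N ∈ ordLE 3) {r : ℕ} {p : MvPolynomial ℕ ℝ} (hp : p ∈ ordLE r)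
    (M : ℝ) :
    ∃ B : ℝ, 0 ≤ B ∧ ∀ u v f, Flow γ0 γ1 γ2 N u v f → ∀ m, r + 6 ≤ m → SobLE m M u →
      ∀ x, |lin r p (jet u x) (jet v x)| ≤ B := by
  choose B1 hB1 h1 using fun j => exists_bound_velocity γ0 γ1 γ2 hN j M
  choose B2 hB2 h2 using fun j => exists_bound_ev (pderiv_mem_ordLE hp j) M
  refine ⟨∑ j ∈ Finset.range (r + 1), B2 j * B1 j,
    Finset.sum_nonneg fun j _ => mul_nonneg (hB2 j) (hB1 j), fun u v f h m hm hM x => ?_⟩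
  refine (Finset.abs_sum_le_sum_abs _ _).trans (Finset.sum_le_sum fun j hj => ?_)
  have := Finset.mem_range.1 hj
  rw [abs_mul]
  exact mul_le_mul (h2 j u h.hu m (by omega) hM x) (h1 j u v f h m (by omega) hM x)
    (abs_nonneg _) (hB2 j)

lemma exists_bound_weightDot (hN : N ∈ ordLE 3) {r : ℕ} {p : MvPolynomial ℕ ℝ} (hp : p ∈ ordLE r)
    (M : ℝ) :
    ∃ B : ℝ, 0 ≤ B ∧ ∀ u v f, Flow γ0 γ1 γ2 N u v f → ∀ m, r + 6 ≤ m → SobLE m M u →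
      ∀ x, |weightDot γ0 r p u v x| ≤ B := by
  obtain ⟨B, hB, h⟩ := exists_bound_lin γ0 γ1 γ2 hN hp M
  refine ⟨|2 / (5 * γ0)| * (4 * π * B), by positivity, fun u v f hu m hm hM x => ?_⟩
  rw [weightDot, abs_mul]
  exact mul_le_mul_of_nonneg_left (abs_primitive_le (lin_jet_continuous hu.hu hu.hv r p)
    (lin_jet_periodic hu.hu hu.hv r p) (h u v f hu m hm hM) x) (abs_nonneg _)

end

lemma mul_mul_le_of_abs_le {A K x y ε : ℝ} (hA : |A| ≤ K) (hε : 0 < ε) :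
    A * (x * y) ≤ ε * y ^ 2 + K ^ 2 / (4 * ε) * x ^ 2 := by
  have h1 : A ^ 2 ≤ K ^ 2 := sq_le_sq' (by linarith [(abs_le.1 hA).1]) (abs_le.1 hA).2
  have h2 : A * (x * y) ≤ ε * y ^ 2 + A ^ 2 / (4 * ε) * x ^ 2 := by
    have : ε * y ^ 2 + A ^ 2 / (4 * ε) * x ^ 2 - A * (x * y) = ε * (y - A * x / (2 * ε)) ^ 2 := by
      field_simp
      ring
    nlinarith [mul_nonneg hε.le (sq_nonneg (y - A * x / (2 * ε)))]
  have h3 : A ^ 2 / (4 * ε) * x ^ 2 ≤ K ^ 2 / (4 * ε) * x ^ 2 := by gcongr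
  linarith

/-- Absorption of the lower order terms in the energy estimate. -/
lemma energy_young {δ η K q w w1 z F A1 A2 A3 A4 A5 A6 A7 A8 : ℝ} (hδ : 0 < δ) (hη : 0 < η)
    (hq : δ ≤ q) (h1 : |A1| ≤ K) (h2 : |A2| ≤ K) (h3 : |A3| ≤ K) (h4 : |A4| ≤ K) (h5 : |A5| ≤ K)
    (h6 : |A6| ≤ K) (h7 : |A7| ≤ K) (h8 : |A8| ≤ K) :
    -2 * q * w1 ^ 2 + A1 * (w * w1) + A2 * (z * w1) + A3 * w ^ 2 + A4 * (w * z) + A5 * (1 * w)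
      + A6 * (z * F) + A7 * (w * F) + A8 * z ^ 2 ≤
    -(3 / 2) * δ * w1 ^ 2 + η * F ^ 2 + (K ^ 2 / δ + K ^ 2 / (2 * η) + K + K ^ 2 + 1)
      * (1 + w ^ 2 + z ^ 2) := by
  have e1 := mul_mul_le_of_abs_le (x := w) (y := w1) h1 (ε := δ / 4) (by positivity)
  have e2 := mul_mul_le_of_abs_le (x := z) (y := w1) h2 (ε := δ / 4) (by positivity)
  have e4 := mul_mul_le_of_abs_le (x := w) (y := z) h4 (ε := 1 / 2) (by positivity)
  have e5 := mul_mul_le_of_abs_le (x := 1) (y := w) h5 (ε := 1 / 2) (by positivity)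
  have e6 := mul_mul_le_of_abs_le (x := z) (y := F) h6 (ε := η / 2) (by positivity)
  have e7 := mul_mul_le_of_abs_le (x := w) (y := F) h7 (ε := η / 2) (by positivity)
  have e3 : A3 * w ^ 2 ≤ K * w ^ 2 :=
    mul_le_mul_of_nonneg_right (abs_le.1 h3).2 (sq_nonneg _)
  have e8 : A8 * z ^ 2 ≤ K * z ^ 2 :=
    mul_le_mul_of_nonneg_right (abs_le.1 h8).2 (sq_nonneg _)
  have e0 : -2 * q * w1 ^ 2 ≤ -2 * δ * w1 ^ 2 := by nlinarith [sq_nonneg w1]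
  have r1 : K ^ 2 / (4 * (δ / 4)) = K ^ 2 / δ := by congr 1; ring
  have r2 : K ^ 2 / (4 * (η / 2)) = K ^ 2 / (2 * η) := by congr 1; ring
  have r3 : K ^ 2 / (4 * (1 / 2)) = K ^ 2 / 2 := by norm_num
  rw [r1] at e1 e2
  rw [r2] at e6 e7
  rw [r3] at e4 e5
  have p1 : 0 ≤ K ^ 2 / δ := by positivity
  have p2 : 0 ≤ K ^ 2 / (2 * η) := by positivity
  have p3 : 0 ≤ K := (abs_nonneg _).trans h1
  nlinarith [mul_nonneg p1 (sq_nonneg w), mul_nonneg p1 (sq_nonneg z),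
    mul_nonneg p2 (sq_nonneg w), mul_nonneg p2 (sq_nonneg z), mul_nonneg p3 (sq_nonneg w),
    mul_nonneg p3 (sq_nonneg z), mul_nonneg (sq_nonneg K) (sq_nonneg w),
    mul_nonneg (sq_nonneg K) (sq_nonneg z), sq_nonneg w, sq_nonneg z]

section

variable (γ0 γ1 γ2 : ℝ) {N : MvPolynomial ℕ ℝ}

/-- `L²` bound for the projected nonlinearity. -/
lemma exists_bound_forcing (hN : N ∈ ordLE 3) {m : ℕ} (hm : 7 ≤ m) (M : ℝ) :
    ∃ K : ℝ, 1 ≤ K ∧ ∀ u v f, Flow γ0 γ1 γ2 N u v f → SobLE (m - 1) M u →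
      sob (m - 2) f ≤ ∫ x in (0:ℝ)..(2 * π),
        4 * K ^ 2 * (jet u x (m + 1) ^ 2 + jet u x m ^ 2 + jet u x (m - 1) ^ 2 + 1) := by
  obtain ⟨c0, c1, c2, r, h0, h1, h2, hr, e⟩ := iterate_totalD_structure_low hN (m - 2) (by omega)
  rw [show m - 2 + 3 = m + 1 by omega, show m - 2 + 2 = m by omega,
    show m - 2 + 1 = m - 1 by omega] at e
  obtain ⟨K0, hK0, b0⟩ := exists_bound_ev h0 M
  obtain ⟨K1, hK1, b1⟩ := exists_bound_ev h1 M
  obtain ⟨K2, hK2, b2⟩ := exists_bound_ev h2 M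
  obtain ⟨K3, hK3, b3⟩ := exists_bound_ev hr M
  refine ⟨1 + K0 + K1 + K2 + K3, by linarith, fun u v f h hM => (h.le _).trans ?_⟩
  refine integral_mono_of_continuous ((h.hu.ev_continuous _).pow 2) ?_ fun x => ?_
  · have := h.hu.continuous
    fun_prop
  set K := 1 + K0 + K1 + K2 + K3
  have a0 : ev c0 u x ^ 2 ≤ K ^ 2 := sq_le_sq.2
    (((b0 u h.hu (m - 1) (by omega) hM x).trans (by linarith)).trans (le_abs_self _))
  have a1 : ev c1 u x ^ 2 ≤ K ^ 2 := sq_le_sq.2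
    (((b1 u h.hu (m - 1) (by omega) hM x).trans (by linarith)).trans (le_abs_self _))
  have a2 : ev c2 u x ^ 2 ≤ K ^ 2 := sq_le_sq.2
    (((b2 u h.hu (m - 1) (by omega) hM x).trans (by linarith)).trans (le_abs_self _))
  have a3 : ev r u x ^ 2 ≤ K ^ 2 := sq_le_sq.2
    (((b3 u h.hu (m - 1) (by omega) hM x).trans (by linarith)).trans (le_abs_self _))
  rw [e]
  simp only [ev_add, ev_mul, ev_X]
  generalize jet u x (m + 1) = w1
  generalize jet u x m = w
  generalize jet u x (m - 1) = z
  generalize ev c0 u x = A0 at *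
  generalize ev c1 u x = A1 at *
  generalize ev c2 u x = A2 at *
  generalize ev r u x = A3 at *
  have i1 : (A0 * w1 + A1 * w + A2 * z + A3) ^ 2 ≤
      4 * ((A0 * w1) ^ 2 + (A1 * w) ^ 2 + (A2 * z) ^ 2 + A3 ^ 2) := by
    nlinarith [sq_nonneg (A0 * w1 - A1 * w), sq_nonneg (A0 * w1 - A2 * z),
      sq_nonneg (A0 * w1 - A3), sq_nonneg (A1 * w - A2 * z), sq_nonneg (A1 * w - A3),
      sq_nonneg (A2 * z - A3)]
  have j0 : (A0 * w1) ^ 2 ≤ K ^ 2 * w1 ^ 2 := by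
    rw [mul_pow]; exact mul_le_mul_of_nonneg_right a0 (sq_nonneg _)
  have j1 : (A1 * w) ^ 2 ≤ K ^ 2 * w ^ 2 := by
    rw [mul_pow]; exact mul_le_mul_of_nonneg_right a1 (sq_nonneg _)
  have j2 : (A2 * z) ^ 2 ≤ K ^ 2 * z ^ 2 := by
    rw [mul_pow]; exact mul_le_mul_of_nonneg_right a2 (sq_nonneg _)
  linarith

/-- The energy identity: the derivative of the modified energy has no terms of order higher
than `m + 1`, and the quadratic terms of order `m + 1` have a constant coefficient. -/
lemma energyDot_eq (hγ0 : γ0 ≠ 0) (hN : N ∈ ordLE 3) {m : ℕ} (hm : 9 ≤ m) :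
    ∃ c3 c4 d r : MvPolynomial ℕ ℝ, c3 ∈ ordLE 7 ∧ c4 ∈ ordLE 7 ∧
      d ∈ ordLE 7 ∧ r ∈ ordLE (m - 2) ∧ ∀ u v f, Flow γ0 γ1 γ2 N u v f →
      energyDot γ0 N m u v = ∫ x in (0:ℝ)..(2 * π),
        (-2 * mean (parab N m) u * jet u x (m + 1) ^ 2
        + (2 * ev d u x + 6 * γ0 * weightJet γ0 (parab N m) u 2 x
          + 2 * γ1 * weightJet γ0 (parab N m) u 0 x) * (jet u x m * jet u x (m + 1))
        + (2 * γ0 * weightJet γ0 (parab N m) u 3 x + 2 * γ1 * weightJet γ0 (parab N m) u 1 x)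
          * (jet u x (m - 1) * jet u x (m + 1))
        + 2 * ev c3 u x * jet u x m ^ 2
        + (2 * ev c4 u x - 2 * γ2 * weightJet γ0 (parab N m) u 0 x)
          * (jet u x m * jet u x (m - 1))
        + 2 * ev r u x * (1 * jet u x m)
        + -2 * weightJet γ0 (parab N m) u 1 x * (jet u x (m - 1) * jet f x (m - 2))
        + -2 * weightJet γ0 (parab N m) u 0 x * (jet u x m * jet f x (m - 2))
        + weightDot γ0 4 (parab N m) u v x * jet u x (m - 1) ^ 2) := by
  obtain ⟨c2, c3, c4, r, h2, h3, h4, hr, e⟩ := iterate_totalD_structure hN m hm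
  set a := pderiv 3 N with ha
  have haN : a ∈ ordLE 3 := pderiv_mem_ordLE hN 3
  set b : MvPolynomial ℕ ℝ := pderiv 2 N + C ((m : ℝ) - 1) * totalD a with hb
  have hbN : b ∈ ordLE 4 := add_mem (ordLE_mono (by omega) (pderiv_mem_ordLE hN 2))
    (mul_mem (C_mem_ordLE _ _) (totalD_mem_ordLE haN))
  refine ⟨c3, c4, c2 - totalD b, r, h3, h4,
    sub_mem h2 (ordLE_mono (by omega) (totalD_mem_ordLE hbN)), hr, fun u v f h => ?_⟩
  have hu := h.hu
  have hf := h.hf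
  obtain ⟨k, rfl⟩ : ∃ k, m = k + 2 := ⟨m - 2, by omega⟩
  simp only [show k + 2 - 1 = k + 1 by omega, show k + 2 - 2 = k by omega] at *
  have E1 := integral_weighted_energy (z := fun i x => jet u x (k + 1 + i))
    (f := fun i x => jet f x (k + i)) (g := weightJet γ0 (parab N (k + 2)) u)
    (gv := weightDot γ0 4 (parab N (k + 2)) u v) γ0 γ1 γ2
    (fun i x => hu.hasDerivAt _ x) (fun i => hu.periodic _)
    (fun i x => hf.hasDerivAt _ x) (fun i => hf.periodic _)
    (weightJet_hasDerivAt γ0 _ hu) (weightJet_periodic γ0 _ hu)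
    (weightDot_continuous hu h.hv _ _ _)
  have E2 := integral_nonlinear_energy (z := fun i x => jet u x (k + 1 + i))
    (a := ev a u) (a' := ev (totalD a) u) (b := ev b u) (b' := ev (totalD b) u)
    (c2 := ev c2 u) (c3 := ev c3 u) (c4 := ev c4 u) (r := ev r u)
    (fun i x => hu.hasDerivAt _ x) (fun i => hu.periodic _)
    (hu.ev_hasDerivAt a) (hu.ev_hasDerivAt b) (hu.ev_periodic a) (hu.ev_periodic b)
    (hu.ev_continuous _) (hu.ev_continuous _) (hu.ev_continuous _) (hu.ev_continuous _)
    (hu.ev_continuous _) (hu.ev_continuous _)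
  have E3 : ∫ x in (0:ℝ)..(2 * π), 2 * (jet u x (k + 2) * jet f x (k + 2)) =
      ∫ x in (0:ℝ)..(2 * π), 2 * (jet u x (k + 2) * ev (totalD^[k + 2] N) u x) := by
    rw [intervalIntegral.integral_const_mul, intervalIntegral.integral_const_mul,
      h.orth (k + 2)]
  have E4 : ∀ x, ev (totalD^[k + 2] N) u x = ev a u x * jet u x (k + 5) +
      (ev b u x + ev (totalD a) u x) * jet u x (k + 4) + ev c2 u x * jet u x (k + 3) +
      ev c3 u x * jet u x (k + 2) + ev c4 u x * jet u x (k + 1) + ev r u x := by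
    intro x
    rw [e, hb]
    simp only [ev_add, ev_mul, ev_X, ev_C]
    push_cast
    ring_nf
  simp only [show k + 1 + 0 = k + 1 from rfl, show k + 1 + 1 = k + 2 from rfl,
    show k + 1 + 2 = k + 3 from rfl, show k + 1 + 3 = k + 4 from rfl, show k + 1 + 4 = k + 5 from rfl,
    show k + 1 + 5 = k + 6 from rfl, show k + 1 + 6 = k + 7 from rfl, show k + 0 = k from rfl] at E1 E2
  simp only [E4] at E3
  refine Eq.trans ?_ (E1.trans ?_)
  · unfold energyDot
    refine intervalIntegral.integral_congr fun x _ => ?_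
    simp only [h.jet_eq, show k + 2 - 1 = k + 1 by omega, weightJet, show k + 2 + 1 = k + 3 from rfl,
      show k + 2 + 3 = k + 5 from rfl, show k + 2 + 5 = k + 7 from rfl,
      show k + 1 + 1 = k + 2 from rfl, show k + 1 + 3 = k + 4 from rfl,
      show k + 1 + 5 = k + 6 from rfl]
  rw [E3, E2, ← intervalIntegral.integral_add]
  · refine intervalIntegral.integral_congr fun x _ => ?_
    have hq : ev b u x - 1 / 2 * ev (totalD a) u x = ev (parab N (k + 2)) u x := by
      simp only [parab, hb, ev_add, ev_mul, ev_C, ← ha]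
      ring
    have hd : ev (c2 - totalD b) u x = ev c2 u x - ev (totalD b) u x := by simp [ev]
    have hg : 5 * γ0 * weightJet γ0 (parab N (k + 2)) u 1 x =
        2 * (ev (parab N (k + 2)) u x - mean (parab N (k + 2)) u) := by
      simp only [weightJet]
      field_simp
    simp only [show k + 2 + 1 = k + 3 from rfl]
    rw [hq, hg, hd]
    ring
  · have c1 := hu.continuous
    have c2 := hu.ev_continuous
    exact Continuous.intervalIntegrable (by fun_prop) _ _
  · have c1 := hu.continuous
    have c1' := hf.continuous
    have c2 := hu.ev_continuous
    have c3 := weightDot_continuous hu h.hv γ0 4 (parab N (k + 2))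
    have c4 : ∀ i, Continuous (weightJet γ0 (parab N (k + 2)) u i) := fun i =>
      continuous_iff_continuousAt.2 fun x => (weightJet_hasDerivAt γ0 _ hu i x).continuousAt
    exact Continuous.intervalIntegrable (by fun_prop) _ _

end

lemma weightJet_continuous (γ0 : ℝ) (p : MvPolynomial ℕ ℝ) {u : ℝ → ℝ} (hu : SmoothPer u)
    (i : ℕ) : Continuous (weightJet γ0 p u i) :=
  continuous_iff_continuousAt.2 fun x => (weightJet_hasDerivAt γ0 p hu i x).continuousAt

lemma energy_scalar {δ K1 C0 M SF Sz Sw S1 : ℝ} (hδ : 0 < δ) (hK1 : 0 < K1) (hC0 : 0 ≤ C0)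
    (s1 : 0 ≤ Sw)
    (I2 : SF ≤ 4 * K1 ^ 2 * (S1 + Sw + Sz + (2 * π - 0) * 1)) (I3 : Sz ≤ |M|) :
    -(3 / 2) * δ * S1 + δ / (8 * K1 ^ 2) * SF + C0 * ((2 * π - 0) * 1 + Sw + Sz)
      ≤ (δ / 2 + C0) * (2 * π + 1 + |M|) * (1 + Sw) - δ * S1 := by
  have I4 : δ / (8 * K1 ^ 2) * SF ≤ δ / 2 * (S1 + Sw + Sz + (2 * π - 0) * 1) := by
    refine (mul_le_mul_of_nonneg_left I2 (by positivity)).trans (le_of_eq ?_)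
    field_simp
    ring
  have hD : 0 ≤ δ / 2 + C0 := by positivity
  have I5 : (δ / 2 + C0) * (2 * π + Sw + Sz) ≤ (δ / 2 + C0) * ((2 * π + 1 + |M|) * (1 + Sw)) := by
    refine mul_le_mul_of_nonneg_left ?_ hD
    nlinarith [mul_nonneg Real.pi_pos.le s1, mul_nonneg (abs_nonneg M) s1]
  linarith

set_option maxHeartbeats 1000000 in
/-- The energy estimate. -/
theorem exists_energyDot_le (γ0 γ1 γ2 : ℝ) {N : MvPolynomial ℕ ℝ} (hγ0 : γ0 ≠ 0)
    (hN : N ∈ ordLE 3) {m : ℕ} (hm : 12 ≤ m) (M : ℝ) {δ : ℝ} (hδ : 0 < δ) :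
    ∃ C : ℝ, 0 ≤ C ∧ ∀ u v f, Flow γ0 γ1 γ2 N u v f → SobLE (m - 1) M u →
      δ ≤ mean (pderiv 2 N) u →
      energyDot γ0 N m u v ≤ C * (1 + sob m u) - δ * sob (m + 1) u := by
  obtain ⟨c3, c4, d, r, h3, h4, hd, hr, key⟩ := energyDot_eq γ0 γ1 γ2 hγ0 hN (m := m) (by omega)
  obtain ⟨B3, hB3, b3⟩ := exists_bound_ev h3 M
  obtain ⟨B4, hB4, b4⟩ := exists_bound_ev h4 M
  obtain ⟨Bd, hBd, bd⟩ := exists_bound_ev hd M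
  obtain ⟨Br, hBr, br⟩ := exists_bound_ev hr M
  choose G hG bG using fun i => exists_bound_weightJet γ0 (parab_mem hN m) i M
  obtain ⟨Bv, hBv, bv⟩ := exists_bound_weightDot γ0 γ1 γ2 hN (parab_mem hN m) M
  obtain ⟨K1, hK1, bf⟩ := exists_bound_forcing γ0 γ1 γ2 hN (m := m) (by omega) M
  set K : ℝ := 2 * B3 + 2 * B4 + 2 * Bd + 2 * Br + Bv + 6 * |γ0| * G 2 + 2 * |γ1| * G 0
    + 2 * |γ0| * G 3 + 2 * |γ1| * G 1 + 2 * |γ2| * G 0 + 2 * G 1 + 2 * G 0 with hK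
  have n0 := hG 0
  have n1 := hG 1
  have n2 := hG 2
  have n3 := hG 3
  have p0 : 0 ≤ |γ0| * G 2 := by positivity
  have p1 : 0 ≤ |γ1| * G 0 := by positivity
  have p2 : 0 ≤ |γ0| * G 3 := by positivity
  have p3 : 0 ≤ |γ1| * G 1 := by positivity
  have p4 : 0 ≤ |γ2| * G 0 := by positivity
  set η : ℝ := δ / (8 * K1 ^ 2) with hη
  have hη0 : 0 < η := by positivity
  set C0 : ℝ := K ^ 2 / δ + K ^ 2 / (2 * η) + K + K ^ 2 + 1 with hC0
  have hKn : 0 ≤ K := by rw [hK]; positivity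
  have hC0n : 0 ≤ C0 := by positivity
  refine ⟨(δ / 2 + C0) * (2 * π + 1 + |M|), by positivity, fun u v f h hM hq => ?_⟩
  have hu := h.hu
  have cu := hu.continuous
  have cf := h.hf.continuous
  have ce := hu.ev_continuous
  have cg := weightJet_continuous γ0 (parab N m) hu
  have cv := weightDot_continuous hu h.hv γ0 4 (parab N m)
  rw [← mean_parab hu N m] at hq
  rw [key u v f h]
  have I1 := integral_mono_of_continuous (f := fun x =>
        (-2 * mean (parab N m) u * jet u x (m + 1) ^ 2
        + (2 * ev d u x + 6 * γ0 * weightJet γ0 (parab N m) u 2 x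
          + 2 * γ1 * weightJet γ0 (parab N m) u 0 x) * (jet u x m * jet u x (m + 1))
        + (2 * γ0 * weightJet γ0 (parab N m) u 3 x + 2 * γ1 * weightJet γ0 (parab N m) u 1 x)
          * (jet u x (m - 1) * jet u x (m + 1))
        + 2 * ev c3 u x * jet u x m ^ 2
        + (2 * ev c4 u x - 2 * γ2 * weightJet γ0 (parab N m) u 0 x)
          * (jet u x m * jet u x (m - 1))
        + 2 * ev r u x * (1 * jet u x m)
        + -2 * weightJet γ0 (parab N m) u 1 x * (jet u x (m - 1) * jet f x (m - 2))
        + -2 * weightJet γ0 (parab N m) u 0 x * (jet u x m * jet f x (m - 2))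
        + weightDot γ0 4 (parab N m) u v x * jet u x (m - 1) ^ 2))
    (g := fun x => -(3 / 2) * δ * jet u x (m + 1) ^ 2 + η * jet f x (m - 2) ^ 2
      + C0 * (1 + jet u x m ^ 2 + jet u x (m - 1) ^ 2)) (by fun_prop) (by fun_prop) (fun x => by
      have e0 := bG 0 u hu (m - 1) (by omega) hM x
      have e1 := bG 1 u hu (m - 1) (by omega) hM x
      have e2 := bG 2 u hu (m - 1) (by omega) hM x
      have e3 := bG 3 u hu (m - 1) (by omega) hM x
      have q0 : ∀ γ c : ℝ, ∀ i, |weightJet γ0 (parab N m) u i x| ≤ G i → 0 ≤ c →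
          |c * γ * weightJet γ0 (parab N m) u i x| ≤ c * |γ| * G i := by
        intro γ c i hi hc
        rw [abs_mul, abs_mul, abs_of_nonneg hc]
        exact mul_le_mul_of_nonneg_left hi (by positivity)
      have t3 := b3 u hu (m - 1) (by omega) hM x
      have t4 := b4 u hu (m - 1) (by omega) hM x
      have td := bd u hu (m - 1) (by omega) hM x
      have tr := br u hu (m - 1) (by omega) hM x
      have tv := bv u v f h (m - 1) (by omega) hM x
      have q1 := q0 γ0 6 2 e2 (by norm_num)
      have q2 := q0 γ1 2 0 e0 (by norm_num)
      have q3 := q0 γ0 2 3 e3 (by norm_num)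
      have q4 := q0 γ1 2 1 e1 (by norm_num)
      have q5 := q0 γ2 2 0 e0 (by norm_num)
      rw [abs_le] at e0 e1 t3 t4 td tr tv q1 q2 q3 q4 q5
      refine energy_young hδ hη0 hq ?_ ?_ ?_ ?_ ?_ ?_ ?_ ?_ <;> rw [abs_le] <;> constructor <;>
        linarith [e0.1, e0.2, e1.1, e1.2, t3.1, t3.2, t4.1, t4.2, td.1, td.2, tr.1, tr.2, tv.1,
          tv.2, q1.1, q1.2, q2.1, q2.2, q3.1, q3.2, q4.1, q4.2, q5.1, q5.2])
  refine I1.trans ?_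
  have ic : ∀ {F : ℝ → ℝ}, Continuous F → IntervalIntegrable F MeasureTheory.volume 0 (2 * π) :=
    fun h => h.intervalIntegrable _ _
  rw [intervalIntegral.integral_add (ic (by fun_prop)) (ic (by fun_prop)),
    intervalIntegral.integral_add (ic (by fun_prop)) (ic (by fun_prop)),
    intervalIntegral.integral_const_mul, intervalIntegral.integral_const_mul,
    intervalIntegral.integral_const_mul,
    intervalIntegral.integral_add (ic (by fun_prop)) (ic (by fun_prop)),
    intervalIntegral.integral_add (ic (by fun_prop)) (ic (by fun_prop)),
    intervalIntegral.integral_const, smul_eq_mul]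
  have I2 := bf u v f h hM
  rw [intervalIntegral.integral_const_mul,
    intervalIntegral.integral_add (ic (by fun_prop)) (ic (by fun_prop)),
    intervalIntegral.integral_add (ic (by fun_prop)) (ic (by fun_prop)),
    intervalIntegral.integral_add (ic (by fun_prop)) (ic (by fun_prop)),
    intervalIntegral.integral_const, smul_eq_mul] at I2
  have I3 : sob (m - 1) u ≤ |M| := (hM _ le_rfl).trans (le_abs_self M)
  have s0 := sob_nonneg (m - 1) u
  have s1 := sob_nonneg m u
  have s2 := sob_nonneg (m + 1) u
  simp only [sob] at I2 I3 s0 s1 s2 ⊢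
  generalize (∫ x in (0:ℝ)..(2 * π), jet f x (m - 2) ^ 2) = SF at *
  generalize (∫ x in (0:ℝ)..(2 * π), jet u x (m - 1) ^ 2) = Sz at *
  generalize (∫ x in (0:ℝ)..(2 * π), jet u x m ^ 2) = Sw at *
  generalize (∫ x in (0:ℝ)..(2 * π), jet u x (m + 1) ^ 2) = S1 at *
  exact energy_scalar hδ (by linarith) hC0n s1 I2 I3

/-- The modified energy. -/
noncomputable def energyCorr (γ0 : ℝ) (N : MvPolynomial ℕ ℝ) (m : ℕ) (u : ℝ → ℝ) : ℝ :=
  ∫ x in (0:ℝ)..(2 * π), weight γ0 (parab N m) u x * jet u x (m - 1) ^ 2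

lemma weight_continuous (γ0 : ℝ) (p : MvPolynomial ℕ ℝ) {u : ℝ → ℝ} (hu : SmoothPer u) :
    Continuous (weight γ0 p u) := weightJet_continuous γ0 p hu 0

lemma exists_bound_energyCorr (γ0 : ℝ) {N : MvPolynomial ℕ ℝ} (hN : N ∈ ordLE 3) {m : ℕ}
    (hm : 6 ≤ m) (M : ℝ) : ∃ B : ℝ, 0 ≤ B ∧ ∀ u, SmoothPer u → SobLE (m - 1) M u →
      |energyCorr γ0 N m u| ≤ B := by
  obtain ⟨B, hB, b⟩ := exists_bound_weight γ0 (parab_mem hN m) M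
  refine ⟨B * |M|, by positivity, fun u hu hM => ?_⟩
  have cu := hu.continuous
  have cw := weight_continuous γ0 (parab N m) hu
  have b' := b u hu (m - 1) (by omega) hM
  have h1 : ∫ x in (0:ℝ)..(2 * π), B * jet u x (m - 1) ^ 2 ≤ B * |M| := by
    rw [intervalIntegral.integral_const_mul]
    exact mul_le_mul_of_nonneg_left ((hM _ le_rfl).trans (le_abs_self M)) hB
  rw [abs_le]
  constructor
  · have h2 := integral_mono_of_continuous (f := fun x => -(B * jet u x (m - 1) ^ 2))
      (g := fun x => weight γ0 (parab N m) u x * jet u x (m - 1) ^ 2) (by fun_prop) (by fun_prop)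
      fun x => by nlinarith [(abs_le.1 (b' x)).1, sq_nonneg (jet u x (m - 1))]
    rw [intervalIntegral.integral_neg] at h2
    exact (neg_le_neg h1).trans h2
  · exact (integral_mono_of_continuous (f := fun x => weight γ0 (parab N m) u x * jet u x (m - 1) ^ 2)
      (g := fun x => (B * jet u x (m - 1) ^ 2)) (by fun_prop) (by fun_prop)
      fun x => by nlinarith [(abs_le.1 (b' x)).2, sq_nonneg (jet u x (m - 1))]).trans h1

/-- The exponential `e^{ikx}`. -/
noncomputable def ek (k : ℤ) (x : ℝ) : ℂ := Complex.exp (Complex.I * k * x)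

@[fun_prop]
lemma ek_continuous (k : ℤ) : Continuous (ek k) := by unfold ek; fun_prop

lemma ek_zero (x : ℝ) : ek 0 x = 1 := by simp [ek]

lemma ek_mul (k l : ℤ) (x : ℝ) : ek k x * ek l x = ek (k + l) x := by
  simp only [ek, ← Complex.exp_add]
  congr 1
  push_cast
  ring

lemma conj_ek (k : ℤ) (x : ℝ) : (starRingEnd ℂ) (ek k x) = ek (-k) x := by
  simp only [ek, ← Complex.exp_conj]
  congr 1
  simp

lemma norm_ek (k : ℤ) (x : ℝ) : ‖ek k x‖ = 1 := by
  rw [ek, show Complex.I * k * x = ((k * x : ℝ) : ℂ) * Complex.I by push_cast; ring]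
  exact Complex.norm_exp_ofReal_mul_I _

lemma ek_periodic (k : ℤ) (x : ℝ) : ek k (x + 2 * π) = ek k x := by
  simp only [ek]
  rw [show Complex.I * k * ((x + 2 * π : ℝ) : ℂ) = Complex.I * k * x + k * (2 * π * Complex.I) by
    push_cast; ring, Complex.exp_add, Complex.exp_int_mul_two_pi_mul_I, mul_one]

lemma ek_hasDerivAt (k : ℤ) (x : ℝ) : HasDerivAt (ek k) (Complex.I * k * ek k x) x := by
  have h : HasDerivAt (fun y : ℝ => Complex.I * k * (y : ℂ)) (Complex.I * k) x := by
    simpa using (Complex.ofRealCLM.hasDerivAt (x := x)).const_mul (Complex.I * k)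
  have := h.cexp
  rw [mul_comm (Complex.exp _)] at this
  exact this

lemma integral_ek (k : ℤ) :
    ∫ x in (0:ℝ)..(2 * π), ek k x = if k = 0 then ((2 * π : ℝ) : ℂ) else 0 := by
  split_ifs with h
  · subst h
    simp [ek_zero]
  · have hk : Complex.I * k ≠ 0 := mul_ne_zero Complex.I_ne_zero (by exact_mod_cast h)
    have e : ∀ x, HasDerivAt (fun y => (Complex.I * k)⁻¹ * ek k y) (ek k x) x := fun x => by
      have := (ek_hasDerivAt k x).const_mul (Complex.I * k)⁻¹
      rwa [← mul_assoc, inv_mul_cancel₀ hk, one_mul] at this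
    rw [intervalIntegral.integral_eq_sub_of_hasDerivAt (fun x _ => e x)
      ((ek_continuous k).intervalIntegrable _ _)]
    have := ek_periodic k 0
    rw [zero_add] at this
    rw [this, sub_self]

lemma fc_eq (f : ℝ → ℝ) (k : ℤ) :
    fc f k = ((2 * π : ℝ) : ℂ)⁻¹ * ∫ x in (0:ℝ)..(2 * π), (f x : ℂ) * ek (-k) x := by
  rw [fc]
  congr 2
  ext x
  rw [ek]
  congr 2
  push_cast
  ring

lemma integral_mul_ek (f : ℝ → ℝ) (k : ℤ) :
    ∫ x in (0:ℝ)..(2 * π), (f x : ℂ) * ek k x = ((2 * π : ℝ) : ℂ) * fc f (-k) := by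
  rw [fc_eq, neg_neg, mul_inv_cancel_left₀]
  exact_mod_cast Real.two_pi_pos.ne'

lemma fc_neg (f : ℝ → ℝ) (k : ℤ) : fc f (-k) = (starRingEnd ℂ) (fc f k) := by
  rw [fc_eq, fc_eq, map_mul, map_inv₀, Complex.conj_ofReal]
  congr 1
  rw [intervalIntegral.integral_of_le two_pi_nonneg, intervalIntegral.integral_of_le two_pi_nonneg,
    ← integral_conj]
  simp [conj_ek]

lemma norm_fc_le {f : ℝ → ℝ} {B : ℝ} (h : ∀ x, |f x| ≤ B) (k : ℤ) : ‖fc f k‖ ≤ B := by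
  rw [fc_eq, norm_mul, norm_inv]
  have := intervalIntegral.norm_integral_le_of_norm_le_const (a := 0) (b := 2 * π) (C := B)
    (f := fun x => (f x : ℂ) * ek (-k) x) (fun x _ => by
      rw [norm_mul, norm_ek, mul_one, Complex.norm_real]; exact h x)
  rw [sub_zero, abs_of_pos Real.two_pi_pos] at this
  rw [Complex.norm_real, norm_of_nonneg Real.two_pi_pos.le, inv_mul_le_iff₀ Real.two_pi_pos]
  linarith

lemma fc_add {f g : ℝ → ℝ} (hf : Continuous f) (hg : Continuous g) (k : ℤ) :
    fc (fun x => f x + g x) k = fc f k + fc g k := by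
  simp only [fc_eq]
  rw [← mul_add, ← intervalIntegral.integral_add
    (Continuous.intervalIntegrable (by fun_prop) _ _)
    (Continuous.intervalIntegrable (by fun_prop) _ _)]
  simp only [Complex.ofReal_add, add_mul]

lemma fc_const_mul (r : ℝ) (f : ℝ → ℝ) (k : ℤ) : fc (fun x => r * f x) k = r * fc f k := by
  simp only [fc_eq]
  rw [mul_left_comm, ← intervalIntegral.integral_const_mul (r : ℂ)]
  congr 2
  simp only [Complex.ofReal_mul, mul_assoc]

lemma fc_sub {f g : ℝ → ℝ} (hf : Continuous f) (hg : Continuous g) (k : ℤ) :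
    fc (fun x => f x - g x) k = fc f k - fc g k := by
  have h := fc_add (g := fun x => -1 * g x) hf (by fun_prop) k
  rw [fc_const_mul] at h
  rw [sub_eq_add_neg, ← neg_one_mul (fc g k)]
  push_cast at h
  rw [← h]
  congr 1
  ext x
  simp [sub_eq_add_neg]

lemma fc_deriv {f g : ℝ → ℝ} (hf : ∀ x, HasDerivAt f (g x) x) (hg : Continuous g)
    (hp : Function.Periodic f (2 * π)) (k : ℤ) : fc g k = Complex.I * k * fc f k := by
  have h := intervalIntegral.integral_deriv_mul_eq_sub (a := 0) (b := 2 * π)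
    (u := fun x => (f x : ℂ)) (u' := fun x => (g x : ℂ)) (v := ek (-k))
    (v' := fun x => Complex.I * ((-k : ℤ) : ℂ) * ek (-k) x) (fun x _ => (hf x).ofReal_comp)
    (fun x _ => ek_hasDerivAt _ x) (Continuous.intervalIntegrable (by fun_prop) _ _)
    (Continuous.intervalIntegrable (by fun_prop) _ _)
  have e1 := ek_periodic (-k) 0
  have e2 := hp 0
  rw [zero_add] at e1 e2
  rw [e1, e2, sub_self] at h
  have cf : Continuous f := continuous_iff_continuousAt.2 fun x => (hf x).continuousAt
  rw [intervalIntegral.integral_add (Continuous.intervalIntegrable (by fun_prop) _ _)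
    (Continuous.intervalIntegrable (by fun_prop) _ _), integral_mul_ek, neg_neg] at h
  have e3 : ∫ x in (0:ℝ)..(2 * π), (f x : ℂ) * (Complex.I * ((-k : ℤ) : ℂ) * ek (-k) x)
      = -(Complex.I * k) * (((2 * π : ℝ) : ℂ) * fc f k) := by
    have := integral_mul_ek f (-k)
    rw [neg_neg] at this
    rw [← this, ← intervalIntegral.integral_const_mul]
    congr 1
    ext x
    push_cast
    ring
  rw [e3] at h
  have hpi : ((2 * π : ℝ) : ℂ) ≠ 0 := by exact_mod_cast Real.two_pi_pos.ne'
  have : ((2 * π : ℝ) : ℂ) * (fc g k - Complex.I * k * fc f k) = 0 := by rw [← h]; ring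
  exact sub_eq_zero.1 ((mul_eq_zero.1 this).resolve_left hpi)

lemma fc_jet {f : ℝ → ℝ} (hf : SmoothPer f) (j : ℕ) (k : ℤ) :
    fc (fun x => jet f x j) k = (Complex.I * k) ^ j * fc f k := by
  induction j with
  | zero => simp [jet]
  | succ j ih =>
    rw [fc_deriv (fun x => hf.hasDerivAt j x) (hf.continuous _) (hf.periodic j), ih]
    ring

/-- Trigonometric polynomials. -/
noncomputable def trig (n : ℕ) (c : ℤ → ℂ) (x : ℝ) : ℝ :=
  (∑ k ∈ Finset.Icc (-n : ℤ) n, c k * ek k x).re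

lemma trig_ofReal (n : ℕ) (c : ℤ → ℂ) (x : ℝ) :
    ((trig n c x : ℝ) : ℂ) = ∑ k ∈ Finset.Icc (-n : ℤ) n,
      (c k * ek k x + (starRingEnd ℂ) (c k) * ek (-k) x) / 2 := by
  rw [trig, Complex.re_eq_add_conj, map_sum, ← Finset.sum_add_distrib, Finset.sum_div]
  simp [conj_ek]

lemma trig_hasDerivAt (n : ℕ) (c : ℤ → ℂ) (x : ℝ) :
    HasDerivAt (trig n c) (trig n (fun k => Complex.I * k * c k) x) x := by
  have h : HasDerivAt (fun x => ∑ k ∈ Finset.Icc (-n : ℤ) n, c k * ek k x)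
      (∑ k ∈ Finset.Icc (-n : ℤ) n, Complex.I * k * c k * ek k x) x := by
    refine HasDerivAt.fun_sum fun k _ => ?_
    have := (ek_hasDerivAt k x).const_mul (c k)
    rwa [← mul_assoc, mul_comm (c k)] at this
  exact Complex.reCLM.hasFDerivAt.comp_hasDerivAt x h

lemma jet_trig (n : ℕ) (c : ℤ → ℂ) (x : ℝ) (j : ℕ) :
    jet (trig n c) x j = trig n (fun k => (Complex.I * k) ^ j * c k) x := by
  induction j generalizing x with
  | zero => simp [jet]
  | succ j ih =>
    have : iteratedDeriv j (trig n c) = trig n (fun k => (Complex.I * k) ^ j * c k) := funext ih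
    rw [jet, iteratedDeriv_succ, this, (trig_hasDerivAt _ _ _).deriv]
    congr 1
    ext k
    ring

lemma trig_smoothPer (n : ℕ) (c : ℤ → ℂ) : SmoothPer (trig n c) := by
  constructor
  · refine contDiff_of_differentiable_iteratedDeriv fun j _ x => ?_
    have : iteratedDeriv j (trig n c) = trig n (fun k => (Complex.I * k) ^ j * c k) :=
      funext fun x => jet_trig n c x j
    rw [this]
    exact (trig_hasDerivAt _ _ _).differentiableAt
  · intro x
    simp [trig, ek_periodic]

lemma fc_trig (n : ℕ) (c : ℤ → ℂ) (l : ℤ) :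
    fc (trig n c) l = if l ∈ Finset.Icc (-n : ℤ) n then
      (c l + (starRingEnd ℂ) (c (-l))) / 2 else 0 := by
  have hpi : ((2 * π : ℝ) : ℂ) ≠ 0 := by exact_mod_cast Real.two_pi_pos.ne'
  have e : ∀ x, ((trig n c x : ℝ) : ℂ) * ek (-l) x = ∑ k ∈ Finset.Icc (-n : ℤ) n,
      (c k / 2 * ek (k - l) x + (starRingEnd ℂ) (c k) / 2 * ek (-k - l) x) := fun x => by
    rw [trig_ofReal, Finset.sum_mul]
    refine Finset.sum_congr rfl fun k _ => ?_
    rw [sub_eq_add_neg, ← ek_mul, sub_eq_add_neg, ← ek_mul]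
    ring
  rw [fc_eq]
  simp only [e]
  rw [intervalIntegral.integral_finsetSum fun k _ =>
    Continuous.intervalIntegrable (by fun_prop) _ _]
  have e2 : ∀ k : ℤ, ∫ x in (0:ℝ)..(2 * π), (c k / 2 * ek (k - l) x
      + (starRingEnd ℂ) (c k) / 2 * ek (-k - l) x) = ((2 * π : ℝ) : ℂ) *
      ((if k = l then c k / 2 else 0) + (if k = -l then (starRingEnd ℂ) (c k) / 2 else 0)) := by
    intro k
    rw [intervalIntegral.integral_add (Continuous.intervalIntegrable (by fun_prop) _ _)
      (Continuous.intervalIntegrable (by fun_prop) _ _), intervalIntegral.integral_const_mul,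
      intervalIntegral.integral_const_mul, integral_ek, integral_ek]
    have h1 : k - l = 0 ↔ k = l := sub_eq_zero
    have h2 : -k - l = 0 ↔ k = -l := by omega
    simp only [h1, h2]
    split_ifs <;> ring
  simp only [e2]
  rw [← Finset.mul_sum, inv_mul_cancel_left₀ hpi, Finset.sum_add_distrib, Finset.sum_ite_eq',
    Finset.sum_ite_eq']
  have h3 : -l ∈ Finset.Icc (-n : ℤ) n ↔ l ∈ Finset.Icc (-n : ℤ) n := by
    simp only [Finset.mem_Icc]; omega
  simp only [h3]
  split_ifs <;> ring

lemma sum_Icc_neg {M : Type*} [AddCommMonoid M] (n : ℕ) (g : ℤ → M) :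
    ∑ k ∈ Finset.Icc (-n : ℤ) n, g (-k) = ∑ k ∈ Finset.Icc (-n : ℤ) n, g k :=
  Finset.sum_nbij' (fun k => -k) (fun k => -k) (by intro k; simp only [Finset.mem_Icc]; omega)
    (by intro k; simp only [Finset.mem_Icc]; omega) (by simp) (by simp) (by simp)

/-- Truncation of the Fourier series. -/
noncomputable def trunc (n : ℕ) (f : ℝ → ℝ) : ℝ → ℝ := trig n (fc f)

lemma trig_congr {n : ℕ} {c d : ℤ → ℂ} (h : ∀ k ∈ Finset.Icc (-n : ℤ) n, c k = d k) :
    trig n c = trig n d := by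
  ext x
  simp only [trig]
  rw [Finset.sum_congr rfl fun k hk => by rw [h k hk]]

lemma trunc_trig (n : ℕ) (c : ℤ → ℂ) : trunc n (trig n c) = trig n c := by
  rw [trunc, trig_congr (d := fun l => (c l + (starRingEnd ℂ) (c (-l))) / 2)
    fun k hk => by rw [fc_trig, if_pos hk]]
  ext x
  apply Complex.ofReal_injective
  rw [trig_ofReal, trig_ofReal]
  have h := sum_Icc_neg n fun k => (c k * ek k x + (starRingEnd ℂ) (c k) * ek (-k) x) / 2
  have e : ∀ k, ((c k + (starRingEnd ℂ) (c (-k))) / 2 * ek k x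
      + (starRingEnd ℂ) ((c k + (starRingEnd ℂ) (c (-k))) / 2) * ek (-k) x) / 2 =
      ((c k * ek k x + (starRingEnd ℂ) (c k) * ek (-k) x) / 2 +
        (c (-k) * ek (-k) x + (starRingEnd ℂ) (c (-k)) * ek (-(-k)) x) / 2) / 2 := by
    intro k
    simp only [map_div₀, map_add, Complex.conj_conj, map_ofNat, neg_neg]
    ring
  simp only [e]
  rw [← Finset.sum_div, Finset.sum_add_distrib, h]
  ring

lemma integral_trig_mul (n : ℕ) (c : ℤ → ℂ) {f : ℝ → ℝ} (hf : Continuous f) :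
    ∫ x in (0:ℝ)..(2 * π), trig n c x * f x =
      2 * π * ∑ k ∈ Finset.Icc (-n : ℤ) n, (c k * (starRingEnd ℂ) (fc f k)).re := by
  have e : ∀ x, trig n c x * f x =
      Complex.reCLM (∑ k ∈ Finset.Icc (-n : ℤ) n, c k * ((f x : ℂ) * ek k x)) := fun x => by
    rw [trig, Complex.reCLM_apply, ← Complex.re_mul_ofReal, Finset.sum_mul]
    congr 1
    refine Finset.sum_congr rfl fun k _ => by ring
  simp only [e]
  rw [ContinuousLinearMap.intervalIntegral_comp_comm _
    (Continuous.intervalIntegrable (by fun_prop) _ _),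
    intervalIntegral.integral_finsetSum fun k _ =>
    Continuous.intervalIntegrable (by fun_prop) _ _]
  simp only [intervalIntegral.integral_const_mul, integral_mul_ek, fc_neg]
  rw [Complex.reCLM_apply, Complex.re_sum, Finset.mul_sum]
  refine Finset.sum_congr rfl fun k _ => ?_
  rw [mul_left_comm, Complex.re_ofReal_mul]

lemma integral_trunc_mul (n : ℕ) {f h : ℝ → ℝ} (hf : Continuous f) (hh : Continuous h) :
    ∫ x in (0:ℝ)..(2 * π), trunc n f x * h x = ∫ x in (0:ℝ)..(2 * π), f x * trunc n h x := by
  have e : ∀ x, f x * trunc n h x = trunc n h x * f x := fun x => mul_comm _ _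
  simp only [e]
  rw [trunc, trunc, integral_trig_mul n _ hh, integral_trig_mul n _ hf]
  congr 1
  refine Finset.sum_congr rfl fun k _ => ?_
  simp
  ring

lemma jet_trunc (n : ℕ) {f : ℝ → ℝ} (hf : SmoothPer f) (j : ℕ) :
    (fun x => jet (trunc n f) x j) = trunc n (fun x => jet f x j) := by
  ext x
  rw [trunc, jet_trig, trunc]
  congr 1
  ext k
  rw [fc_jet hf]

lemma trunc_continuous (n : ℕ) (f : ℝ → ℝ) : Continuous (trunc n f) :=
  (trig_smoothPer n _).1.continuous

lemma integral_trunc_sq_eq (n : ℕ) {f : ℝ → ℝ} (hf : Continuous f) :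
    ∫ x in (0:ℝ)..(2 * π), trunc n f x ^ 2 = ∫ x in (0:ℝ)..(2 * π), trunc n f x * f x := by
  have := integral_trunc_mul n hf (trunc_continuous n f)
  rw [show trunc n (trunc n f) = trunc n f from trunc_trig n _] at this
  simp only [sq, this]
  simp only [mul_comm]

lemma integral_trunc_sq (n : ℕ) {f : ℝ → ℝ} (hf : Continuous f) :
    ∫ x in (0:ℝ)..(2 * π), trunc n f x ^ 2 =
      2 * π * ∑ k ∈ Finset.Icc (-n : ℤ) n, ‖fc f k‖ ^ 2 := by
  rw [integral_trunc_sq_eq n hf, trunc, integral_trig_mul n _ hf]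
  congr 1
  refine Finset.sum_congr rfl fun k _ => ?_
  rw [Complex.mul_conj, Complex.ofReal_re, Complex.normSq_eq_norm_sq]

lemma integral_trunc_sq_le (n : ℕ) {f : ℝ → ℝ} (hf : Continuous f) :
    ∫ x in (0:ℝ)..(2 * π), trunc n f x ^ 2 ≤ ∫ x in (0:ℝ)..(2 * π), f x ^ 2 := by
  have h1 := integral_trunc_sq_eq n hf
  have c1 := trunc_continuous n f
  have h2 := integral_mono_of_continuous (f := fun x => trunc n f x * f x)
    (g := fun x => 1 / 2 * trunc n f x ^ 2 + 1 / 2 * f x ^ 2) (by fun_prop) (by fun_prop)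
    fun x => by nlinarith [sq_nonneg (trunc n f x - f x)]
  rw [intervalIntegral.integral_add (Continuous.intervalIntegrable (by fun_prop) _ _)
    (Continuous.intervalIntegrable (by fun_prop) _ _), intervalIntegral.integral_const_mul,
    intervalIntegral.integral_const_mul] at h2
  linarith

/-- `u` is a trigonometric polynomial of degree at most `n`. -/
def IsTrig (n : ℕ) (u : ℝ → ℝ) : Prop := ∃ c, u = trig n c

lemma IsTrig.smoothPer {n : ℕ} {u : ℝ → ℝ} (h : IsTrig n u) : SmoothPer u := by
  obtain ⟨c, rfl⟩ := h
  exact trig_smoothPer n c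

lemma IsTrig.trunc_eq {n : ℕ} {u : ℝ → ℝ} (h : IsTrig n u) : trunc n u = u := by
  obtain ⟨c, rfl⟩ := h
  exact trunc_trig n c

lemma IsTrig.fc_eq_zero {n : ℕ} {u : ℝ → ℝ} (h : IsTrig n u) {k : ℤ}
    (hk : k ∉ Finset.Icc (-n : ℤ) n) : fc u k = 0 := by
  obtain ⟨c, rfl⟩ := h
  rw [fc_trig, if_neg hk]

lemma IsTrig.trunc_jet {n : ℕ} {u : ℝ → ℝ} (h : IsTrig n u) (j : ℕ) :
    trunc n (fun x => jet u x j) = fun x => jet u x j := by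
  rw [← jet_trunc n h.smoothPer, h.trunc_eq]

lemma IsTrig.sob_eq {n : ℕ} {u : ℝ → ℝ} (h : IsTrig n u) (j : ℕ) :
    sob j u = 2 * π * ∑ k ∈ Finset.Icc (-n : ℤ) n, (k : ℝ) ^ (2 * j) * ‖fc u k‖ ^ 2 := by
  have e := integral_trunc_sq n (h.smoothPer.continuous j)
  rw [h.trunc_jet] at e
  rw [sob, e]
  congr 1
  refine Finset.sum_congr rfl fun k _ => ?_
  rw [fc_jet h.smoothPer, norm_mul, mul_pow, norm_pow, norm_mul, Complex.norm_I, one_mul, ← pow_mul,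
    mul_comm j, pow_mul, pow_mul, Complex.norm_intCast, sq_abs]

/-- The differential polynomial of the full equation. -/
noncomputable def rhs (γ0 γ1 γ2 : ℝ) (N : MvPolynomial ℕ ℝ) : MvPolynomial ℕ ℝ :=
  N + (C (-γ0) * X 5 + (C (-γ1) * X 3 + C (-γ2) * X 1))

lemma rhs_mem (γ0 γ1 γ2 : ℝ) {N : MvPolynomial ℕ ℝ} (hN : N ∈ ordLE 3) :
    rhs γ0 γ1 γ2 N ∈ ordLE 5 :=
  add_mem (ordLE_mono (by norm_num) hN)
    (add_mem (mul_mem (C_mem_ordLE _ _) (X_mem_ordLE (by norm_num)))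
    (add_mem (mul_mem (C_mem_ordLE _ _) (X_mem_ordLE (by norm_num)))
      (mul_mem (C_mem_ordLE _ _) (X_mem_ordLE (by norm_num)))))

lemma ev_rhs (γ0 γ1 γ2 : ℝ) (N : MvPolynomial ℕ ℝ) (u : ℝ → ℝ) :
    ev (rhs γ0 γ1 γ2 N) u = fun x => ev N u x + (-γ0 * jet u x 5 + (-γ1 * jet u x 3
      + -γ2 * jet u x 1)) := by
  ext x
  simp only [rhs, ev_add, ev_mul, ev_C, ev_X]

lemma trunc_add (n : ℕ) {f g : ℝ → ℝ} (hf : Continuous f) (hg : Continuous g) :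
    trunc n (fun x => f x + g x) = fun x => trunc n f x + trunc n g x := by
  ext x
  simp only [trunc, trig]
  rw [← Complex.add_re, ← Finset.sum_add_distrib]
  congr 1
  refine Finset.sum_congr rfl fun k _ => ?_
  rw [fc_add hf hg]
  ring

lemma trunc_const_mul (n : ℕ) (r : ℝ) (f : ℝ → ℝ) :
    trunc n (fun x => r * f x) = fun x => r * trunc n f x := by
  ext x
  simp only [trunc, trig]
  rw [← Complex.re_ofReal_mul, Finset.mul_sum]
  congr 1
  refine Finset.sum_congr rfl fun k _ => ?_
  rw [fc_const_mul]
  ring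

lemma IsTrig.flow {n : ℕ} {u : ℝ → ℝ} (h : IsTrig n u) (γ0 γ1 γ2 : ℝ) (N : MvPolynomial ℕ ℝ) :
    Flow γ0 γ1 γ2 N u (trunc n (ev (rhs γ0 γ1 γ2 N) u)) (trunc n (ev N u)) := by
  have hu := h.smoothPer
  have cu := hu.continuous
  have cN := hu.ev_continuous
  have hj : ∀ j, (fun x => jet (trunc n (ev N u)) x j) = trunc n (ev (totalD^[j] N) u) := by
    intro j
    rw [jet_trunc n (hu.ev_smoothPer N)]
    congr 1
    ext x
    rw [jet, hu.iteratedDeriv_ev]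
  refine ⟨hu, trig_smoothPer _ _, trig_smoothPer _ _, fun x => ?_, fun j => ?_, fun j => ?_⟩
  · rw [ev_rhs, trunc_add n (cN N) (by fun_prop), trunc_add n (by fun_prop) (by fun_prop),
      trunc_add n (by fun_prop) (by fun_prop), trunc_const_mul, trunc_const_mul, trunc_const_mul,
      h.trunc_jet, h.trunc_jet, h.trunc_jet]
    ring
  · have e := integral_trunc_mul n (cu j) (cN (totalD^[j] N))
    rw [h.trunc_jet, ← hj] at e
    exact e.symm
  · have e := integral_trunc_sq_le n (cN (totalD^[j] N))
    rw [← hj] at e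
    exact e

lemma exists_lipschitz_eval {r : ℕ} {p : MvPolynomial ℕ ℝ} (hp : p ∈ ordLE r) (K : ℝ) :
    ∃ L : ℝ, 0 ≤ L ∧ ∀ (y y' : ℕ → ℝ) (D : ℝ), 0 ≤ D → (∀ j ≤ r, |y j| ≤ K) →
      (∀ j ≤ r, |y' j| ≤ K) → (∀ j ≤ r, |y j - y' j| ≤ D) → |eval y p - eval y' p| ≤ L * D := by
  refine ordLE_induction (motive := fun p => ∃ L : ℝ, 0 ≤ L ∧ ∀ (y y' : ℕ → ℝ) (D : ℝ), 0 ≤ D →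
      (∀ j ≤ r, |y j| ≤ K) → (∀ j ≤ r, |y' j| ≤ K) → (∀ j ≤ r, |y j - y' j| ≤ D) →
      |eval y p - eval y' p| ≤ L * D) ?_ ?_ ?_ ?_ hp
  · intro j hj
    refine ⟨1, zero_le_one, fun y y' D _ _ _ h => ?_⟩
    simpa using h j hj
  · intro c
    exact ⟨0, le_rfl, fun y y' D _ _ _ _ => by simp⟩
  · rintro p q - - ⟨L, hL, h⟩ ⟨L', hL', h'⟩
    refine ⟨L + L', by positivity, fun y y' D hD h1 h2 h3 => ?_⟩
    have e1 := h y y' D hD h1 h2 h3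
    have e2 := h' y y' D hD h1 h2 h3
    rw [map_add, map_add, add_mul]
    calc |eval y p + eval y q - (eval y' p + eval y' q)|
        = |(eval y p - eval y' p) + (eval y q - eval y' q)| := by ring_nf
      _ ≤ _ := (abs_add_le _ _).trans (add_le_add e1 e2)
  · rintro p q hp hq ⟨L, hL, h⟩ ⟨L', hL', h'⟩
    obtain ⟨B, hB, b⟩ := exists_bound_eval hp K
    obtain ⟨B', hB', b'⟩ := exists_bound_eval hq K
    refine ⟨L * B' + B * L', by positivity, fun y y' D hD h1 h2 h3 => ?_⟩
    have e1 := h y y' D hD h1 h2 h3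
    have e2 := h' y y' D hD h1 h2 h3
    rw [map_mul, map_mul]
    calc |eval y p * eval y q - eval y' p * eval y' q|
        = |(eval y p - eval y' p) * eval y q + eval y' p * (eval y q - eval y' q)| := by ring_nf
      _ ≤ |eval y p - eval y' p| * |eval y q| + |eval y' p| * |eval y q - eval y' q| := by
        rw [← abs_mul, ← abs_mul]; exact abs_add_le _ _
      _ ≤ (L * D) * B' + B * (L' * D) := by
        gcongr
        · exact b' y h1
        · exact b y' h2
      _ = _ := by ring

lemma exists_curve {E : Type*} [NormedAddCommGroup E] [NormedSpace ℝ E] [CompleteSpace E]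
    {F : E → E} {K B : ℝ} (hK : ∀ x y, ‖F x - F y‖ ≤ K * ‖x - y‖) (hB : ∀ x, ‖F x‖ ≤ B) (x : E) :
    ∃ α β : ℝ → E, (∀ t, HasDerivAt α (β t) t) ∧ Continuous β ∧ α 0 = x ∧
      ∀ t ∈ Set.Icc (0:ℝ) 1, β t = F (α t) := by
  have hL : LipschitzWith K.toNNReal F := LipschitzWith.of_dist_le_mul fun x y => by
    rw [dist_eq_norm, dist_eq_norm]
    exact (hK x y).trans (mul_le_mul_of_nonneg_right (Real.le_coe_toNNReal K) (norm_nonneg _))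
  have hP : IsPicardLindelof (fun _ => F) (tmin := 0) (tmax := 1) ⟨0, by simp⟩ x B.toNNReal 0
      B.toNNReal K.toNNReal := IsPicardLindelof.of_time_independent
    (fun x _ => (hB x).trans (Real.le_coe_toNNReal B)) hL.lipschitzOnWith (by simp)
  obtain ⟨a, ha0, ha⟩ := hP.exists_eq_forall_mem_Icc_hasDerivWithinAt₀
  have ha0' : a 0 = x := ha0
  have hca : ContinuousOn a (Set.Icc 0 1) := fun t ht => (ha t ht).continuousWithinAt
  have hcp : Continuous fun t : ℝ => a (Set.projIcc 0 1 zero_le_one t) :=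
    hca.comp_continuous (by fun_prop) fun t => (Set.projIcc 0 1 zero_le_one t).2
  have hcb : Continuous fun t : ℝ => F (a (Set.projIcc 0 1 zero_le_one t)) :=
    hL.continuous.comp hcp
  have hα : ∀ t, HasDerivAt (fun t => x + ∫ s in (0:ℝ)..t,
      F (a (Set.projIcc 0 1 zero_le_one s))) (F (a (Set.projIcc 0 1 zero_le_one t))) t := fun t =>
    (intervalIntegral.integral_hasDerivAt_right (hcb.intervalIntegrable _ _)
      (hcb.stronglyMeasurableAtFilter _ _) hcb.continuousAt).const_add x
  refine ⟨_, _, hα, hcb, by simp, fun t ht => ?_⟩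
  have hz := constant_of_has_deriv_right_zero
    (f := fun t => a t - (x + ∫ s in (0:ℝ)..t, F (a (Set.projIcc 0 1 zero_le_one s))))
    (a := 0) (b := 1) (hca.sub fun t _ => (hα t).continuousAt.continuousWithinAt)
    (fun s hs => by
      have h1 : HasDerivWithinAt a (F (a s)) (Set.Ici s) s :=
        (ha s ⟨hs.1, hs.2.le⟩).mono_of_mem_nhdsWithin
        (mem_nhdsWithin.2 ⟨Set.Iio 1, isOpen_Iio, hs.2,
          fun y hy => ⟨le_trans hs.1 hy.2, le_of_lt hy.1⟩⟩)
      have h2 := h1.fun_sub (hα s).hasDerivWithinAt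
      rw [Set.projIcc_of_mem _ ⟨hs.1, hs.2.le⟩] at h2
      simpa using h2) t ht
  simp only [intervalIntegral.integral_same, add_zero, ha0', sub_self] at hz
  rw [← sub_eq_zero.1 hz, Set.projIcc_of_mem _ ht]

/-- Clamping of the real and imaginary parts to `[-R, R]`. -/
noncomputable def clampC (R : ℝ) (z : ℂ) : ℂ := ⟨max (-R) (min R z.re), max (-R) (min R z.im)⟩

lemma clampC_eq {R : ℝ} {z : ℂ} (h : ‖z‖ ≤ R) : clampC R z = z := by
  have h1 := abs_le.1 ((Complex.abs_re_le_norm z).trans h)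
  have h2 := abs_le.1 ((Complex.abs_im_le_norm z).trans h)
  apply Complex.ext
  · simp [clampC, h1.1, h1.2]
  · simp [clampC, h2.1, h2.2]

lemma abs_clamp_le {R : ℝ} (hR : 0 ≤ R) (a : ℝ) : |max (-R) (min R a)| ≤ R :=
  abs_le.2 ⟨le_max_left _ _, max_le (by linarith) (min_le_left _ _)⟩

lemma abs_clamp_sub_le (R a b : ℝ) : |max (-R) (min R a) - max (-R) (min R b)| ≤ |a - b| := by
  refine (abs_max_sub_max_le_max _ _ _ _).trans (max_le (by simp) ?_)
  refine (abs_min_sub_min_le_max _ _ _ _).trans (max_le (by simp) le_rfl)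

lemma norm_clampC_le {R : ℝ} (hR : 0 ≤ R) (z : ℂ) : ‖clampC R z‖ ≤ 2 * R := by
  refine (Complex.norm_le_abs_re_add_abs_im _).trans ?_
  have h1 := abs_clamp_le hR z.re
  have h2 := abs_clamp_le hR z.im
  simp only [clampC]
  linarith

lemma norm_clampC_sub_le (R : ℝ) (z w : ℂ) : ‖clampC R z - clampC R w‖ ≤ 2 * ‖z - w‖ := by
  refine (Complex.norm_le_abs_re_add_abs_im _).trans ?_
  have h1 := (abs_clamp_sub_le R z.re w.re).trans
    (Complex.sub_re z w ▸ Complex.abs_re_le_norm (z - w))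
  have h2 := (abs_clamp_sub_le R z.im w.im).trans
    (Complex.sub_im z w ▸ Complex.abs_im_le_norm (z - w))
  simp only [clampC, Complex.sub_re, Complex.sub_im]
  linarith

/-- A constant controlling the first derivatives of a trigonometric polynomial. -/
noncomputable def jetConst (n r : ℕ) : ℝ :=
  ∑ j ∈ Finset.range (r + 1), ∑ k ∈ Finset.Icc (-n : ℤ) n, |(k : ℝ)| ^ j

lemma jetConst_nonneg (n r : ℕ) : 0 ≤ jetConst n r := by
  unfold jetConst; positivity

lemma abs_jet_trig_le {n r : ℕ} {c : ℤ → ℂ} {D : ℝ} (hD : 0 ≤ D)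
    (h : ∀ k ∈ Finset.Icc (-n : ℤ) n, ‖c k‖ ≤ D) {j : ℕ} (hj : j ≤ r) (x : ℝ) :
    |jet (trig n c) x j| ≤ jetConst n r * D := by
  rw [jet_trig, trig]
  calc _ ≤ ‖∑ k ∈ Finset.Icc (-n : ℤ) n, (Complex.I * k) ^ j * c k * ek k x‖ :=
        Complex.abs_re_le_norm _
    _ ≤ ∑ k ∈ Finset.Icc (-n : ℤ) n, |(k : ℝ)| ^ j * D := by
        refine norm_sum_le_of_le _ fun k hk => ?_
        rw [norm_mul, norm_ek, mul_one, norm_mul, norm_pow, norm_mul, Complex.norm_I, one_mul,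
          Complex.norm_intCast]
        exact mul_le_mul_of_nonneg_left (h k hk) (by positivity)
    _ = (∑ k ∈ Finset.Icc (-n : ℤ) n, |(k : ℝ)| ^ j) * D := by rw [Finset.sum_mul]
    _ ≤ _ := by
        refine mul_le_mul_of_nonneg_right ?_ hD
        exact Finset.single_le_sum (f := fun j => ∑ k ∈ Finset.Icc (-n : ℤ) n, |(k : ℝ)| ^ j)
          (fun j _ => by positivity) (Finset.mem_range.2 (by omega))

lemma jet_trig_sub (n : ℕ) (c d : ℤ → ℂ) (x : ℝ) (j : ℕ) :
    jet (trig n c) x j - jet (trig n d) x j = jet (trig n fun k => c k - d k) x j := by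
  simp only [jet_trig, trig]
  rw [← Complex.sub_re, ← Finset.sum_sub_distrib]
  congr 1
  refine Finset.sum_congr rfl fun k _ => by ring

/-- Extension by zero of a finite family of coefficients. -/
noncomputable def extC (n : ℕ) (c : Finset.Icc (-n : ℤ) n → ℂ) (k : ℤ) : ℂ :=
  if h : k ∈ Finset.Icc (-n : ℤ) n then c ⟨k, h⟩ else 0

lemma norm_extC_sub_le (n : ℕ) (c d : Finset.Icc (-n : ℤ) n → ℂ) (k : ℤ) :
    ‖extC n c k - extC n d k‖ ≤ ‖c - d‖ := by
  unfold extC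
  split_ifs with h
  · exact norm_le_pi_norm (c - d) ⟨k, h⟩
  · simp

lemma norm_fc_trig_extC_sub_le (n : ℕ) (c d : Finset.Icc (-n : ℤ) n → ℂ) (k : ℤ) :
    ‖fc (trig n (extC n c)) k - fc (trig n (extC n d)) k‖ ≤ ‖c - d‖ := by
  rw [fc_trig, fc_trig]
  split_ifs
  · have h1 := norm_extC_sub_le n c d k
    have h2 := norm_extC_sub_le n c d (-k)
    rw [← Complex.norm_conj, map_sub] at h2
    calc _ = ‖(extC n c k - extC n d k) + ((starRingEnd ℂ) (extC n c (-k))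
          - (starRingEnd ℂ) (extC n d (-k)))‖ / 2 := by
          rw [← Complex.norm_ofNat 2, ← norm_div]
          congr 1
          ring
      _ ≤ (‖c - d‖ + ‖c - d‖) / 2 := by
          gcongr
          exact (norm_add_le _ _).trans (add_le_add h1 h2)
      _ = _ := by ring
  · simp

/-- Global solutions of the truncated Galerkin system. -/
theorem exists_galerkin {r : ℕ} {p : MvPolynomial ℕ ℝ} (hp : p ∈ ordLE r) (n : ℕ) (R : ℝ)
    (φ : ℝ → ℝ) : ∃ c d : ℝ → ℤ → ℂ, (∀ k t, HasDerivAt (fun t => c t k) (d t k) t) ∧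
      (∀ k, Continuous fun t => d t k) ∧ trig n (c 0) = trunc n φ ∧
      ∀ t ∈ Set.Icc (0:ℝ) 1, sob 0 (trig n (c t)) ≤ R →
        trig n (d t) = trunc n (ev p (trig n (c t))) := by
  set R' : ℝ := 1 + |R| with hR'
  have hR0 : 0 ≤ R' := by positivity
  set K : ℝ := jetConst n r * (2 * R') with hK
  obtain ⟨L, hL, lip⟩ := exists_lipschitz_eval hp K
  obtain ⟨B, hB, bd⟩ := exists_bound_eval hp K
  set q : (Finset.Icc (-n : ℤ) n → ℂ) → ℤ → ℂ :=
    fun c l => clampC R' (fc (trig n (extC n c)) l) with hq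
  have hqK : ∀ c x, ∀ j ≤ r, |jet (trig n (q c)) x j| ≤ K := fun c x j hj =>
    abs_jet_trig_le (by positivity) (fun k _ => norm_clampC_le hR0 _) hj x
  obtain ⟨α, β, h1, h2, h3, h4⟩ := exists_curve
    (F := fun c : Finset.Icc (-n : ℤ) n → ℂ => fun k => fc (ev p (trig n (q c))) k)
    (K := L * (jetConst n r * 2)) (B := B) (fun c d => by
      refine (pi_norm_le_iff_of_nonneg (by have := jetConst_nonneg n r; positivity)).2 fun k => ?_
      rw [Pi.sub_apply, ← fc_sub ((trig_smoothPer _ _).ev_continuous p)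
        ((trig_smoothPer _ _).ev_continuous p)]
      refine norm_fc_le (fun x => ?_) k
      refine (lip _ _ (jetConst n r * (2 * ‖c - d‖)) (by have := jetConst_nonneg n r; positivity)
        (hqK c x) (hqK d x) fun j hj => ?_).trans (le_of_eq (by ring))
      rw [jet_trig_sub]
      refine abs_jet_trig_le (by positivity) (fun k _ => ?_) hj x
      exact (norm_clampC_sub_le _ _ _).trans
        (mul_le_mul_of_nonneg_left (norm_fc_trig_extC_sub_le n c d k) zero_le_two))
    (fun c => (pi_norm_le_iff_of_nonneg hB).2 fun k =>
      norm_fc_le (fun x => bd _ (hqK c x)) k) (fun k => fc φ k)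
  refine ⟨fun t => extC n (α t), fun t => extC n (β t), fun k t => ?_, fun k => ?_, ?_,
    fun t ht hs => ?_⟩
  · simp only [extC]
    split_ifs with h
    · exact hasDerivAt_pi.1 (h1 t) ⟨k, h⟩
    · exact hasDerivAt_const _ _
  · simp only [extC]
    split_ifs with h
    · fun_prop
    · exact continuous_const
  · refine trig_congr fun k hk => ?_
    simp only [h3, extC, dif_pos hk]
  · refine trig_congr fun k hk => ?_
    simp only [extC, dif_pos hk, h4 t ht]
    congr 2
    rw [← trunc_trig n (extC n (α t)), trunc]
    refine trig_congr fun l hl => clampC_eq ?_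
    have hT : IsTrig n (trig n (extC n (α t))) := ⟨_, rfl⟩
    have e1 := hT.sob_eq 0
    have e2 : ‖fc (trig n (extC n (α t))) l‖ ^ 2 ≤ ∑ k ∈ Finset.Icc (-n : ℤ) n,
        (k : ℝ) ^ (2 * 0) * ‖fc (trig n (extC n (α t))) k‖ ^ 2 := by
      have := Finset.single_le_sum (f := fun k : ℤ => (k : ℝ) ^ (2 * 0) *
        ‖fc (trig n (extC n (α t))) k‖ ^ 2) (fun k _ => mul_nonneg (by simp) (sq_nonneg _)) hl
      simpa using this
    have e3 : (∑ k ∈ Finset.Icc (-n : ℤ) n, (k : ℝ) ^ (2 * 0) *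
      ‖fc (trig n (extC n (α t))) k‖ ^ 2) ≤ sob 0 (trig n (extC n (α t))) := by
      rw [e1]
      refine le_mul_of_one_le_left (Finset.sum_nonneg fun k _ => mul_nonneg (by simp) (sq_nonneg _)) ?_
      linarith [Real.pi_gt_three]
    have e4 : ‖fc (trig n (extC n (α t))) l‖ ^ 2 ≤ |R| := (e2.trans e3).trans (hs.trans (le_abs_self R))
    nlinarith [norm_nonneg (fc (trig n (extC n (α t))) l), abs_nonneg R]

lemma hasDerivAt_integral_of_continuous {F F' : ℝ → ℝ → ℝ}
    (hF : Continuous fun z : ℝ × ℝ => F z.1 z.2) (hF' : Continuous fun z : ℝ × ℝ => F' z.1 z.2)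
    (h : ∀ x t, HasDerivAt (fun t => F t x) (F' t x) t) (a b t : ℝ) :
    HasDerivAt (fun t => ∫ x in a..b, F t x) (∫ x in a..b, F' t x) t := by
  obtain ⟨B, hB⟩ := ((isCompact_Icc (a := t - 1) (b := t + 1)).prod
    (isCompact_uIcc (a := a) (b := b))).exists_bound_of_continuousOn hF'.continuousOn
  have c1 : ∀ t, Continuous (F t) := fun t => hF.comp (Continuous.prodMk_right t)
  have c2 : ∀ t, Continuous (F' t) := fun t => hF'.comp (Continuous.prodMk_right t)
  refine (intervalIntegral.hasDerivAt_integral_of_dominated_loc_of_deriv_le (bound := fun _ => B)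
    (s := Set.Icc (t - 1) (t + 1)) (Icc_mem_nhds (by linarith) (by linarith))
    (Filter.Eventually.of_forall fun t => (c1 t).aestronglyMeasurable)
    ((c1 t).intervalIntegrable _ _) (c2 t).aestronglyMeasurable
    (Filter.Eventually.of_forall fun x hx s hs => ?_) intervalIntegrable_const
    (Filter.Eventually.of_forall fun x _ s _ => h x s)).2
  exact hB (s, x) ⟨hs, Set.uIoc_subset_uIcc hx⟩

/-- A time dependent family of smooth functions `u`, with velocity `v`. -/
structure Curve (u v : ℝ → ℝ → ℝ) : Prop where
  hu : ∀ t, SmoothPer (u t)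
  hv : ∀ t, SmoothPer (v t)
  cu : ∀ j, Continuous fun z : ℝ × ℝ => jet (u z.1) z.2 j
  cv : ∀ j, Continuous fun z : ℝ × ℝ => jet (v z.1) z.2 j
  der : ∀ j x t, HasDerivAt (fun t => jet (u t) x j) (jet (v t) x j) t

lemma curve_trig (n : ℕ) {c d : ℝ → ℤ → ℂ} (h : ∀ k t, HasDerivAt (fun t => c t k) (d t k) t)
    (hd : ∀ k, Continuous fun t => d t k) :
    Curve (fun t => trig n (c t)) (fun t => trig n (d t)) := by
  have hc : ∀ k, Continuous fun t => c t k := fun k =>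
    continuous_iff_continuousAt.2 fun t => (h k t).continuousAt
  refine ⟨fun t => trig_smoothPer _ _, fun t => trig_smoothPer _ _, fun j => ?_, fun j => ?_,
    fun j x t => ?_⟩
  · simp only [jet_trig, trig]
    refine Complex.continuous_re.comp (continuous_finsetSum _ fun k _ => ?_)
    exact (continuous_const.mul ((hc k).comp continuous_fst)).mul
      ((ek_continuous k).comp continuous_snd)
  · simp only [jet_trig, trig]
    refine Complex.continuous_re.comp (continuous_finsetSum _ fun k _ => ?_)
    exact (continuous_const.mul ((hd k).comp continuous_fst)).mul
      ((ek_continuous k).comp continuous_snd)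
  · simp only [jet_trig, trig]
    exact Complex.reCLM.hasFDerivAt.comp_hasDerivAt t (HasDerivAt.fun_sum fun k _ =>
      ((h k t).const_mul _).mul_const _)

section

variable {u v : ℝ → ℝ → ℝ}

lemma Curve.continuous_ev (h : Curve u v) {r : ℕ} {p : MvPolynomial ℕ ℝ} (hp : p ∈ ordLE r) :
    Continuous fun z : ℝ × ℝ => ev p (u z.1) z.2 := by
  unfold ev
  exact continuous_eval_jet (y := fun z : ℝ × ℝ => jet (u z.1) z.2) hp fun j _ => h.cu j

lemma Curve.continuous_lin (h : Curve u v) (r : ℕ) (p : MvPolynomial ℕ ℝ) :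
    Continuous fun z : ℝ × ℝ => lin r p (jet (u z.1) z.2) (jet (v z.1) z.2) := by
  unfold lin
  refine continuous_finsetSum _ fun j _ => ?_
  obtain ⟨r', hp⟩ := exists_ordLE (pderiv j p)
  exact (h.continuous_ev hp).mul (h.cv j)

lemma Curve.hasDerivAt_ev (h : Curve u v) {r : ℕ} {p : MvPolynomial ℕ ℝ} (hp : p ∈ ordLE r)
    (x t : ℝ) : HasDerivAt (fun t => ev p (u t) x) (lin r p (jet (u t) x) (jet (v t) x)) t :=
  hasDerivAt_eval hp (y := fun t => jet (u t) x) fun j _ => h.der j x t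

lemma Curve.hasDerivAt_mean (h : Curve u v) {r : ℕ} {p : MvPolynomial ℕ ℝ} (hp : p ∈ ordLE r)
    (t : ℝ) : HasDerivAt (fun t => mean p (u t))
      ((2 * π)⁻¹ * ∫ x in (0:ℝ)..(2 * π), lin r p (jet (u t) x) (jet (v t) x)) t :=
  (hasDerivAt_integral_of_continuous (h.continuous_ev hp) (h.continuous_lin r p)
    (fun x t => h.hasDerivAt_ev hp x t) _ _ t).const_mul _

lemma Curve.continuous_mean (h : Curve u v) {r : ℕ} {p : MvPolynomial ℕ ℝ} (hp : p ∈ ordLE r) :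
    Continuous fun t => mean p (u t) :=
  continuous_iff_continuousAt.2 fun t => (h.hasDerivAt_mean hp t).continuousAt

lemma Curve.continuous_meanLin (h : Curve u v) (r : ℕ) (p : MvPolynomial ℕ ℝ) :
    Continuous fun t => (2 * π)⁻¹ * ∫ x in (0:ℝ)..(2 * π), lin r p (jet (u t) x) (jet (v t) x) :=
  (intervalIntegral.continuous_parametric_intervalIntegral_of_continuous'
    (f := fun t x => lin r p (jet (u t) x) (jet (v t) x)) (h.continuous_lin r p) _ _).const_mul _

lemma Curve.hasDerivAt_weight (h : Curve u v) (γ0 : ℝ) {r : ℕ} {p : MvPolynomial ℕ ℝ}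
    (hp : p ∈ ordLE r) (x t : ℝ) :
    HasDerivAt (fun t => weight γ0 p (u t) x) (weightDot γ0 r p (u t) (v t) x) t := by
  refine (hasDerivAt_integral_of_continuous (F := fun t y => ev p (u t) y - mean p (u t)) ?_
    (F' := fun t y => lin r p (jet (u t) y) (jet (v t) y) -
      (2 * π)⁻¹ * ∫ x in (0:ℝ)..(2 * π), lin r p (jet (u t) x) (jet (v t) x)) ?_
    (fun x t => (h.hasDerivAt_ev hp x t).fun_sub (h.hasDerivAt_mean hp t)) 0 x t).const_mul _
  · exact (h.continuous_ev hp).sub ((h.continuous_mean hp).comp continuous_fst)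
  · exact (h.continuous_lin r p).sub ((h.continuous_meanLin r p).comp continuous_fst)

lemma Curve.continuous_weight (h : Curve u v) (γ0 : ℝ) {r : ℕ} {p : MvPolynomial ℕ ℝ}
    (hp : p ∈ ordLE r) : Continuous fun z : ℝ × ℝ => weight γ0 p (u z.1) z.2 :=
  (intervalIntegral.continuous_parametric_primitive_of_continuous
    (f := fun t y => ev p (u t) y - mean p (u t))
    ((h.continuous_ev hp).sub ((h.continuous_mean hp).comp continuous_fst))).const_mul _

lemma Curve.continuous_weightDot (h : Curve u v) (γ0 : ℝ) (r : ℕ) (p : MvPolynomial ℕ ℝ) :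
    Continuous fun z : ℝ × ℝ => weightDot γ0 r p (u z.1) (v z.1) z.2 :=
  (intervalIntegral.continuous_parametric_primitive_of_continuous
    (f := fun t y => lin r p (jet (u t) y) (jet (v t) y) -
      (2 * π)⁻¹ * ∫ x in (0:ℝ)..(2 * π), lin r p (jet (u t) x) (jet (v t) x))
    ((h.continuous_lin r p).sub ((h.continuous_meanLin r p).comp continuous_fst))).const_mul _

lemma Curve.hasDerivAt_sob (h : Curve u v) (m : ℕ) (t : ℝ) :
    HasDerivAt (fun t => sob m (u t))
      (∫ x in (0:ℝ)..(2 * π), 2 * jet (u t) x m * jet (v t) x m) t := by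
  have c1 := h.cu m
  have c2 := h.cv m
  refine hasDerivAt_integral_of_continuous (F := fun t x => jet (u t) x m ^ 2)
    (F' := fun t x => 2 * jet (u t) x m * jet (v t) x m) (by fun_prop) (by fun_prop)
    (fun x t => ?_) _ _ t
  simpa using (h.der m x t).fun_pow 2

lemma Curve.continuous_sob (h : Curve u v) (m : ℕ) : Continuous fun t => sob m (u t) :=
  continuous_iff_continuousAt.2 fun t => (h.hasDerivAt_sob m t).continuousAt

lemma Curve.hasDerivAt_energyCorr (h : Curve u v) (γ0 : ℝ) {N : MvPolynomial ℕ ℝ}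
    (hN : N ∈ ordLE 3) (m : ℕ) (t : ℝ) : HasDerivAt (fun t => energyCorr γ0 N m (u t))
      (∫ x in (0:ℝ)..(2 * π), (2 * weight γ0 (parab N m) (u t) x * jet (u t) x (m - 1)
        * jet (v t) x (m - 1) + weightDot γ0 4 (parab N m) (u t) (v t) x
        * jet (u t) x (m - 1) ^ 2)) t := by
  have c1 := h.cu (m - 1)
  have c2 := h.cv (m - 1)
  have c3 := h.continuous_weight γ0 (parab_mem hN m)
  have c4 := h.continuous_weightDot γ0 4 (parab N m)
  refine hasDerivAt_integral_of_continuous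
    (F := fun t x => weight γ0 (parab N m) (u t) x * jet (u t) x (m - 1) ^ 2)
    (F' := fun t x => (2 * weight γ0 (parab N m) (u t) x * jet (u t) x (m - 1)
        * jet (v t) x (m - 1) + weightDot γ0 4 (parab N m) (u t) (v t) x
        * jet (u t) x (m - 1) ^ 2)) (by fun_prop) (by fun_prop)
    (fun x t => ?_) _ _ t
  have := (h.hasDerivAt_weight γ0 (parab_mem hN m) x t).fun_mul ((h.der (m - 1) x t).fun_pow 2)
  refine this.congr_deriv ?_
  simp only [weightDot]
  norm_num
  ring

lemma Curve.hasDerivAt_energy (h : Curve u v) (γ0 : ℝ) {N : MvPolynomial ℕ ℝ}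
    (hN : N ∈ ordLE 3) (m : ℕ) (t : ℝ) :
    HasDerivAt (fun t => sob m (u t) + energyCorr γ0 N m (u t))
      (energyDot γ0 N m (u t) (v t)) t := by
  have := (h.hasDerivAt_sob m t).fun_add (h.hasDerivAt_energyCorr γ0 hN m t)
  have c1 := (h.hu t).continuous
  have c2 := (h.hv t).continuous
  have c3 := weight_continuous γ0 (parab N m) (h.hu t)
  have c4 := weightDot_continuous (h.hu t) (h.hv t) γ0 4 (parab N m)
  rw [← intervalIntegral.integral_add (Continuous.intervalIntegrable (by fun_prop) _ _)
    (Continuous.intervalIntegrable (by fun_prop) _ _)] at this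
  simp only [← add_assoc] at this
  exact this

end

lemma sub_le_of_hasDerivAt_le {f f' : ℝ → ℝ} {a b C : ℝ} (hab : a ≤ b)
    (h : ∀ t, HasDerivAt f (f' t) t) (hC : ∀ t ∈ Set.Icc a b, f' t ≤ C) :
    f b - f a ≤ C * (b - a) := by
  rcases hab.eq_or_lt with rfl | hab
  · simp
  obtain ⟨c, hc, e⟩ := exists_hasDerivAt_eq_slope f f' hab
    (fun t _ => (h t).continuousAt.continuousWithinAt) fun t _ => h t
  have := hC c (Set.Ioo_subset_Icc_self hc)
  rw [e, div_le_iff₀ (by linarith)] at this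
  exact this

/-- A continuity argument. -/
lemma neg_of_continuation {f : ℝ → ℝ} (hf : Continuous f) {T : ℝ} (h0 : f 0 < 0)
    (h : ∀ t ∈ Set.Icc 0 T, (∀ s ∈ Set.Icc 0 t, f s ≤ 0) → f t < 0) :
    ∀ t ∈ Set.Icc 0 T, f t < 0 := by
  by_contra! hc
  obtain ⟨t, ht, hft⟩ := hc
  obtain ⟨τ, ⟨hτ, hfτ⟩, hm⟩ := (isCompact_Icc.inter_right
    (isClosed_le continuous_const hf : IsClosed {x | 0 ≤ f x})).exists_isLeast ⟨t, ht, hft⟩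
  obtain ⟨x, hx, hfx⟩ := intermediate_value_Icc hτ.1 hf.continuousOn ⟨h0.le, hfτ⟩
  have e : τ ≤ x := hm ⟨⟨hx.1, hx.2.trans hτ.2⟩, hfx.ge⟩
  obtain rfl : x = τ := le_antisymm hx.2 e
  refine (h x hτ fun s hs => ?_).not_ge hfτ
  by_contra! hs'
  have := hm ⟨⟨hs.1, hs.2.trans hτ.2⟩, hs'.le⟩
  obtain rfl : s = x := le_antisymm hs.2 this
  linarith

lemma pow_le_one_add_pow {x : ℝ} (hx : 0 ≤ x) {j m : ℕ} (h : j ≤ m) : x ^ j ≤ 1 + x ^ m := by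
  rcases le_total x 1 with h1 | h1
  · have := pow_le_one₀ hx h1 (n := j)
    have := pow_nonneg hx m
    linarith
  · have := pow_le_pow_right₀ h1 h
    linarith

lemma exists_pow_le {ε : ℝ} (hε : 0 < ε) {j m : ℕ} (h : j < m) :
    ∃ C : ℝ, 0 ≤ C ∧ ∀ x : ℝ, 0 ≤ x → x ^ j ≤ C + ε * x ^ m := by
  refine ⟨(max 1 ε⁻¹) ^ j, by positivity, fun x hx => ?_⟩
  rcases le_total x (max 1 ε⁻¹) with h1 | h1
  · have := pow_le_pow_left₀ hx h1 j
    have : 0 ≤ ε * x ^ m := by positivity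
    linarith
  · have h2 : 1 ≤ x := (le_max_left _ _).trans h1
    have h3 : ε⁻¹ ≤ x := (le_max_right _ _).trans h1
    have h4 : 1 ≤ ε * x := by rwa [inv_le_iff_one_le_mul₀' hε] at h3
    have h5 : x ^ (j + 1) ≤ x ^ m := pow_le_pow_right₀ h2 h
    have h6 : x ^ j ≤ ε * x ^ (j + 1) := by
      rw [pow_succ]
      nlinarith [pow_nonneg hx j]
    have h7 : ε * x ^ (j + 1) ≤ ε * x ^ m := by gcongr
    have : 0 ≤ (max 1 ε⁻¹) ^ j := by positivity
    linarith

lemma IsTrig.sob_le_of_pow_le {n : ℕ} {u : ℝ → ℝ} (h : IsTrig n u) {j m : ℕ} {A B : ℝ}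
    (hx : ∀ x : ℝ, 0 ≤ x → x ^ j ≤ A + B * x ^ m) : sob j u ≤ A * sob 0 u + B * sob m u := by
  have e : A * sob 0 u + B * sob m u = 2 * π * ∑ k ∈ Finset.Icc (-n : ℤ) n,
      (A + B * (k : ℝ) ^ (2 * m)) * ‖fc u k‖ ^ 2 := by
    rw [h.sob_eq, h.sob_eq]
    simp only [Finset.mul_sum]
    rw [← Finset.sum_add_distrib]
    exact Finset.sum_congr rfl fun k _ => by ring
  rw [e, h.sob_eq]
  refine mul_le_mul_of_nonneg_left (Finset.sum_le_sum fun k _ => ?_) two_pi_nonneg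
  refine mul_le_mul_of_nonneg_right ?_ (sq_nonneg _)
  rw [pow_mul, pow_mul]
  exact hx _ (sq_nonneg _)

lemma IsTrig.sob_le_add {n : ℕ} {u : ℝ → ℝ} (h : IsTrig n u) {j m : ℕ} (hj : j ≤ m) :
    sob j u ≤ sob 0 u + sob m u := by
  have := h.sob_le_of_pow_le (j := j) (m := m) (A := 1) (B := 1)
    fun x hx => by simpa using pow_le_one_add_pow hx hj
  simpa using this

lemma exists_sob_le {ε : ℝ} (hε : 0 < ε) {j m : ℕ} (h : j < m) :
    ∃ C : ℝ, 0 ≤ C ∧ ∀ n u, IsTrig n u → sob j u ≤ C * sob 0 u + ε * sob m u := by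
  obtain ⟨C, hC, hx⟩ := exists_pow_le hε h
  exact ⟨C, hC, fun n u hu => hu.sob_le_of_pow_le hx⟩

lemma IsTrig.sobLE {n : ℕ} {u : ℝ → ℝ} (h : IsTrig n u) {m : ℕ} {A B : ℝ} (h0 : sob 0 u ≤ A)
    (hm : sob m u ≤ B) : SobLE m (A + B) u := fun j hj => by
  have := h.sob_le_add hj
  linarith

section

variable {γ0 : ℝ} (γ1 γ2 : ℝ) {N : MvPolynomial ℕ ℝ}

/-- Low order norms vary slowly along the flow. -/
lemma exists_bound_sobDot (γ0 : ℝ) (hN : N ∈ ordLE 3) (j : ℕ) (M : ℝ) :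
    ∃ B : ℝ, 0 ≤ B ∧ ∀ u v f, Flow γ0 γ1 γ2 N u v f → ∀ m, j + 6 ≤ m → SobLE m M u →
      |∫ x in (0:ℝ)..(2 * π), 2 * jet u x j * jet v x j| ≤ B := by
  obtain ⟨B, hB, b⟩ := exists_bound_velocity γ0 γ1 γ2 hN j M
  refine ⟨2 * π * (2 * |1 + 4 * M| * B), by positivity, fun u v f h m hm hM => ?_⟩
  have c1 := h.hu.continuous j
  have c2 := h.hv.continuous j
  refine abs_integral_le (fun x => ?_) ⟨two_pi_nonneg, le_rfl⟩
  have b1 := h.hu.abs_jet_le hM (j := j) (by omega) x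
  have b2 := b u v f h m hm hM x
  rw [abs_mul, abs_mul, abs_two]
  exact mul_le_mul (mul_le_mul_of_nonneg_left (b1.trans (le_abs_self _)) zero_le_two) b2
    (abs_nonneg _) (by positivity)

/-- The modified energy is comparable with the top order norm. -/
lemma exists_energyCorr_le (γ0 : ℝ) (hN : N ∈ ordLE 3) {m : ℕ} (hm : 1 ≤ m) (M : ℝ) :
    ∃ C : ℝ, 0 ≤ C ∧ ∀ n u, IsTrig n u → SobLE 5 M u → sob 0 u ≤ M →
      |energyCorr γ0 N m u| ≤ C + 1 / 2 * sob m u := by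
  obtain ⟨B, hB, b⟩ := exists_bound_weight γ0 (parab_mem hN m) M
  obtain ⟨C, hC, hc⟩ := exists_sob_le (ε := (2 * (B + 1))⁻¹) (by positivity)
    (show m - 1 < m by omega)
  refine ⟨B * (C * |M|), by positivity, fun n u hu h5 h0 => ?_⟩
  have cu := hu.smoothPer.continuous (m - 1)
  have cw := weight_continuous γ0 (parab N m) hu.smoothPer
  have h1 : |energyCorr γ0 N m u| ≤ B * sob (m - 1) u := by
    have e : B * sob (m - 1) u = ∫ x in (0:ℝ)..(2 * π), B * jet u x (m - 1) ^ 2 := by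
      rw [sob, intervalIntegral.integral_const_mul]
    rw [e, energyCorr]
    refine (intervalIntegral.abs_integral_le_integral_abs two_pi_nonneg).trans ?_
    refine integral_mono_of_continuous (by fun_prop) (by fun_prop) fun x => ?_
    rw [abs_mul, abs_of_nonneg (sq_nonneg (jet u x (m - 1)))]
    exact mul_le_mul_of_nonneg_right (b u hu.smoothPer 5 (by norm_num) h5 x) (sq_nonneg _)
  have h2 := hc n u hu
  have h3 : B * sob (m - 1) u ≤ B * (C * |M| + (2 * (B + 1))⁻¹ * sob m u) := by
    refine mul_le_mul_of_nonneg_left (h2.trans ?_) hB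
    gcongr
    exact h0.trans (le_abs_self M)
  have h4 : B * ((2 * (B + 1))⁻¹ * sob m u) ≤ 1 / 2 * sob m u := by
    rw [← mul_assoc]
    refine mul_le_mul_of_nonneg_right ?_ (sob_nonneg _ _)
    rw [mul_inv_le_iff₀ (by positivity)]
    linarith
  linarith

/-- Uniform control of the trajectories on a short time interval. -/
lemma exists_time (hγ0 : γ0 ≠ 0) (hN : N ∈ ordLE 3) (M0 : ℝ) {δ : ℝ} (hδ : 0 < δ) :
    ∃ T : ℝ, 0 < T ∧ T ≤ 1 ∧ ∃ M R : ℝ, ∀ u v : ℝ → ℝ → ℝ, Curve u v →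
      (∀ t, ∃ n, IsTrig n (u t)) →
      (∀ t ∈ Set.Icc (0:ℝ) 1, sob 0 (u t) ≤ R → ∃ f, Flow γ0 γ1 γ2 N (u t) (v t) f) →
      SobLE 12 M0 (u 0) → 9 / 5 * δ ≤ mean (pderiv 2 N) (u 0) →
      ∀ t ∈ Set.Icc 0 T, sob 0 (u t) ≤ R ∧ SobLE 12 M (u t) ∧
        11 / 10 * δ ≤ mean (pderiv 2 N) (u t) := by
  obtain ⟨C3, hC3, h3⟩ := exists_energyCorr_le γ0 hN (m := 12) (by norm_num) (2 * (M0 + 1))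
  obtain ⟨C1, hC1, h1⟩ := exists_energyDot_le γ0 γ1 γ2 hγ0 hN (m := 12) (by norm_num)
    ((M0 + 1) + (3 * M0 + 4 * C3 + 2)) hδ
  set M1 : ℝ := 3 * M0 + 4 * C3 + 2 with hM1
  obtain ⟨B0, hB0, b0⟩ := exists_bound_sobDot γ1 γ2 γ0 hN 0 ((M0 + 1) + M1)
  obtain ⟨B6, hB6, b6⟩ := exists_bound_sobDot γ1 γ2 γ0 hN 6 ((M0 + 1) + M1)
  obtain ⟨BP, hBP, bP⟩ := exists_bound_lin γ0 γ1 γ2 hN (pderiv_mem_ordLE hN 2) ((M0 + 1) + M1)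
  obtain ⟨T, hT, hT1, hTB, hTC, hTP⟩ : ∃ T : ℝ, 0 < T ∧ T ≤ 1 ∧ (B0 + B6) * T < 1 ∧
      2 * (C1 * (1 + |M1|)) * T < 1 ∧ BP * T < δ / 10 := by
    set A : ℝ := (B0 + B6) + 2 * (C1 * (1 + |M1|)) + BP * (10 / δ) with hA
    have h1 : 0 ≤ 2 * (C1 * (1 + |M1|)) := by positivity
    have h2 : 0 ≤ BP * (10 / δ) := by positivity
    have h3 : 0 ≤ B0 + B6 := by positivity
    have hA0 : 0 ≤ A := by positivity
    have hlt : ∀ x ≤ A, x * (A + 1)⁻¹ < 1 := fun x hx => by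
      rw [mul_inv_lt_iff₀ (by positivity)]
      linarith
    refine ⟨(A + 1)⁻¹, by positivity, inv_le_one_of_one_le₀ (by linarith), hlt _ (by linarith),
      hlt _ (by linarith), ?_⟩
    have := hlt (BP * (10 / δ)) (by linarith)
    have e : BP * (A + 1)⁻¹ = BP * (10 / δ) * (A + 1)⁻¹ * (δ / 10) := by field_simp
    rw [e]
    exact mul_lt_of_lt_one_left (by positivity) this
  refine ⟨T, hT, hT1, (M0 + 1) + M1, M0 + 1, fun u v h htr hfl hi hmi => ?_⟩
  have hM0 : 0 ≤ M0 := (sob_nonneg 0 (u 0)).trans (hi 0 (by norm_num))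
  have hM1' : 0 ≤ M1 := by positivity
  set F : ℝ → ℝ := fun t => max (max (sob 0 (u t) - (M0 + 1)) (sob 6 (u t) - (M0 + 1)))
    (max (sob 12 (u t) - M1) (11 / 10 * δ - mean (pderiv 2 N) (u t))) with hF
  have c0 := h.continuous_sob 0
  have c6 := h.continuous_sob 6
  have c12 := h.continuous_sob 12
  have cm := h.continuous_mean (pderiv_mem_ordLE hN 2)
  have hFc : Continuous F := by fun_prop
  have key : ∀ t, F t ≤ 0 → t ∈ Set.Icc (0:ℝ) 1 → (∃ f, Flow γ0 γ1 γ2 N (u t) (v t) f) ∧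
      SobLE 12 ((M0 + 1) + M1) (u t) ∧ 11 / 10 * δ ≤ mean (pderiv 2 N) (u t) := by
    intro t ht ht1
    simp only [hF, max_le_iff, sub_nonpos] at ht
    obtain ⟨n, hn⟩ := htr t
    exact ⟨hfl t ht1 ht.1.1, hn.sobLE ht.1.1 ht.2.1, ht.2.2⟩
  suffices hneg : ∀ t ∈ Set.Icc 0 T, F t < 0 from
    fun t ht => ⟨by
      have h := hneg t ht
      simp only [hF, max_lt_iff, sub_neg] at h
      exact h.1.1.le, (key t (hneg t ht).le ⟨ht.1, ht.2.trans hT1⟩).2⟩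
  refine neg_of_continuation hFc ?_ fun t ht hs => ?_
  · simp only [hF, max_lt_iff, sub_neg]
    have i0 := hi 0 (by norm_num)
    have i6 := hi 6 (by norm_num)
    have i12 := hi 12 le_rfl
    exact ⟨⟨by linarith, by linarith⟩, by linarith, by linarith⟩
  have hk : ∀ s ∈ Set.Icc 0 t, (∃ f, Flow γ0 γ1 γ2 N (u s) (v s) f) ∧
      SobLE 12 ((M0 + 1) + M1) (u s) ∧ 11 / 10 * δ ≤ mean (pderiv 2 N) (u s) :=
    fun s hs' => key s (hs s hs') ⟨hs'.1, hs'.2.trans (ht.2.trans hT1)⟩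
  have e0 := sub_le_of_hasDerivAt_le ht.1 (h.hasDerivAt_sob 0) (C := B0) fun s hs' => by
    obtain ⟨⟨f, hf⟩, hM, -⟩ := hk s hs'
    exact (le_abs_self _).trans (b0 _ _ f hf 12 (by norm_num) hM)
  have e6 := sub_le_of_hasDerivAt_le ht.1 (h.hasDerivAt_sob 6) (C := B6) fun s hs' => by
    obtain ⟨⟨f, hf⟩, hM, -⟩ := hk s hs'
    exact (le_abs_self _).trans (b6 _ _ f hf 12 (by norm_num) hM)
  have eP := sub_le_of_hasDerivAt_le ht.1
    (fun s => (h.hasDerivAt_mean (pderiv_mem_ordLE hN 2) s).fun_neg) (C := BP) fun s hs' => by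
    obtain ⟨⟨f, hf⟩, hM, -⟩ := hk s hs'
    refine (neg_le_abs _).trans ?_
    refine abs_mean_le fun x => ?_
    exact bP _ _ f hf 12 (by norm_num) hM x
  have e12 := sub_le_of_hasDerivAt_le ht.1 (h.hasDerivAt_energy γ0 hN 12) (C := C1 * (1 + M1))
    fun s hs' => by
    obtain ⟨⟨f, hf⟩, hM, hm⟩ := hk s hs'
    have h12 := hs s hs'
    simp only [hF, max_le_iff, sub_nonpos] at h12
    refine (h1 _ _ f hf (hM.mono (by norm_num) le_rfl) (by linarith)).trans ?_
    have := sob_nonneg 13 (u s)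
    have : C1 * (1 + sob 12 (u s)) ≤ C1 * (1 + M1) := by gcongr; exact h12.2.1
    nlinarith
  rw [abs_of_nonneg hM1'] at hTC
  have i0 := hi 0 (by norm_num)
  have i6 := hi 6 (by norm_num)
  have i12 := hi 12 le_rfl
  have t0 : B0 * (t - 0) ≤ B0 * T := by gcongr; linarith [ht.2]
  have t6 : B6 * (t - 0) ≤ B6 * T := by gcongr; linarith [ht.2]
  have tP : BP * (t - 0) ≤ BP * T := by gcongr; linarith [ht.2]
  have t12 : C1 * (1 + M1) * (t - 0) ≤ C1 * (1 + M1) * T := by gcongr; linarith [ht.2]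
  have p0 : 0 ≤ B0 * T := by positivity
  have p6 : 0 ≤ B6 * T := by positivity
  have l0 : sob 0 (u t) < M0 + 1 := by linarith
  have l6 : sob 6 (u t) < M0 + 1 := by linarith
  obtain ⟨n, hn⟩ := htr t
  obtain ⟨n', hn'⟩ := htr 0
  have k1 := h3 n (u t) hn ((hn.sobLE l0.le l6.le).mono (by norm_num) (by linarith)) (by linarith)
  have k2 := h3 n' (u 0) hn' (hi.mono (by norm_num) (by linarith)) (by linarith)
  have k3 := neg_abs_le (energyCorr γ0 N 12 (u t))
  have k4 := le_abs_self (energyCorr γ0 N 12 (u 0))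
  simp only [hF, max_lt_iff, sub_neg]
  exact ⟨⟨l0, l6⟩, by linarith, by linarith⟩

end

/-- A trajectory of the truncated parabolic flow. -/
structure Traj (γ0 γ1 γ2 : ℝ) (N : MvPolynomial ℕ ℝ) (δ T : ℝ) (u v : ℝ → ℝ → ℝ) : Prop where
  curve : Curve u v
  trig : ∃ n, ∀ t, IsTrig n (u t)
  flow : ∀ t ∈ Set.Icc 0 T, ∃ f, Flow γ0 γ1 γ2 N (u t) (v t) f
  mean_ge : ∀ t ∈ Set.Icc 0 T, δ ≤ mean (pderiv 2 N) (u t)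

section

variable {γ0 : ℝ} (γ1 γ2 : ℝ) {N : MvPolynomial ℕ ℝ}

/-- Propagation of the norm of order `m` and gain of one derivative in time average. -/
lemma exists_level (hγ0 : γ0 ≠ 0) (hN : N ∈ ordLE 3) {m : ℕ} (hm : 12 ≤ m) (M : ℝ) {δ : ℝ}
    (hδ : 0 < δ) : ∃ K : ℝ, 0 ≤ K ∧ ∀ T u v, Traj γ0 γ1 γ2 N δ T u v → ∀ t0 t1, 0 ≤ t0 → t0 ≤ t1 →
      t1 ≤ T → t1 - t0 ≤ 1 → (∀ t ∈ Set.Icc t0 t1, SobLE (m - 1) M (u t)) →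
      sob m (u t1) ≤ K * (1 + sob m (u t0)) ∧
      ∃ t ∈ Set.Icc t0 t1, (t1 - t0) * sob (m + 1) (u t) ≤ K * (1 + sob m (u t0)) := by
  obtain ⟨C, hC, hdot⟩ := exists_energyDot_le γ0 γ1 γ2 hγ0 hN hm M hδ
  obtain ⟨B, hB, hcor⟩ := exists_bound_energyCorr γ0 hN (m := m) (by omega) M
  set L : ℝ := exp C * (2 * B + 1) with hL
  have hL0 : 0 ≤ L := by positivity
  refine ⟨L + δ⁻¹ * L, by positivity, fun T u v h t0 t1 ht0 ht01 ht1 hle hM => ?_⟩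
  set W : ℝ → ℝ := fun t => sob m (u t) + energyCorr γ0 N m (u t) + (B + 1) with hW
  have hWd : ∀ t, HasDerivAt W (energyDot γ0 N m (u t) (v t)) t := fun t =>
    (h.curve.hasDerivAt_energy γ0 hN m t).add_const _
  have hcor' : ∀ t ∈ Set.Icc t0 t1, |energyCorr γ0 N m (u t)| ≤ B := fun t ht =>
    hcor _ (h.curve.hu t) (hM t ht)
  have hW1 : ∀ t ∈ Set.Icc t0 t1, 1 + sob m (u t) ≤ W t := fun t ht => by
    have := (abs_le.1 (hcor' t ht)).1
    simp only [hW]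
    linarith
  have hWdot : ∀ t ∈ Set.Icc t0 t1,
      energyDot γ0 N m (u t) (v t) - C * W t ≤ -(δ * sob (m + 1) (u t)) := fun t ht => by
    have htT : t ∈ Set.Icc 0 T := ⟨ht0.trans ht.1, ht.2.trans ht1⟩
    obtain ⟨f, hf⟩ := h.flow t htT
    have h1 := hdot _ _ f hf (hM t ht) (h.mean_ge t htT)
    have h2 := mul_le_mul_of_nonneg_left (hW1 t ht) hC
    linarith
  set Z : ℝ → ℝ := fun t => W t * exp (-C * (t - t0)) with hZ
  have hZd : ∀ t, HasDerivAt Z ((energyDot γ0 N m (u t) (v t) - C * W t) *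
      exp (-C * (t - t0))) t := fun t => by
    have h1 : HasDerivAt (fun t => exp (-C * (t - t0))) (exp (-C * (t - t0)) * (-C * 1)) t :=
      (((hasDerivAt_id' t).sub_const t0).const_mul (-C)).exp
    exact ((hWd t).fun_mul h1).congr_deriv (by ring)
  have hexp : ∀ t ∈ Set.Icc t0 t1, exp (-C) ≤ exp (-C * (t - t0)) := fun t ht => by
    apply exp_le_exp.2
    nlinarith [ht.1, ht.2]
  have hZ0 : Z t0 = W t0 := by simp [hZ]
  have hWt0 : W t0 ≤ (2 * B + 1) * (1 + sob m (u t0)) := by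
    have := (abs_le.1 (hcor' t0 ⟨le_rfl, ht01⟩)).2
    have := sob_nonneg m (u t0)
    simp only [hW]
    nlinarith
  have hS : ∀ t, 0 ≤ 1 + sob m (u t) := fun t => by
    have := sob_nonneg m (u t)
    linarith
  have hZW : ∀ t ∈ Set.Icc t0 t1, (1 + sob m (u t)) * exp (-C) ≤ Z t := fun t ht =>
    mul_le_mul (hW1 t ht) (hexp t ht) (exp_pos _).le ((hS t).trans (hW1 t ht))
  have hpos : 0 < exp (-C) := exp_pos _
  have heC : exp C * exp (-C) = 1 := by rw [← exp_add]; simp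
  have main : ∀ D : ℝ, D * exp (-C) ≤ W t0 → D ≤ L * (1 + sob m (u t0)) := fun D hD => by
    have h1 : exp C * (D * exp (-C)) ≤ exp C * ((2 * B + 1) * (1 + sob m (u t0))) :=
      mul_le_mul_of_nonneg_left (hD.trans hWt0) (exp_pos _).le
    have h2 : exp C * (D * exp (-C)) = D * (exp C * exp (-C)) := by ring
    rw [h2, heC] at h1
    rw [hL]
    linarith
  have hLS : 0 ≤ δ⁻¹ * L * (1 + sob m (u t0)) := mul_nonneg (by positivity) (hS t0)
  have hLS' : 0 ≤ L * (1 + sob m (u t0)) := mul_nonneg (by positivity) (hS t0)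
  have dec : Z t1 - Z t0 ≤ 0 * (t1 - t0) := sub_le_of_hasDerivAt_le ht01 hZd fun t ht => by
    have h1 := hWdot t ht
    have h2 : 0 ≤ δ * sob (m + 1) (u t) := mul_nonneg hδ.le (sob_nonneg _ _)
    exact mul_nonpos_of_nonpos_of_nonneg (by linarith) (exp_pos _).le
  refine ⟨?_, ?_⟩
  · have h1 := hZW t1 ⟨ht01, le_rfl⟩
    have h2 := main (1 + sob m (u t1)) (by linarith)
    linarith
  · by_contra! hcon
    have h3 : Z t1 - Z t0 ≤ _ := sub_le_of_hasDerivAt_le ht01 hZd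
      (C := -((L + δ⁻¹ * L) * (1 + sob m (u t0)) * δ / (t1 - t0) * exp (-C))) fun t ht => by
      have h1 := hWdot t ht
      have h2 := hcon t ht
      have h4 : 0 < t1 - t0 := by
        rcases ht01.eq_or_lt with e | e
        · rw [← e] at h2
          linarith
        · linarith
      have h5 : (L + δ⁻¹ * L) * (1 + sob m (u t0)) * δ / (t1 - t0) ≤ δ * sob (m + 1) (u t) := by
        rw [div_le_iff₀ h4]
        nlinarith
      have h6 : 0 ≤ δ * sob (m + 1) (u t) := mul_nonneg hδ.le (sob_nonneg _ _)
      have h7 := mul_le_mul h5 (hexp t ht) hpos.le h6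
      have h8 := mul_le_mul_of_nonneg_right h1 (exp_pos (-C * (t - t0))).le
      linarith
    have h4 : 0 < t1 - t0 := by
      have h2 := hcon t0 ⟨le_rfl, ht01⟩
      rcases ht01.eq_or_lt with e | e
      · rw [← e] at h2
        linarith
      · linarith
    have h5 : 0 < Z t1 := lt_of_lt_of_le
      (mul_pos (by linarith [sob_nonneg m (u t1)]) hpos) (hZW t1 ⟨ht01, le_rfl⟩)
    have h6 : -((L + δ⁻¹ * L) * (1 + sob m (u t0)) * δ / (t1 - t0) * exp (-C)) * (t1 - t0) =
        -((L * δ + L) * (1 + sob m (u t0)) * exp (-C)) := by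
      field_simp
    rw [h6, hZ0] at h3
    by_cases hz : L * (1 + sob m (u t0)) = 0
    · have h7 : 0 ≤ exp (-C) := hpos.le
      have h8 : (L * δ + L) * (1 + sob m (u t0)) = 0 := by
        rw [show (L * δ + L) * (1 + sob m (u t0)) = (δ + 1) * (L * (1 + sob m (u t0))) by ring, hz,
          mul_zero]
      rw [h8] at h3
      have h9 := hW1 t0 ⟨le_rfl, ht01⟩
      have h10 := main (1 + sob m (u t0)) (by nlinarith [hS t0, exp_le_one_iff.2 (neg_nonpos.2 hC)])
      have h11 := sob_nonneg m (u t0)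
      linarith
    · have h7 := main ((L * δ + L) * (1 + sob m (u t0))) (by linarith)
      have h8 : 0 < δ * (L * (1 + sob m (u t0))) :=
        mul_pos hδ (lt_of_le_of_ne hLS' (Ne.symm hz))
      linarith

/-- Propagation of regularity up to the initial time. -/
lemma exists_persistence (hγ0 : γ0 ≠ 0) (hN : N ∈ ordLE 3) {δ T M : ℝ} (hδ : 0 < δ) (hT : T ≤ 1)
    (M0 : ℝ) {m : ℕ} (hm : 12 ≤ m) : ∃ K : ℝ, ∀ u v, Traj γ0 γ1 γ2 N δ T u v →
      (∀ t ∈ Set.Icc 0 T, SobLE 12 M (u t)) → SobLE m M0 (u 0) →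
      ∀ t ∈ Set.Icc 0 T, SobLE m K (u t) := by
  induction m, hm using Nat.le_induction with
  | base => exact ⟨M, fun u v _ h _ => h⟩
  | succ m hm ih =>
    obtain ⟨K, hK⟩ := ih
    obtain ⟨K', hK', h'⟩ := exists_level γ1 γ2 hγ0 hN (m := m + 1) (by omega) K hδ
    refine ⟨max K (K' * (1 + M0)), fun u v h hM h0 t ht j hj => ?_⟩
    have h1 := hK u v h hM (h0.mono (Nat.le_succ m) le_rfl)
    rcases hj.lt_or_eq with hj | rfl
    · exact (h1 t ht j (by omega)).trans (le_max_left _ _)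
    · refine le_trans ?_ (le_max_right _ _)
      have h2 := (h' T u v h 0 t le_rfl ht.1 ht.2 (by linarith [ht.2])
        fun s hs => h1 s ⟨hs.1, hs.2.trans ht.2⟩).1
      refine h2.trans (mul_le_mul_of_nonneg_left ?_ hK')
      linarith [h0 (m + 1) le_rfl]

/-- Smoothing for positive times. -/
lemma exists_smoothing (hγ0 : γ0 ≠ 0) (hN : N ∈ ordLE 3) {δ T M : ℝ} (hδ : 0 < δ) (hT : T ≤ 1)
    {m : ℕ} (hm : 12 ≤ m) : ∀ τ : ℝ, 0 < τ → ∃ K : ℝ, ∀ u v, Traj γ0 γ1 γ2 N δ T u v →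
      (∀ t ∈ Set.Icc 0 T, SobLE 12 M (u t)) → ∀ t ∈ Set.Icc τ T, SobLE m K (u t) := by
  induction m, hm using Nat.le_induction with
  | base => exact fun τ hτ => ⟨M, fun u v _ h t ht => h t ⟨hτ.le.trans ht.1, ht.2⟩⟩
  | succ m hm ih =>
    intro τ hτ
    obtain ⟨K, hK⟩ := ih (τ / 2) (by positivity)
    obtain ⟨K1, hK1, h1⟩ := exists_level γ1 γ2 hγ0 hN (m := m) hm K hδ
    obtain ⟨K2, hK2, h2⟩ := exists_level γ1 γ2 hγ0 hN (m := m + 1) (by omega) K hδ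
    refine ⟨max K (K2 * (1 + K1 * (1 + K) / (τ / 2))), fun u v h hM t ht j hj => ?_⟩
    have hs := hK u v h hM
    rcases hj.lt_or_eq with hj | rfl
    · exact (hs t ⟨by linarith [ht.1], ht.2⟩ j (by omega)).trans (le_max_left _ _)
    · refine le_trans ?_ (le_max_right _ _)
      have htT : τ ≤ T := ht.1.trans ht.2
      obtain ⟨t', ht', e⟩ := (h1 T u v h (τ / 2) τ (by positivity) (by linarith) htT (by linarith)
        fun s hs' => (hs s ⟨hs'.1, hs'.2.trans htT⟩).mono (by omega) le_rfl).2
      have e2 := (h2 T u v h t' t (by linarith [ht'.1]) (ht'.2.trans ht.1) ht.2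
        (by linarith [ht'.1, ht.2])
        fun s hs' => hs s ⟨ht'.1.trans hs'.1, hs'.2.trans ht.2⟩).1
      refine e2.trans (mul_le_mul_of_nonneg_left ?_ hK2)
      have e3 : sob (m + 1) (u t') ≤ K1 * (1 + K) / (τ / 2) := by
        rw [le_div_iff₀ (by positivity)]
        have := hs (τ / 2) ⟨le_rfl, by linarith⟩ m le_rfl
        have := mul_le_mul_of_nonneg_left (add_le_add_right this 1) hK1
        linarith
      linarith

end

lemma abs_sub_le_of_hasDerivAt {f f' : ℝ → ℝ} {a b C : ℝ} (hab : a ≤ b)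
    (h : ∀ t, HasDerivAt f (f' t) t) (hC : ∀ t ∈ Set.Icc a b, |f' t| ≤ C) :
    |f b - f a| ≤ C * (b - a) := by
  refine abs_sub_le_iff.2 ⟨sub_le_of_hasDerivAt_le hab h fun t ht => (le_abs_self _).trans (hC t ht),
    ?_⟩
  have := sub_le_of_hasDerivAt_le hab (fun t => (h t).fun_neg) fun t ht =>
    (neg_le_abs _).trans (hC t ht)
  linarith

lemma jet_sub {u v : ℝ → ℝ} (hu : SmoothPer u) (hv : SmoothPer v) (x : ℝ) (j : ℕ) :
    jet (fun y => u y - v y) x j = jet u x j - jet v x j := by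
  have h1 := hu.1.contDiffAt (x := x)
  have h2 := hv.1.contDiffAt (x := x)
  exact iteratedDeriv_fun_sub (h1.of_le (by exact_mod_cast le_top))
    (h2.of_le (by exact_mod_cast le_top))

lemma trig_sub (n : ℕ) (c d : ℤ → ℂ) (x : ℝ) :
    trig n c x - trig n d x = trig n (fun k => c k - d k) x := by
  simp only [trig, sub_mul, Finset.sum_sub_distrib, Complex.sub_re]

lemma IsTrig.mono {n m : ℕ} {u : ℝ → ℝ} (h : IsTrig n u) (hnm : n ≤ m) : IsTrig m u := by
  obtain ⟨c, rfl⟩ := h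
  refine ⟨fun k => if k ∈ Finset.Icc (-n : ℤ) n then c k else 0, funext fun x => ?_⟩
  simp only [trig, ite_mul, zero_mul]
  rw [← Finset.sum_filter]
  congr 2
  ext k
  simp only [Finset.mem_Icc, Finset.mem_filter]
  omega

lemma IsTrig.sub {n : ℕ} {u v : ℝ → ℝ} (h : IsTrig n u) (h' : IsTrig n v) :
    IsTrig n fun x => u x - v x := by
  obtain ⟨c, rfl⟩ := h
  obtain ⟨d, rfl⟩ := h'
  exact ⟨_, funext fun x => trig_sub n c d x⟩

lemma sob_sub_le {u v : ℝ → ℝ} (hu : SmoothPer u) (hv : SmoothPer v) (j : ℕ) :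
    sob j (fun x => u x - v x) ≤ 2 * sob j u + 2 * sob j v := by
  have c1 := hu.continuous j
  have c2 := hv.continuous j
  have e : 2 * sob j u + 2 * sob j v =
      ∫ x in (0:ℝ)..(2 * π), (2 * jet u x j ^ 2 + 2 * jet v x j ^ 2) := by
    rw [intervalIntegral.integral_add (Continuous.intervalIntegrable (by fun_prop) _ _)
      (Continuous.intervalIntegrable (by fun_prop) _ _), intervalIntegral.integral_const_mul,
      intervalIntegral.integral_const_mul, sob, sob]
  rw [e, sob]
  simp only [jet_sub hu hv]
  exact integral_mono_of_continuous (by fun_prop) (by fun_prop) fun x => by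
    nlinarith [sq_nonneg (jet u x j + jet v x j)]

lemma sob_zero_le {u : ℝ → ℝ} (hu : Continuous u) {B : ℝ} (h : ∀ x, |u x| ≤ B) :
    sob 0 u ≤ 2 * π * B ^ 2 := by
  have e : 2 * π * B ^ 2 = ∫ x in (0:ℝ)..(2 * π), B ^ 2 := by simp
  rw [e, sob]
  simp only [jet_zero]
  exact integral_mono_of_continuous (by fun_prop) (by fun_prop) fun x => sq_le_sq' 
    (abs_le.1 (h x)).1 (abs_le.1 (h x)).2

section

variable {γ0 : ℝ} (γ1 γ2 : ℝ) {N : MvPolynomial ℕ ℝ}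

/-- Trajectories are uniformly Lipschitz in time. -/
lemma exists_lipschitz_time (γ0 : ℝ) (hN : N ∈ ordLE 3) (δ T M : ℝ) : ∃ B : ℝ, 0 ≤ B ∧
    ∀ u v, Traj γ0 γ1 γ2 N δ T u v → (∀ t ∈ Set.Icc 0 T, SobLE 12 M (u t)) →
      ∀ t0 t1, 0 ≤ t0 → t0 ≤ t1 → t1 ≤ T → ∀ x, |u t1 x - u t0 x| ≤ B * (t1 - t0) := by
  obtain ⟨B, hB, b⟩ := exists_bound_velocity γ0 γ1 γ2 hN 0 M
  refine ⟨B, hB, fun u v h hM t0 t1 ht0 h01 ht1 x => ?_⟩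
  have := abs_sub_le_of_hasDerivAt h01 (h.curve.der 0 x) fun t ht => by
    have htT : t ∈ Set.Icc 0 T := ⟨ht0.trans ht.1, ht.2.trans ht1⟩
    obtain ⟨f, hf⟩ := h.flow t htT
    exact b _ _ f hf 12 (by norm_num) (hM t htT) x
  simpa only [jet_zero] using this

lemma exists_lipschitz_weight (γ0 : ℝ) (hN : N ∈ ordLE 3) (δ T M : ℝ) (m : ℕ) : ∃ B : ℝ, 0 ≤ B ∧
    ∀ u v, Traj γ0 γ1 γ2 N δ T u v → (∀ t ∈ Set.Icc 0 T, SobLE 12 M (u t)) →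
      ∀ t ∈ Set.Icc 0 T, ∀ x,
        |weight γ0 (parab N m) (u t) x - weight γ0 (parab N m) (u 0) x| ≤ B * t := by
  obtain ⟨B, hB, b⟩ := exists_bound_weightDot γ0 γ1 γ2 hN (parab_mem hN m) M
  refine ⟨B, hB, fun u v h hM t ht x => ?_⟩
  have := abs_sub_le_of_hasDerivAt ht.1 (h.curve.hasDerivAt_weight γ0 (parab_mem hN m) x)
    fun s hs => by
    have htT : s ∈ Set.Icc 0 T := ⟨hs.1, hs.2.trans ht.2⟩
    obtain ⟨f, hf⟩ := h.flow s htT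
    exact b _ _ f hf 12 (by norm_num) (hM s htT) x
  simpa using this

lemma exists_energyCorr_sub_le (γ0 : ℝ) (hN : N ∈ ordLE 3) (δ : ℝ) {T M : ℝ} (hT : T ≤ 1)
    (hM : 0 ≤ M) {m : ℕ} (hm : 12 ≤ m) {ε : ℝ} (hε : 0 < ε) : ∃ A : ℝ, 0 ≤ A ∧
      ∀ u v, Traj γ0 γ1 γ2 N δ T u v → (∀ t ∈ Set.Icc 0 T, SobLE m M (u t)) →
      ∀ t ∈ Set.Icc 0 T, energyCorr γ0 N m (u 0) - energyCorr γ0 N m (u t) ≤ A * t + ε := by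
  obtain ⟨Bv, hBv, bv⟩ := exists_lipschitz_time γ1 γ2 γ0 hN δ T M
  obtain ⟨Bd, hBd, bd⟩ := exists_lipschitz_weight γ1 γ2 γ0 hN δ T M m
  obtain ⟨Bw, hBw, bw⟩ := exists_bound_weight γ0 (parab_mem hN m) M
  set η : ℝ := ε / (8 * ((Bw + 1) * (M + 1))) with hη
  have hη0 : 0 < η := by positivity
  set ε' : ℝ := η * ε / (2 * ((Bw + 1) * (M + 1))) with hε'
  have hε'0 : 0 < ε' := by positivity
  obtain ⟨Ci, hCi, hci⟩ := exists_sob_le hε'0 (show m - 1 < m by omega)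
  refine ⟨Bd * M + Bw * (1 / (4 * η) * (Ci * (2 * π * Bv ^ 2))), by positivity,
    fun u v h hS t ht => ?_⟩
  have hS0 := hS 0 ⟨le_rfl, ht.1.trans ht.2⟩
  have hSt := hS t ht
  have hu0 := h.curve.hu 0
  have hut := h.curve.hu t
  have c1 := hu0.continuous (m - 1)
  have c2 := hut.continuous (m - 1)
  have c3 := weight_continuous γ0 (parab N m) hu0
  have c4 := weight_continuous γ0 (parab N m) hut
  have hS12 : ∀ t ∈ Set.Icc 0 T, SobLE 12 M (u t) := fun t ht => (hS t ht).mono hm le_rfl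
  have e1 : energyCorr γ0 N m (u 0) - energyCorr γ0 N m (u t) =
      ∫ x in (0:ℝ)..(2 * π), (weight γ0 (parab N m) (u 0) x * jet (u 0) x (m - 1) ^ 2 -
        weight γ0 (parab N m) (u t) x * jet (u t) x (m - 1) ^ 2) := by
    rw [intervalIntegral.integral_sub (Continuous.intervalIntegrable (by fun_prop) _ _)
      (Continuous.intervalIntegrable (by fun_prop) _ _), energyCorr, energyCorr]
  have e2 : ∫ x in (0:ℝ)..(2 * π), (Bd * t * jet (u 0) x (m - 1) ^ 2 + Bw * (η * (2 *
      jet (u 0) x (m - 1) ^ 2 + 2 * jet (u t) x (m - 1) ^ 2) + 1 / (4 * η) *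
      jet (fun y => u t y - u 0 y) x (m - 1) ^ 2)) = Bd * t * sob (m - 1) (u 0) +
      Bw * (η * (2 * sob (m - 1) (u 0) + 2 * sob (m - 1) (u t)) + 1 / (4 * η) *
      sob (m - 1) (fun y => u t y - u 0 y)) := by
    simp only [sob, jet_sub hut hu0]
    simp only [← intervalIntegral.integral_const_mul]
    rw [← intervalIntegral.integral_add (Continuous.intervalIntegrable (by fun_prop) _ _)
      (Continuous.intervalIntegrable (by fun_prop) _ _)]
    rw [← intervalIntegral.integral_const_mul]
    rw [← intervalIntegral.integral_add (Continuous.intervalIntegrable (by fun_prop) _ _)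
      (Continuous.intervalIntegrable (by fun_prop) _ _)]
    rw [← intervalIntegral.integral_const_mul]
    rw [← intervalIntegral.integral_add (Continuous.intervalIntegrable (by fun_prop) _ _)
      (Continuous.intervalIntegrable (by fun_prop) _ _)]
  have e3 := integral_mono_of_continuous
    (f := fun x => weight γ0 (parab N m) (u 0) x * jet (u 0) x (m - 1) ^ 2 -
        weight γ0 (parab N m) (u t) x * jet (u t) x (m - 1) ^ 2)
    (g := fun x => Bd * t * jet (u 0) x (m - 1) ^ 2 + Bw * (η * (2 *
      jet (u 0) x (m - 1) ^ 2 + 2 * jet (u t) x (m - 1) ^ 2) + 1 / (4 * η) *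
      jet (fun y => u t y - u 0 y) x (m - 1) ^ 2)) (by fun_prop)
      (by simp only [jet_sub hut hu0]; fun_prop) fun x => by
    have d1 := (abs_le.1 (bd u v h hS12 t ht x)).1
    have d2 := bw (u t) hut m (by omega) hSt x
    simp only [jet_sub hut hu0]
    set a := jet (u 0) x (m - 1)
    set b := jet (u t) x (m - 1)
    have d3 : (weight γ0 (parab N m) (u 0) x - weight γ0 (parab N m) (u t) x) * a ^ 2 ≤
        Bd * t * a ^ 2 := mul_le_mul_of_nonneg_right (by linarith) (sq_nonneg _)
    have d4 : weight γ0 (parab N m) (u t) x * (a ^ 2 - b ^ 2) ≤ Bw * |a ^ 2 - b ^ 2| := by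
      refine (le_abs_self _).trans ?_
      rw [abs_mul]
      exact mul_le_mul_of_nonneg_right d2 (abs_nonneg _)
    have d5 : |a ^ 2 - b ^ 2| ≤ η * (2 * a ^ 2 + 2 * b ^ 2) + 1 / (4 * η) * (b - a) ^ 2 := by
      have y : ∀ p q : ℝ, p * q ≤ η * p ^ 2 + 1 / (4 * η) * q ^ 2 := fun p q => by
        have e : η * p ^ 2 + 1 / (4 * η) * q ^ 2 - p * q = 1 / (4 * η) * (2 * η * p - q) ^ 2 := by
          field_simp
          ring
        have : 0 ≤ 1 / (4 * η) * (2 * η * p - q) ^ 2 := by positivity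
        linarith
      have y1 := y (a + b) (b - a)
      have y2 := y (a + b) (a - b)
      rw [show (a - b) ^ 2 = (b - a) ^ 2 by ring] at y2
      have y3 : η * (a + b) ^ 2 ≤ η * (2 * a ^ 2 + 2 * b ^ 2) :=
        mul_le_mul_of_nonneg_left (by nlinarith [sq_nonneg (a - b)]) hη0.le
      exact abs_le.2 ⟨by linarith, by linarith⟩
    have d6 := mul_le_mul_of_nonneg_left d5 hBw
    linarith
  rw [← e1, e2] at e3
  obtain ⟨n, hn⟩ := h.trig
  have i1 := hci n _ ((hn t).sub (hn 0))
  have i2 := sob_zero_le (u := fun x => u t x - u 0 x)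
    (hut.1.continuous.sub hu0.1.continuous) (B := Bv * t) fun x => by
    simpa using bv u v h hS12 0 t le_rfl ht.1 ht.2 x
  have i3 := sob_sub_le hut hu0 m
  have s0 := hS0 (m - 1) (by omega)
  have st := hSt (m - 1) (by omega)
  have s0' := hS0 m le_rfl
  have st' := hSt m le_rfl
  have i4 : sob (m - 1) (fun y => u t y - u 0 y) ≤ Ci * (2 * π * Bv ^ 2) * t + ε' * (4 * M) := by
    refine i1.trans (add_le_add ?_ (mul_le_mul_of_nonneg_left (by linarith) hε'0.le))
    rw [mul_assoc]
    refine mul_le_mul_of_nonneg_left (i2.trans ?_) hCi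
    rw [mul_pow, ← mul_assoc]
    exact mul_le_mul_of_nonneg_left (by nlinarith [ht.1, ht.2]) (by positivity)
  have i5 : Bw * (η * (2 * sob (m - 1) (u 0) + 2 * sob (m - 1) (u t)) + 1 / (4 * η) *
      sob (m - 1) (fun y => u t y - u 0 y)) ≤ Bw * (η * (4 * M) + 1 / (4 * η) *
      (Ci * (2 * π * Bv ^ 2) * t + ε' * (4 * M))) := by
    gcongr
    linarith
  have i6 : Bd * t * sob (m - 1) (u 0) ≤ Bd * t * M :=
    mul_le_mul_of_nonneg_left s0 (mul_nonneg hBd ht.1)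
  have hfrac : Bw * M / ((Bw + 1) * (M + 1)) ≤ 1 := by
    rw [div_le_one (by positivity)]
    nlinarith
  have i7 : Bw * (η * (4 * M)) ≤ ε / 2 := by
    have : Bw * (η * (4 * M)) = ε / 2 * (Bw * M / ((Bw + 1) * (M + 1))) := by
      rw [hη]
      field_simp
      ring
    rw [this]
    exact mul_le_of_le_one_right (by positivity) hfrac
  have i8 : Bw * (1 / (4 * η) * (ε' * (4 * M))) ≤ ε / 2 := by
    have : Bw * (1 / (4 * η) * (ε' * (4 * M))) = ε / 2 * (Bw * M / ((Bw + 1) * (M + 1))) := by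
      rw [hε']
      field_simp
    rw [this]
    exact mul_le_of_le_one_right (by positivity) hfrac
  linarith

/-- The top order norm does not jump up at the initial time, uniformly in the trajectory. -/
lemma exists_modulus (hγ0 : γ0 ≠ 0) (hN : N ∈ ordLE 3) {δ T M : ℝ} (hδ : 0 < δ) (hT : T ≤ 1)
    (hM : 0 ≤ M) {m : ℕ} (hm : 12 ≤ m) {ε : ℝ} (hε : 0 < ε) : ∃ τ : ℝ, 0 < τ ∧
      ∀ u v, Traj γ0 γ1 γ2 N δ T u v → (∀ t ∈ Set.Icc 0 T, SobLE m M (u t)) →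
      ∀ t ∈ Set.Icc 0 T, t ≤ τ → sob m (u t) ≤ sob m (u 0) + ε := by
  obtain ⟨A, hA, a⟩ := exists_energyCorr_sub_le γ1 γ2 γ0 hN δ hT hM hm (half_pos hε)
  obtain ⟨C, hC, hdot⟩ := exists_energyDot_le γ0 γ1 γ2 hγ0 hN hm M hδ
  set D : ℝ := A + C * (1 + M) + 1 with hD
  have hD0 : 0 < D := by positivity
  refine ⟨ε / 2 / D, by positivity, fun u v h hS t ht hτ => ?_⟩
  have h1 := a u v h hS t ht
  have h2 := sub_le_of_hasDerivAt_le ht.1 (h.curve.hasDerivAt_energy γ0 hN m) (C := C * (1 + M))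
    fun s hs => by
    have hsT : s ∈ Set.Icc 0 T := ⟨hs.1, hs.2.trans ht.2⟩
    obtain ⟨f, hf⟩ := h.flow s hsT
    refine (hdot _ _ f hf ((hS s hsT).mono (by omega) le_rfl) (h.mean_ge s hsT)).trans ?_
    have h3 : 0 ≤ δ * sob (m + 1) (u s) := mul_nonneg hδ.le (sob_nonneg _ _)
    have h4 := mul_le_mul_of_nonneg_left (add_le_add_right (hS s hsT m le_rfl) 1) hC
    linarith
  rw [le_div_iff₀ hD0] at hτ
  have := ht.1
  rw [hD] at hτ
  linarith

end

end

section

open MvPolynomial Real MeasureTheory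

lemma integral_swap_of_continuous {E : Type*} [NormedAddCommGroup E] [NormedSpace ℝ E]
    {F : ℝ → ℝ → E} (hF : Continuous fun z : ℝ × ℝ => F z.1 z.2)
    {a b c d : ℝ} (hab : a ≤ b) (hcd : c ≤ d) :
    ∫ x in a..b, ∫ y in c..d, F x y = ∫ y in c..d, ∫ x in a..b, F x y := by
  simp only [intervalIntegral.integral_of_le hab, intervalIntegral.integral_of_le hcd]
  refine integral_integral_swap ?_
  rw [Measure.prod_restrict]
  exact (hF.continuousOn.integrableOn_compact (isCompact_Icc.prod isCompact_Icc)).mono_set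
    (Set.prod_mono Set.Ioc_subset_Icc_self Set.Ioc_subset_Icc_self)

lemma fc_integral {F : ℝ → ℝ → ℝ} (hF : Continuous fun z : ℝ × ℝ => F z.1 z.2) {a b : ℝ}
    (hab : a ≤ b) (k : ℤ) : fc (fun x => ∫ t in a..b, F t x) k = ∫ t in a..b, fc (F t) k := by
  simp only [fc_eq, intervalIntegral.integral_const_mul]
  congr 1
  rw [integral_swap_of_continuous (F := fun t x => (F t x : ℂ) * ek (-k) x) (by fun_prop) hab
    two_pi_nonneg]
  simp only [intervalIntegral.integral_mul_const, intervalIntegral.integral_ofReal]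

lemma tendsto_fc {f : ℕ → ℝ → ℝ} {g : ℝ → ℝ} {B : ℝ} (hf : ∀ n, Continuous (f n))
    (hB : ∀ n x, |f n x| ≤ B) (h : ∀ x, Filter.Tendsto (fun n => f n x) Filter.atTop (nhds (g x)))
    (k : ℤ) : Filter.Tendsto (fun n => fc (f n) k) Filter.atTop (nhds (fc g k)) := by
  simp only [fc_eq]
  refine Filter.Tendsto.const_mul _ ?_
  refine intervalIntegral.tendsto_integral_filter_of_dominated_convergence (fun _ => B)
    (Filter.Eventually.of_forall fun n => ?_)
    (Filter.Eventually.of_forall fun n => Filter.Eventually.of_forall fun x _ => ?_)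
    intervalIntegrable_const (Filter.Eventually.of_forall fun x _ => ?_)
  · have := hf n
    exact (by fun_prop : Continuous fun x => (f n x : ℂ) * ek (-k) x).aestronglyMeasurable
  · rw [norm_mul, norm_ek, mul_one, Complex.norm_real]
    exact hB n x
  · exact ((Complex.continuous_ofReal.tendsto _).comp (h x)).mul_const _

lemma eq_zero_of_fc_eq_zero {f : ℝ → ℝ} (hf : Continuous f) (hp : Function.Periodic f (2 * π))
    (h : ∀ k, fc f k = 0) (x : ℝ) : f x = 0 := by
  have : Fact (0 < 2 * π) := ⟨two_pi_pos⟩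
  have hp' : Function.Periodic (fun x => (f x : ℂ)) (2 * π) := fun x => by simp only [hp x]
  have hc : Continuous (hp'.lift : AddCircle (2 * π) → ℂ) :=
    continuous_coinduced_dom.2 (Complex.continuous_ofReal.comp hf)
  set F : C(AddCircle (2 * π), ℂ) := ⟨hp'.lift, hc⟩ with hF
  have hFx : ∀ x : ℝ, F (x : AddCircle (2 * π)) = f x := fun x => rfl
  have h0 : fourierCoeff F = 0 := by
    funext k
    rw [fourierCoeff_eq_intervalIntegral F k 0]
    have := h k
    rw [fc_eq, mul_eq_zero] at this
    have h1 : ∫ x in (0:ℝ)..(2 * π), (f x : ℂ) * ek (-k) x = 0 := by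
      refine this.resolve_left (inv_ne_zero ?_)
      exact_mod_cast two_pi_pos.ne'
    have h2 : ∫ x in (0:ℝ)..0 + 2 * π, fourier (-k) (x : AddCircle (2 * π)) • F x = 0 := by
      rw [zero_add, ← h1]
      refine intervalIntegral.integral_congr fun x _ => ?_
      simp only [hFx, fourier_coe_apply, smul_eq_mul, ek]
      rw [mul_comm]
      congr 2
      have : (π : ℂ) ≠ 0 := by exact_mod_cast pi_ne_zero
      push_cast
      field_simp
    rw [h2, smul_zero]
    rfl
  have := has_pointwise_sum_fourier_series_of_summable (f := F) (by rw [h0]; exact summable_zero) x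
  rw [h0] at this
  simp only [Pi.zero_apply, zero_smul] at this
  have := this.unique hasSum_zero
  rw [hFx] at this
  exact_mod_cast this

lemma eq_of_fc_eq {f g : ℝ → ℝ} (hf : Continuous f) (hfp : Function.Periodic f (2 * π))
    (hg : Continuous g) (hgp : Function.Periodic g (2 * π)) (h : ∀ k, fc f k = fc g k) (x : ℝ) :
    f x = g x := by
  have := eq_zero_of_fc_eq_zero (f := fun x => f x - g x) (hf.sub hg)
    (fun x => by simp only [hfp x, hgp x]) (fun k => by rw [fc_sub hf hg, h, sub_self]) x
  linarith

/-- Extraction of a uniformly convergent subsequence. -/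
lemma exists_subseq {T B : ℝ} {u : ℕ → ℝ → ℝ → ℝ} (hp : ∀ n t, Function.Periodic (u n t) (2 * π))
    (hB : ∀ n, ∀ t ∈ Set.Icc 0 T, ∀ x, |u n t x| ≤ B)
    (ht : ∀ n, ∀ t ∈ Set.Icc 0 T, ∀ t' ∈ Set.Icc 0 T, ∀ x, |u n t x - u n t' x| ≤ B * |t - t'|)
    (hx : ∀ n, ∀ t ∈ Set.Icc 0 T, ∀ x y, |u n t x - u n t y| ≤ B * |x - y|) :
    ∃ θ : ℕ → ℕ, StrictMono θ ∧ ∀ ε > 0, ∃ n0, ∀ n ≥ n0, ∀ m ≥ n0, ∀ t ∈ Set.Icc 0 T, ∀ x,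
      |u (θ n) t x - u (θ m) t x| ≤ ε := by
  set K : Set (ℝ × ℝ) := Set.Icc 0 T ×ˢ Set.Icc 0 (2 * π) with hK
  have : CompactSpace K := isCompact_iff_compactSpace.1 (isCompact_Icc.prod isCompact_Icc)
  have hdist : ∀ n, ∀ z w : K, dist (u n z.1.1 z.1.2) (u n w.1.1 w.1.2) ≤ 2 * |B| * dist z w := by
    intro n z w
    have h1 := ht n _ z.2.1 _ w.2.1 z.1.2
    have h2 := hx n _ w.2.1 z.1.2 w.1.2
    have h3 : |z.1.1 - w.1.1| ≤ dist z w := (le_max_left _ _ : _ ≤ dist z.1 w.1)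
    have h4 : |z.1.2 - w.1.2| ≤ dist z w := (le_max_right _ _ : _ ≤ dist z.1 w.1)
    have h5 := dist_triangle (u n z.1.1 z.1.2) (u n w.1.1 z.1.2) (u n w.1.1 w.1.2)
    have h6 : B * |z.1.1 - w.1.1| ≤ |B| * dist z w :=
      mul_le_mul (le_abs_self _) h3 (abs_nonneg _) (abs_nonneg _)
    have h7 : B * |z.1.2 - w.1.2| ≤ |B| * dist z w :=
      mul_le_mul (le_abs_self _) h4 (abs_nonneg _) (abs_nonneg _)
    rw [Real.dist_eq (u n z.1.1 z.1.2) (u n w.1.1 z.1.2),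
      Real.dist_eq (u n w.1.1 z.1.2) (u n w.1.1 w.1.2)] at h5
    linarith
  have hlim : Filter.Tendsto (fun r : ℝ => 2 * |B| * r) (nhds 0) (nhds 0) := by
    have : Continuous fun r : ℝ => 2 * |B| * r := by fun_prop
    simpa using this.tendsto 0
  have heq : Equicontinuous fun n (z : K) => u n z.1.1 z.1.2 :=
    Metric.equicontinuous_of_continuity_modulus _ hlim _ fun z w n => hdist n z w
  set F : ℕ → BoundedContinuousFunction K ℝ := fun n =>
    BoundedContinuousFunction.mkOfCompact ⟨fun z : K => u n z.1.1 z.1.2, heq.continuous n⟩ with hF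
  have hcomp : IsCompact (closure (Set.range F)) := by
    refine BoundedContinuousFunction.arzela_ascoli (Metric.closedBall 0 B)
      (isCompact_closedBall _ _) _ ?_ ?_
    · rintro _ z ⟨n, rfl⟩
      rw [mem_closedBall_zero_iff]
      exact hB n _ z.2.1 _
    · refine Metric.equicontinuous_of_continuity_modulus _ hlim _ fun z w f => ?_
      obtain ⟨n, hn⟩ := f.2
      rw [← hn]
      exact hdist n z w
  obtain ⟨g, -, θ, hθ, hg⟩ := hcomp.tendsto_subseq fun n => subset_closure (Set.mem_range_self n)
  refine ⟨θ, hθ, fun ε hε => ?_⟩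
  obtain ⟨n0, hn0⟩ := Metric.cauchySeq_iff.1 hg.cauchySeq ε hε
  refine ⟨n0, fun n hn m hm t htT x => ?_⟩
  obtain ⟨y, hy, hxy⟩ : ∃ y ∈ Set.Ico 0 (2 * π), (u (θ n) t x = u (θ n) t y ∧
      u (θ m) t x = u (θ m) t y) := by
    refine ⟨toIcoMod two_pi_pos 0 x, by simpa using toIcoMod_mem_Ico two_pi_pos 0 x, ?_, ?_⟩
    · exact ((hp _ t).sub_zsmul_eq _).symm
    · exact ((hp _ t).sub_zsmul_eq _).symm
  rw [hxy.1, hxy.2]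
  have := (BoundedContinuousFunction.dist_coe_le_dist (⟨(t, y), htT, Set.Ico_subset_Icc_self hy⟩ : K)).trans
    (hn0 n hn m hm).le
  exact this

end

section

open MvPolynomial Real Filter Topology

/-- A sequence of families of trigonometric polynomials that is Cauchy in `L²`, uniformly on `A`. -/
structure CauchyTrig (A : Set ℝ) (w : ℕ → ℝ → ℝ → ℝ) : Prop where
  trig : ∀ n, ∃ d, ∀ t, IsTrig d (w n t)
  cauchy : ∀ ε > 0, ∃ n0, ∀ n ≥ n0, ∀ k ≥ n0, ∀ t ∈ A, sob 0 (fun x => w n t x - w k t x) ≤ ε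

/-- The pointwise limit of the `j`-th derivatives. -/
noncomputable def jetLim (w : ℕ → ℝ → ℝ → ℝ) (j : ℕ) (t x : ℝ) : ℝ :=
  limUnder atTop fun n => jet (w n t) x j

section

variable {A : Set ℝ} {w : ℕ → ℝ → ℝ → ℝ} {m : ℕ} {K : ℝ}

lemma CauchyTrig.mono (h : CauchyTrig A w) {B : Set ℝ} (hB : B ⊆ A) : CauchyTrig B w where
  trig := h.trig
  cauchy ε hε := (h.cauchy ε hε).imp fun _ h n hn k hk t ht => h n hn k hk t (hB ht)

lemma CauchyTrig.smoothPer (h : CauchyTrig A w) (n : ℕ) (t : ℝ) : SmoothPer (w n t) := by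
  obtain ⟨d, hd⟩ := h.trig n
  exact (hd t).smoothPer

lemma CauchyTrig.cauchy_jet (h : CauchyTrig A w) (hK : ∀ n, ∀ t ∈ A, SobLE m K (w n t)) {j : ℕ}
    (hj : j + 2 ≤ m) {ε : ℝ} (hε : 0 < ε) : ∃ n0, ∀ n ≥ n0, ∀ k ≥ n0, ∀ t ∈ A, ∀ x,
      |jet (w n t) x j - jet (w k t) x j| ≤ ε := by
  set η : ℝ := ε ^ 2 / (32 * (|K| + 1)) with hη
  have hη0 : 0 < η := by positivity
  obtain ⟨C1, hC1, h1⟩ := exists_sob_le hη0 (show j < m by omega)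
  obtain ⟨C2, hC2, h2⟩ := exists_sob_le hη0 (show j + 1 < m by omega)
  obtain ⟨n0, hn0⟩ := h.cauchy (ε ^ 2 / (4 * (C1 + C2 + 1))) (by positivity)
  refine ⟨n0, fun n hn k hk t ht x => ?_⟩
  obtain ⟨d, hd⟩ := h.trig n
  obtain ⟨d', hd'⟩ := h.trig k
  have htr : IsTrig (max d d') fun x => w n t x - w k t x :=
    ((hd t).mono (le_max_left _ _)).sub ((hd' t).mono (le_max_right _ _))
  rw [← jet_sub (hd t).smoothPer (hd' t).smoothPer]
  have e1 := htr.smoothPer.jet_sq_le j x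
  have e2 := h1 _ _ htr
  have e3 := h2 _ _ htr
  have e4 := sob_sub_le (hd t).smoothPer (hd' t).smoothPer m
  have e5 := hK n t ht m le_rfl
  have e6 := hK k t ht m le_rfl
  have e7 := hn0 n hn k hk t ht
  refine abs_le_of_sq_le_sq ?_ hε.le
  have e8 : sob m (fun x => w n t x - w k t x) ≤ 4 * (|K| + 1) := by
    have := le_abs_self K
    linarith
  have e9 : η * sob m (fun x => w n t x - w k t x) ≤ ε ^ 2 / 8 := by
    calc _ ≤ η * (4 * (|K| + 1)) := by gcongr
      _ = ε ^ 2 / 8 := by rw [hη]; field_simp; norm_num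
  have e10 : (C1 + C2) * sob 0 (fun x => w n t x - w k t x) ≤ ε ^ 2 / 4 := by
    calc _ ≤ (C1 + C2 + 1) * (ε ^ 2 / (4 * (C1 + C2 + 1))) := by
          exact mul_le_mul (by linarith) e7 (sob_nonneg _ _) (by positivity)
      _ = ε ^ 2 / 4 := by field_simp
  linarith

lemma CauchyTrig.tendstoUniformlyOn (h : CauchyTrig A w)
    (hK : ∀ n, ∀ t ∈ A, SobLE m K (w n t)) {j : ℕ} (hj : j + 2 ≤ m) :
    TendstoUniformlyOn (fun n (z : ℝ × ℝ) => jet (w n z.1) z.2 j) (fun z => jetLim w j z.1 z.2)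
      atTop (A ×ˢ Set.univ) := by
  have hu : UniformCauchySeqOn (fun n (z : ℝ × ℝ) => jet (w n z.1) z.2 j) atTop
      (A ×ˢ Set.univ) := by
    rw [Metric.uniformCauchySeqOn_iff]
    intro ε hε
    obtain ⟨n0, hn0⟩ := h.cauchy_jet hK hj (half_pos hε)
    exact ⟨n0, fun n hn k hk z hz => (hn0 n hn k hk z.1 hz.1 z.2).trans_lt (half_lt_self hε)⟩
  refine hu.tendstoUniformlyOn_of_tendsto fun z hz => ?_
  exact (show CauchySeq _ from hu.cauchySeq hz).tendsto_limUnder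

lemma CauchyTrig.tendsto (h : CauchyTrig A w)
    (hK : ∀ n, ∀ t ∈ A, SobLE m K (w n t)) {j : ℕ} (hj : j + 2 ≤ m) {t : ℝ} (ht : t ∈ A) (x : ℝ) :
    Tendsto (fun n => jet (w n t) x j) atTop (𝓝 (jetLim w j t x)) :=
  (h.tendstoUniformlyOn hK hj).tendsto_at (x := (t, x)) ⟨ht, Set.mem_univ _⟩

lemma CauchyTrig.hasDerivAt (h : CauchyTrig A w)
    (hK : ∀ n, ∀ t ∈ A, SobLE m K (w n t)) {j : ℕ} (hj : j + 3 ≤ m) {t : ℝ} (ht : t ∈ A) (x : ℝ) :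
    HasDerivAt (jetLim w j t) (jetLim w (j + 1) t x) x := by
  refine hasDerivAt_of_tendstoUniformlyOn (s := Set.univ) isOpen_univ
    (f := fun n x => jet (w n t) x j) (f' := fun n x => jet (w n t) x (j + 1)) (l := atTop) ?_
    (Eventually.of_forall fun n x _ => (h.smoothPer n t).hasDerivAt j x)
    (fun x _ => h.tendsto hK (by omega) ht x) (Set.mem_univ x)
  have := (h.tendstoUniformlyOn hK (j := j + 1) (by omega)).comp (fun x : ℝ => (t, x))
  refine this.mono fun x _ => ?_
  exact ⟨ht, Set.mem_univ _⟩

lemma CauchyTrig.continuousOn (h : CauchyTrig A w) (hK : ∀ n, ∀ t ∈ A, SobLE m K (w n t))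
    (hc : ∀ n j, Continuous fun z : ℝ × ℝ => jet (w n z.1) z.2 j) {j : ℕ} (hj : j + 2 ≤ m) :
    ContinuousOn (fun z : ℝ × ℝ => jetLim w j z.1 z.2) (A ×ˢ Set.univ) :=
  (h.tendstoUniformlyOn hK hj).continuousOn
    (Frequently.of_forall fun n => (hc n j).continuousOn)

lemma CauchyTrig.continuous_jetLim (h : CauchyTrig A w) (hK : ∀ n, ∀ t ∈ A, SobLE m K (w n t))
    {j : ℕ} (hj : j + 2 ≤ m) {t : ℝ} (ht : t ∈ A) : Continuous (jetLim w j t) := by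
  have := ((h.mono (Set.singleton_subset_iff.2 ht)).tendstoUniformlyOn
    (fun n s hs => hK n s (by rwa [Set.mem_singleton_iff.1 hs])) hj).comp (fun x : ℝ => (t, x))
  refine continuousOn_univ.1 ((this.mono fun x _ => ?_).continuousOn
    (Frequently.of_forall fun n => ((h.smoothPer n t).continuous j).continuousOn))
  exact ⟨rfl, Set.mem_univ _⟩

lemma jetLim_periodic (h : CauchyTrig A w) (j : ℕ) (t : ℝ) :
    Function.Periodic (jetLim w j t) (2 * π) := fun x => by
  simp only [jetLim, fun n => (h.smoothPer n t).periodic j x]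

lemma CauchyTrig.jet_jetLim (h : CauchyTrig A w) (hK : ∀ n, ∀ t ∈ A, SobLE m K (w n t)) {j : ℕ}
    (hj : j + 2 ≤ m) {t : ℝ} (ht : t ∈ A) (x : ℝ) : jet (jetLim w 0 t) x j = jetLim w j t x := by
  unfold jet
  induction j generalizing x with
  | zero => simp
  | succ j ih =>
    rw [iteratedDeriv_succ, funext fun x => ih (by omega) x]
    exact (h.hasDerivAt hK (by omega) ht x).deriv

lemma CauchyTrig.contDiff (h : CauchyTrig A w) (hK : ∀ n, ∀ t ∈ A, SobLE m K (w n t)) {j : ℕ}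
    (hj : j + 2 ≤ m) {t : ℝ} (ht : t ∈ A) : ContDiff ℝ j (jetLim w 0 t) := by
  have key : ∀ i, i ≤ j → iteratedDeriv i (jetLim w 0 t) = jetLim w i t := fun i hi =>
    funext fun x => h.jet_jetLim hK (by omega) ht x
  refine contDiff_nat_iff_iteratedDeriv.2 ⟨fun i hi => ?_, fun i hi x => ?_⟩
  · rw [key i hi]
    exact h.continuous_jetLim hK (by omega) ht
  · rw [key i hi.le]
    exact (h.hasDerivAt hK (by omega) ht x).differentiableAt

lemma tendsto_eval {r : ℕ} {p : MvPolynomial ℕ ℝ} (hp : p ∈ ordLE r) {y : ℕ → ℕ → ℝ} {z : ℕ → ℝ}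
    (h : ∀ j ≤ r, Tendsto (fun n => y n j) atTop (𝓝 (z j))) :
    Tendsto (fun n => eval (y n) p) atTop (𝓝 (eval z p)) := by
  refine ordLE_induction (motive := fun p => Tendsto (fun n => eval (y n) p) atTop
    (𝓝 (eval z p))) ?_ ?_ ?_ ?_ hp
  · intro j hj
    simpa using h j hj
  · intro c
    simp
  · intro p q _ _ hp hq
    simpa using hp.add hq
  · intro p q _ _ hp hq
    simpa using hp.mul hq

lemma CauchyTrig.tendsto_ev (h : CauchyTrig A w) (hK : ∀ n, ∀ t ∈ A, SobLE m K (w n t)) {r : ℕ}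
    {p : MvPolynomial ℕ ℝ} (hp : p ∈ ordLE r) (hr : r + 2 ≤ m) {t : ℝ} (ht : t ∈ A) (x : ℝ) :
    Tendsto (fun n => ev p (w n t) x) atTop (𝓝 (ev p (jetLim w 0 t) x)) :=
  tendsto_eval hp fun j hj => by
    rw [h.jet_jetLim hK (by omega) ht]
    exact h.tendsto hK (by omega) ht x

lemma CauchyTrig.tendsto_mean (h : CauchyTrig A w) (hK : ∀ n, ∀ t ∈ A, SobLE m K (w n t)) {r : ℕ}
    {p : MvPolynomial ℕ ℝ} (hp : p ∈ ordLE r) (hr : r + 2 ≤ m) {t : ℝ} (ht : t ∈ A) :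
    Tendsto (fun n => mean p (w n t)) atTop (𝓝 (mean p (jetLim w 0 t))) := by
  obtain ⟨B, hB, hb⟩ := exists_bound_ev hp K
  refine Tendsto.const_mul _ (intervalIntegral.tendsto_integral_filter_of_dominated_convergence
    (fun _ => B) (Eventually.of_forall fun n => ((h.smoothPer n t).ev_continuous p).aestronglyMeasurable)
    (Eventually.of_forall fun n => Eventually.of_forall fun x _ =>
      hb _ (h.smoothPer n t) m (by omega) (hK n t ht) x) intervalIntegrable_const
    (Eventually.of_forall fun x _ => h.tendsto_ev hK hp hr ht x))

lemma CauchyTrig.tendsto_fc (h : CauchyTrig A w) (hK : ∀ n, ∀ t ∈ A, SobLE m K (w n t)) {j : ℕ}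
    (hj : j + 2 ≤ m) {t : ℝ} (ht : t ∈ A) (k : ℤ) :
    Tendsto (fun n => fc (fun x => jet (w n t) x j) k) atTop (𝓝 (fc (jetLim w j t) k)) :=
  FifthOrderStmt2.tendsto_fc (fun n => (h.smoothPer n t).continuous j)
    (fun n x => (h.smoothPer n t).abs_jet_le (hK n t ht) (by omega) x)
    (fun x => h.tendsto hK hj ht x) k

end

lemma fc_trunc (n : ℕ) (f : ℝ → ℝ) (k : ℤ) :
    fc (trunc n f) k = if k ∈ Finset.Icc (-n : ℤ) n then fc f k else 0 := by
  rw [trunc, fc_trig]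
  split_ifs
  · rw [fc_neg, Complex.conj_conj]
    ring
  · rfl

lemma sob_trunc (n j : ℕ) (f : ℝ → ℝ) :
    sob j (trunc n f) = 2 * π * ∑ k ∈ Finset.Icc (-n : ℤ) n, (k : ℝ) ^ (2 * j) * ‖fc f k‖ ^ 2 := by
  rw [IsTrig.sob_eq (u := trunc n f) ⟨_, rfl⟩]
  congr 1
  refine Finset.sum_congr rfl fun k hk => ?_
  rw [fc_trunc, if_pos hk]

lemma pow_le_weight {j s : ℕ} (hj : j ≤ s) (k : ℝ) : k ^ (2 * j) ≤ (1 + k ^ 2) ^ s := by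
  rw [pow_mul]
  calc (k ^ 2) ^ j ≤ (1 + k ^ 2) ^ j := by gcongr; linarith
    _ ≤ (1 + k ^ 2) ^ s := pow_le_pow_right₀ (by nlinarith) hj

lemma MemHs.mono {s s' : ℕ} {f : ℝ → ℝ} (h : MemHs s f) (hs : s' ≤ s) : MemHs s' f := by
  refine ⟨h.1, h.2.1, h.2.2.of_nonneg_of_le (fun k => by positivity) fun k => ?_⟩
  gcongr
  nlinarith

lemma hsNorm_sq (s : ℕ) (f : ℝ → ℝ) :
    hsNorm s f ^ 2 = ∑' k : ℤ, (1 + (k : ℝ) ^ 2) ^ s * ‖fc f k‖ ^ 2 :=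
  sq_sqrt (tsum_nonneg fun k => by positivity)

lemma MemHs.sum_le {s : ℕ} {f : ℝ → ℝ} (h : MemHs s f) {j : ℕ} (hj : j ≤ s) (S : Finset ℤ) :
    ∑ k ∈ S, (k : ℝ) ^ (2 * j) * ‖fc f k‖ ^ 2 ≤ hsNorm s f ^ 2 := by
  rw [hsNorm_sq]
  refine le_trans ?_ (h.2.2.sum_le_tsum S fun k _ => by positivity)
  gcongr with k
  exact pow_le_weight hj _

lemma MemHs.sobLE_trunc {s : ℕ} {f : ℝ → ℝ} (h : MemHs s f) (n : ℕ) :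
    SobLE s (2 * π * hsNorm s f ^ 2) (trunc n f) := fun j hj => by
  rw [sob_trunc]
  exact mul_le_mul_of_nonneg_left (h.sum_le hj _) two_pi_nonneg

lemma MemHs.cauchyTrig_trunc {s : ℕ} {f : ℝ → ℝ} (h : MemHs s f) (A : Set ℝ) :
    CauchyTrig A fun n _ => trunc n f where
  trig n := ⟨n, fun _ => ⟨_, rfl⟩⟩
  cauchy ε hε := by
    have h0 : Summable fun k : ℤ => ‖fc f k‖ ^ 2 := by simpa using (h.mono (Nat.zero_le s)).2.2
    obtain ⟨S, hS⟩ := summable_iff_vanishing_norm.1 h0 (ε / (2 * π)) (by have := two_pi_pos; positivity)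
    obtain ⟨n0, hn0⟩ : ∃ n0 : ℕ, S ⊆ Finset.Icc (-n0 : ℤ) n0 := by
      refine ⟨∑ k ∈ S, k.natAbs, fun k hk => ?_⟩
      have := Finset.single_le_sum (f := fun k : ℤ => k.natAbs) (fun _ _ => Nat.zero_le _) hk
      rw [Finset.mem_Icc]
      omega
    refine ⟨n0, fun n hn m hm _ _ => ?_⟩
    have htr : IsTrig (max n m) fun x => trunc n f x - trunc m f x :=
      IsTrig.sub (IsTrig.mono ⟨_, rfl⟩ (le_max_left _ _)) (IsTrig.mono ⟨_, rfl⟩ (le_max_right _ _))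
    rw [htr.sob_eq]
    have h2 : ∑ k ∈ Finset.Icc (-(max n m : ℕ) : ℤ) (max n m : ℕ), (k : ℝ) ^ (2 * 0) *
        ‖fc (fun x => trunc n f x - trunc m f x) k‖ ^ 2 ≤
        ∑ k ∈ Finset.Icc (-(max n m : ℕ) : ℤ) (max n m : ℕ) \ S, ‖fc f k‖ ^ 2 := by
      rw [← Finset.sum_sdiff (s₁ := (Finset.Icc (-(max n m : ℕ) : ℤ) (max n m : ℕ)) ∩ S)
        Finset.inter_subset_left, Finset.sdiff_inter_self_left]
      rw [Finset.sum_eq_zero (s := Finset.Icc (-(max n m : ℕ) : ℤ) (max n m : ℕ) ∩ S), add_zero]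
      · refine Finset.sum_le_sum fun k hk => ?_
        rw [fc_sub (trunc_continuous _ _) (trunc_continuous _ _), fc_trunc, fc_trunc]
        split_ifs <;> simp
      · intro k hk
        have h1 := Finset.mem_Icc.1 (hn0 (Finset.mem_inter.1 hk).2)
        rw [fc_sub (trunc_continuous _ _) (trunc_continuous _ _), fc_trunc, fc_trunc,
          if_pos (by rw [Finset.mem_Icc]; omega), if_pos (by rw [Finset.mem_Icc]; omega)]
        simp
    have h3 := hS _ (Finset.sdiff_disjoint (s := S)
      (t := Finset.Icc (-(max n m : ℕ) : ℤ) (max n m : ℕ)))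
    have h4 := (le_abs_self _).trans_lt h3
    rw [lt_div_iff₀ two_pi_pos] at h4
    have := mul_le_mul_of_nonneg_left h2 two_pi_nonneg
    linarith

lemma MemHs.jetLim_trunc {s : ℕ} {f : ℝ → ℝ} (h : MemHs s f) (hs : 2 ≤ s) (t : ℝ) :
    jetLim (fun n _ => trunc n f) 0 t = f := by
  have hc := h.cauchyTrig_trunc Set.univ
  have hK := fun n (t : ℝ) (_ : t ∈ Set.univ) => h.sobLE_trunc n
  refine funext fun x => eq_of_fc_eq (hc.continuous_jetLim hK hs (Set.mem_univ t))
    (jetLim_periodic hc 0 t) h.1 h.2.1 (fun k => ?_) x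
  refine tendsto_nhds_unique (hc.tendsto_fc hK hs (Set.mem_univ t) k) ?_
  refine tendsto_const_nhds.congr' ?_
  filter_upwards [eventually_ge_atTop k.natAbs] with n hn
  simp only [jet_zero]
  rw [fc_trunc, if_pos (by rw [Finset.mem_Icc]; omega)]

lemma MemHs.tendsto_trunc {s : ℕ} {f : ℝ → ℝ} (h : MemHs s f) (hs : 2 ≤ s) (x : ℝ) :
    Tendsto (fun n => trunc n f x) atTop (𝓝 (f x)) := by
  have := (h.cauchyTrig_trunc Set.univ).tendsto (fun n (t : ℝ) (_ : t ∈ Set.univ) => h.sobLE_trunc n)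
    hs (Set.mem_univ 0) x
  rw [h.jetLim_trunc hs] at this
  simpa only [jet_zero] using this

lemma MemHs.tendsto_mean_trunc {s : ℕ} {f : ℝ → ℝ} (h : MemHs s f) {r : ℕ}
    {p : MvPolynomial ℕ ℝ} (hp : p ∈ ordLE r) (hr : r + 2 ≤ s) :
    Tendsto (fun n => mean p (trunc n f)) atTop (𝓝 (mean p f)) := by
  have := (h.cauchyTrig_trunc Set.univ).tendsto_mean
    (fun n (t : ℝ) (_ : t ∈ Set.univ) => h.sobLE_trunc n) hp hr (Set.mem_univ 0)
  rwa [h.jetLim_trunc (by omega)] at this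

lemma MemHs.contDiff {s : ℕ} {f : ℝ → ℝ} (h : MemHs s f) {j : ℕ} (hj : j + 2 ≤ s) :
    ContDiff ℝ j f := by
  have := (h.cauchyTrig_trunc Set.univ).contDiff
    (fun n (t : ℝ) (_ : t ∈ Set.univ) => h.sobLE_trunc n) hj (Set.mem_univ 0)
  rwa [h.jetLim_trunc (by omega)] at this

/-- The polynomial in the derivatives that represents the nonlinearity. -/
noncomputable def nonlin (j0 : ℕ) (lam : Fin j0 → ℝ) (a b c d : Fin j0 → ℕ) : MvPolynomial ℕ ℝ :=
  ∑ j : Fin j0, C (lam j) * X 3 ^ a j * X 2 ^ b j * X 1 ^ c j * X 0 ^ d j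

section

variable (j0 : ℕ) (lam : Fin j0 → ℝ) (a b c d : Fin j0 → ℕ)

lemma nonlin_mem : nonlin j0 lam a b c d ∈ ordLE 3 := by
  refine Subalgebra.sum_mem _ fun j _ => ?_
  have h : ∀ i ≤ 3, ∀ n, (X i : MvPolynomial ℕ ℝ) ^ n ∈ ordLE 3 := fun i hi n =>
    Subalgebra.pow_mem _ (X_mem_ordLE hi) n
  exact mul_mem (mul_mem (mul_mem (mul_mem (C_mem_ordLE _ _) (h 3 (by norm_num) _))
    (h 2 (by norm_num) _)) (h 1 (by norm_num) _)) (h 0 (by norm_num) _)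

lemma ev_nonlin (f : ℝ → ℝ) : ev (nonlin j0 lam a b c d) f = Nfun j0 lam a b c d f := by
  funext x
  simp [ev, nonlin, Nfun, jet]

lemma mean_nonlin {f : ℝ → ℝ} (hf : ContDiff ℝ 3 f) :
    mean (pderiv 2 (nonlin j0 lam a b c d)) f = PN j0 lam a b c d f := by
  have h : ∀ x, ev (pderiv 2 (nonlin j0 lam a b c d)) f x = ∑ j : Fin j0, (lam j * b j) *
      ((iteratedDeriv 3 f x) ^ (a j) * (iteratedDeriv 2 f x) ^ (b j - 1) *
        (deriv f x) ^ (c j) * (f x) ^ (d j)) := by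
    intro x
    simp only [ev, nonlin, map_sum]
    refine Finset.sum_congr rfl fun j _ => ?_
    have h3 : pderiv 2 (X 3 : MvPolynomial ℕ ℝ) = 0 := pderiv_X_of_ne (by norm_num)
    have h1 : pderiv 2 (X 1 : MvPolynomial ℕ ℝ) = 0 := pderiv_X_of_ne (by norm_num)
    have h0 : pderiv 2 (X 0 : MvPolynomial ℕ ℝ) = 0 := pderiv_X_of_ne (by norm_num)
    simp [h0, h1, h3, jet]
    ring
  have c3 := hf.continuous_iteratedDeriv 3 le_rfl
  have c2 := hf.continuous_iteratedDeriv 2 (by norm_num)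
  have c1 : Continuous (deriv f) := hf.continuous_deriv (by norm_num)
  have c0 := hf.continuous
  simp only [mean, h, PN]
  rw [intervalIntegral.integral_finsetSum fun j _ =>
    Continuous.intervalIntegrable (by fun_prop) _ _, Finset.mul_sum]
  refine Finset.sum_congr rfl fun j _ => ?_
  rw [intervalIntegral.integral_const_mul]
  ring

end

/-- A convergent sequence of Galerkin approximations of `∂ₜu = G(u)`, `u(0) = φ`. -/
structure Approx (G : MvPolynomial ℕ ℝ) (s : ℕ) (M T : ℝ) (φ : ℝ → ℝ) (d : ℕ → ℕ)
    (u v : ℕ → ℝ → ℝ → ℝ) : Prop where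
  hd : Tendsto d atTop atTop
  curve : ∀ n, Curve (u n) (v n)
  trig : ∀ n t, IsTrig (d n) (u n t)
  zero : ∀ n, u n 0 = trunc (d n) φ
  eq : ∀ n, ∀ t ∈ Set.Icc 0 T, v n t = trunc (d n) (ev G (u n t))
  bound : ∀ n, ∀ t ∈ Set.Icc 0 T, SobLE s M (u n t)
  smooth : ∀ τ > 0, ∀ m, ∃ K, ∀ n, ∀ t ∈ Set.Icc τ T, SobLE m K (u n t)
  modulus : ∀ ε > 0, ∃ τ > 0, ∀ n, ∀ t ∈ Set.Icc 0 T, t ≤ τ → sob s (u n t) ≤ sob s (u n 0) + ε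
  cauchy : CauchyTrig (Set.Icc 0 T) u

section

variable {A : Set ℝ} {w : ℕ → ℝ → ℝ → ℝ} {m : ℕ} {K : ℝ}

lemma CauchyTrig.ev_eq (h : CauchyTrig A w) (hK : ∀ n, ∀ t ∈ A, SobLE m K (w n t)) {r : ℕ}
    {p : MvPolynomial ℕ ℝ} (hp : p ∈ ordLE r) (hr : r + 2 ≤ m) {t : ℝ} (ht : t ∈ A) (x : ℝ) :
    ev p (jetLim w 0 t) x = eval (fun j => jetLim w j t x) p :=
  tendsto_nhds_unique (h.tendsto_ev hK hp hr ht x)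
    (tendsto_eval hp fun _ _ => h.tendsto hK (by omega) ht x)

lemma CauchyTrig.continuousOn_ev (h : CauchyTrig A w) (hK : ∀ n, ∀ t ∈ A, SobLE m K (w n t))
    (hc : ∀ n j, Continuous fun z : ℝ × ℝ => jet (w n z.1) z.2 j) {r : ℕ}
    {p : MvPolynomial ℕ ℝ} (hp : p ∈ ordLE r) (hr : r + 2 ≤ m) :
    ContinuousOn (fun z : ℝ × ℝ => ev p (jetLim w 0 z.1) z.2) (A ×ˢ Set.univ) :=
  (continuousOn_eval hp (y := fun (z : ℝ × ℝ) j => jetLim w j z.1 z.2)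
    fun j hj => h.continuousOn hK hc (by omega)).congr
    fun z hz => h.ev_eq hK hp hr hz.1 z.2

lemma CauchyTrig.abs_ev_le (h : CauchyTrig A w) (hK : ∀ n, ∀ t ∈ A, SobLE m K (w n t)) {r : ℕ}
    {p : MvPolynomial ℕ ℝ} (hp : p ∈ ordLE r) (hr : r + 2 ≤ m) : ∃ B : ℝ, 0 ≤ B ∧
      (∀ n, ∀ t ∈ A, ∀ x, |ev p (w n t) x| ≤ B) ∧ ∀ t ∈ A, ∀ x, |ev p (jetLim w 0 t) x| ≤ B := by
  obtain ⟨B, hB, hb⟩ := exists_bound_ev hp K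
  have hb' : ∀ n, ∀ t ∈ A, ∀ x, |ev p (w n t) x| ≤ B := fun n t ht x =>
    hb _ (h.smoothPer n t) m (by omega) (hK n t ht) x
  exact ⟨B, hB, hb', fun t ht x => le_of_tendsto (h.tendsto_ev hK hp hr ht x).abs
    (Eventually.of_forall fun n => hb' n t ht x)⟩

end

section

variable {G : MvPolynomial ℕ ℝ} {s : ℕ} {M T : ℝ} {φ : ℝ → ℝ} {d : ℕ → ℕ} {u v : ℕ → ℝ → ℝ → ℝ}

/-- The integral equation for the Galerkin approximations, on the level of Fourier coefficients. -/
lemma Approx.fc_sub_eq (h : Approx G s M T φ d u v) {r : ℕ} (hG : G ∈ ordLE r) (j : ℕ)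
    {t0 t1 : ℝ} (ht0 : 0 ≤ t0) (ht : t0 ≤ t1) (ht1 : t1 ≤ T) {n : ℕ} {k : ℤ}
    (hk : k ∈ Finset.Icc (-d n : ℤ) (d n)) :
    fc (fun x => jet (u n t1) x j - jet (u n t0) x j) k =
      fc (fun x => ∫ t in t0..t1, ev (totalD^[j] G) (u n t) x) k := by
  have hc := h.curve n
  have e1 : (fun x => jet (u n t1) x j - jet (u n t0) x j) =
      fun x => ∫ t in t0..t1, jet (v n t) x j := by
    funext x
    refine (intervalIntegral.integral_eq_sub_of_hasDerivAt (fun t _ => hc.der j x t) ?_).symm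
    exact ((hc.cv j).comp (f := fun t : ℝ => (t, x)) (by fun_prop)).intervalIntegrable _ _
  rw [e1, fc_integral (F := fun t x => jet (v n t) x j) (hc.cv j) ht,
    fc_integral (F := fun t x => ev (totalD^[j] G) (u n t) x)
      (hc.continuous_ev (iterate_totalD_mem_ordLE hG j)) ht]
  refine intervalIntegral.integral_congr fun t htt => ?_
  rw [Set.uIcc_of_le ht] at htt
  have hu := hc.hu t
  have e2 : (fun x => jet (v n t) x j) = trunc (d n) (ev (totalD^[j] G) (u n t)) := by
    rw [h.eq n t ⟨ht0.trans htt.1, htt.2.trans ht1⟩, jet_trunc _ (hu.ev_smoothPer G)]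
    congr 1
    exact hu.iteratedDeriv_ev G j
  simp only [e2]
  rw [fc_trunc, if_pos hk]

lemma Approx.sub_eq (h : Approx G s M T φ d u v) {r : ℕ} (hG : G ∈ ordLE r) {j m : ℕ} {K : ℝ}
    {t0 t1 : ℝ} (ht0 : 0 ≤ t0) (ht : t0 ≤ t1) (ht1 : t1 ≤ T)
    (hK : ∀ n, ∀ t ∈ Set.Icc t0 t1, SobLE m K (u n t)) (hj : r + j + 2 ≤ m) (hr : 1 ≤ r) (x : ℝ) :
    jetLim u j t1 x - jetLim u j t0 x =
      ∫ t in t0..t1, ev (totalD^[j] G) (jetLim u 0 t) x := by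
  have hC : CauchyTrig (Set.Icc t0 t1) u := h.cauchy.mono (Set.Icc_subset_Icc ht0 ht1)
  have hp := iterate_totalD_mem_ordLE hG j
  have m0 : t0 ∈ Set.Icc t0 t1 := ⟨le_rfl, ht⟩
  have m1 : t1 ∈ Set.Icc t0 t1 := ⟨ht, le_rfl⟩
  have hIoc : Set.uIoc t0 t1 ⊆ Set.Icc t0 t1 := by
    rw [Set.uIoc_of_le ht]
    exact Set.Ioc_subset_Icc_self
  obtain ⟨B, hB, hb, hb'⟩ := hC.abs_ev_le hK hp hj
  have hcont : ∀ x, ContinuousOn (fun t => ev (totalD^[j] G) (jetLim u 0 t) x) (Set.Icc t0 t1) :=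
    fun x => (hC.continuousOn_ev hK (fun n => (h.curve n).cu) hp hj).comp
      (f := fun t : ℝ => (t, x)) (by fun_prop) fun t ht => ⟨ht, Set.mem_univ _⟩
  have hlim : ∀ x, Tendsto (fun n => ∫ t in t0..t1, ev (totalD^[j] G) (u n t) x) atTop
      (𝓝 (∫ t in t0..t1, ev (totalD^[j] G) (jetLim u 0 t) x)) := by
    intro x
    refine intervalIntegral.tendsto_integral_filter_of_dominated_convergence (fun _ => B)
      (Eventually.of_forall fun n => ?_)
      (Eventually.of_forall fun n => Eventually.of_forall fun t ht => hb n t (hIoc ht) x)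
      intervalIntegrable_const
      (Eventually.of_forall fun t ht => hC.tendsto_ev hK hp hj (hIoc ht) x)
    exact (((h.curve n).continuous_ev hp).comp (f := fun t : ℝ => (t, x))
      (by fun_prop)).aestronglyMeasurable
  have hcx : Continuous fun x => ∫ t in t0..t1, ev (totalD^[j] G) (jetLim u 0 t) x := by
    refine intervalIntegral.continuous_of_dominated_interval (bound := fun _ => B) (fun x => ?_)
      (fun x => Eventually.of_forall fun t ht => hb' t (hIoc ht) x) intervalIntegrable_const
      (Eventually.of_forall fun t ht => ?_)
    · exact ((hcont x).mono hIoc).aestronglyMeasurable measurableSet_uIoc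
    · exact continuousOn_univ.1 ((hC.continuousOn_ev hK (fun n => (h.curve n).cu) hp hj).comp
        (f := fun x : ℝ => (t, x)) (by fun_prop) fun x _ => ⟨hIoc ht, Set.mem_univ _⟩)
  refine eq_of_fc_eq ((hC.continuous_jetLim hK (by omega) m1).sub
    (hC.continuous_jetLim hK (by omega) m0)) (fun x => ?_) hcx (fun x => ?_) (fun k => ?_) x
  · exact congrArg₂ (· - ·) (jetLim_periodic hC j _ x) (jetLim_periodic hC j _ x)
  · refine intervalIntegral.integral_congr fun t ht => ?_
    rw [Set.uIcc_of_le (by assumption)] at ht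
    refine tendsto_nhds_unique (hC.tendsto_ev hK hp hj ht _) ?_
    simp only [((h.curve _).hu t).ev_periodic _ x]
    exact hC.tendsto_ev hK hp hj ht x
  · have l1 : Tendsto (fun n => fc (fun x => jet (u n t1) x j - jet (u n t0) x j) k) atTop
        (𝓝 (fc (fun x => jetLim u j t1 x - jetLim u j t0 x) k)) := by
      refine tendsto_fc (B := (1 + 4 * K) + (1 + 4 * K))
        (fun n => (((h.curve n).hu t1).continuous j).sub (((h.curve n).hu t0).continuous j))
        (fun n x => (abs_sub _ _).trans (add_le_add ?_ ?_))
        (fun x => (hC.tendsto hK (by omega) m1 x).sub (hC.tendsto hK (by omega) m0 x)) k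
      · exact ((h.curve n).hu t1).abs_jet_le (hK n _ m1) (by omega) x
      · exact ((h.curve n).hu t0).abs_jet_le (hK n _ m0) (by omega) x
    have l2 : Tendsto (fun n => fc (fun x => ∫ t in t0..t1, ev (totalD^[j] G) (u n t) x) k) atTop
        (𝓝 (fc (fun x => ∫ t in t0..t1, ev (totalD^[j] G) (jetLim u 0 t) x) k)) := by
      refine tendsto_fc (B := B * |t1 - t0|) (fun n => ?_) (fun n x => ?_) hlim k
      · have hF : Continuous (Function.uncurry fun x t => ev (totalD^[j] G) (u n t) x) := by
          have := (h.curve n).continuous_ev hp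
          exact this.comp (g := fun z : ℝ × ℝ => ev (totalD^[j] G) (u n z.1) z.2)
            (f := fun z : ℝ × ℝ => (z.2, z.1)) (by fun_prop)
        exact intervalIntegral.continuous_parametric_intervalIntegral_of_continuous' hF t0 t1
      · exact intervalIntegral.norm_integral_le_of_norm_le_const
          (f := fun t => ev (totalD^[j] G) (u n t) x) fun t ht => hb n t (hIoc ht) x
    refine tendsto_nhds_unique l1 (l2.congr' ?_)
    filter_upwards [h.hd.eventually_ge_atTop k.natAbs] with n hn
    exact (h.fc_sub_eq hG j ht0 ht ht1 (by rw [Finset.mem_Icc]; omega)).symm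

end

lemma contDiffOn_eval {E : Type*} [NormedAddCommGroup E] [NormedSpace ℝ E] {n : WithTop ℕ∞}
    {s : Set E} {r : ℕ} {p : MvPolynomial ℕ ℝ} (hp : p ∈ ordLE r) {y : E → ℕ → ℝ}
    (h : ∀ j ≤ r, ContDiffOn ℝ n (fun x => y x j) s) :
    ContDiffOn ℝ n (fun x => eval (y x) p) s := by
  refine ordLE_induction (motive := fun p => ContDiffOn ℝ n (fun x => eval (y x) p) s)
    ?_ ?_ ?_ ?_ hp
  · intro j hj
    simpa only [eval_X] using h j hj
  · intro c
    simpa only [eval_C] using contDiffOn_const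
  · intro p q _ _ h1 h2
    simpa only [map_add] using h1.add h2
  · intro p q _ _ h1 h2
    simpa only [map_mul] using h1.mul h2

/-- A jet of functions on an open set which solves an evolution equation is smooth. -/
lemma contDiffOn_of_evolution {Y : ℕ → ℝ → ℝ → ℝ} {q : ℕ → MvPolynomial ℕ ℝ}
    {Ω : Set (ℝ × ℝ)} (hΩ : IsOpen Ω)
    (hc : ∀ j, ContinuousOn (fun z : ℝ × ℝ => Y j z.1 z.2) Ω)
    (hx : ∀ j, ∀ z ∈ Ω, HasDerivAt (Y j z.1) (Y (j + 1) z.1 z.2) z.2)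
    (ht : ∀ j, ∀ z ∈ Ω, HasDerivAt (fun t => Y j t z.2) (eval (fun i => Y i z.1 z.2) (q j)) z.1)
    (n : ℕ) : ∀ j, ContDiffOn ℝ n (fun z : ℝ × ℝ => Y j z.1 z.2) Ω := by
  have hq : ∀ {n : WithTop ℕ∞}, (∀ j, ContDiffOn ℝ n (fun z : ℝ × ℝ => Y j z.1 z.2) Ω) → ∀ j,
      ContDiffOn ℝ n (fun z : ℝ × ℝ => eval (fun i => Y i z.1 z.2) (q j)) Ω := fun h j => by
    obtain ⟨r, hr⟩ := exists_ordLE (q j)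
    exact contDiffOn_eval hr fun i _ => h i
  have hder : ∀ j, ∀ z ∈ Ω, HasFDerivAt (fun z : ℝ × ℝ => Y j z.1 z.2)
      (eval (fun i => Y i z.1 z.2) (q j) • ContinuousLinearMap.fst ℝ ℝ ℝ +
        Y (j + 1) z.1 z.2 • ContinuousLinearMap.snd ℝ ℝ ℝ) z := by
    intro j z hz
    have hz' : ∀ᶠ w in 𝓝 z, w ∈ Ω := hΩ.mem_nhds hz
    have key := hasStrictFDerivAt_uncurry_coprod (𝕜 := ℝ) (f := Y j) (u := z)
      (f₁ := fun t x => ContinuousLinearMap.toSpanSingleton ℝ (eval (fun i => Y i t x) (q j)))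
      (f₂ := fun t x => ContinuousLinearMap.toSpanSingleton ℝ (Y (j + 1) t x))
      (hz'.mono fun w hw => (ht j w hw).hasFDerivAt) (hz'.mono fun w hw => (hx j w hw).hasFDerivAt)
      ?_ ?_
    · refine key.hasFDerivAt.congr_fderiv ?_
      ext <;> simp [Function.HasUncurry.uncurry]
    · have h0 := ((hq (n := 0) fun j => contDiffOn_zero.2 (hc j)) j).continuousOn.continuousAt
        (hΩ.mem_nhds hz)
      exact (ContinuousLinearMap.toSpanSingletonCLE (𝕜 := ℝ) (E := ℝ)).continuous.continuousAt.comp h0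
    · have h0 := (hc (j + 1)).continuousAt (hΩ.mem_nhds hz)
      exact (ContinuousLinearMap.toSpanSingletonCLE (𝕜 := ℝ) (E := ℝ)).continuous.continuousAt.comp h0
  induction n with
  | zero => exact fun j => contDiffOn_zero.2 (hc j)
  | succ n ih =>
    intro j
    push_cast
    rw [contDiffOn_succ_iff_hasFDerivWithinAt_of_uniqueDiffOn hΩ.uniqueDiffOn]
    exact ⟨fun h => absurd h (by simp), _,
      ((hq ih j).smul contDiffOn_const).add ((ih (j + 1)).smul contDiffOn_const),
      fun z hz => (hder j z hz).hasFDerivWithinAt⟩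

section

variable {G : MvPolynomial ℕ ℝ} {s : ℕ} {M T : ℝ} {φ : ℝ → ℝ} {d : ℕ → ℕ} {u v : ℕ → ℝ → ℝ → ℝ}

/-- The limit satisfies the evolution equation as soon as enough derivatives are controlled. -/
lemma Approx.hasDerivAt (h : Approx G s M T φ d u v) {r : ℕ} (hG : G ∈ ordLE r) {j m : ℕ} {K : ℝ}
    {t0 t1 : ℝ} (ht0 : 0 ≤ t0) (ht1 : t1 ≤ T)
    (hK : ∀ n, ∀ t ∈ Set.Icc t0 t1, SobLE m K (u n t)) (hj : r + j + 2 ≤ m) (hr : 1 ≤ r) (x : ℝ)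
    {t : ℝ} (ht : t ∈ Set.Ioo t0 t1) :
    HasDerivAt (fun t => jetLim u j t x) (ev (totalD^[j] G) (jetLim u 0 t) x) t := by
  have hC : CauchyTrig (Set.Icc t0 t1) u := h.cauchy.mono (Set.Icc_subset_Icc ht0 ht1)
  have hcont : ContinuousOn (fun t => ev (totalD^[j] G) (jetLim u 0 t) x) (Set.Icc t0 t1) :=
    (hC.continuousOn_ev hK (fun n => (h.curve n).cu) (iterate_totalD_mem_ordLE hG j) hj).comp
      (f := fun t : ℝ => (t, x)) (by fun_prop) fun t ht => ⟨ht, Set.mem_univ _⟩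
  have hI : Set.Icc t0 t1 ∈ 𝓝 t := Icc_mem_nhds ht.1 ht.2
  have hint : IntervalIntegrable (fun t => ev (totalD^[j] G) (jetLim u 0 t) x)
      MeasureTheory.volume t0 t := by
    refine ContinuousOn.intervalIntegrable (hcont.mono ?_)
    rw [Set.uIcc_of_le ht.1.le]
    exact Set.Icc_subset_Icc le_rfl ht.2.le
  have key := (intervalIntegral.integral_hasDerivAt_right hint
    ((hcont.mono Set.Ioo_subset_Icc_self).stronglyMeasurableAtFilter isOpen_Ioo t ht)
    (hcont.continuousAt hI)).add_const (jetLim u j t0 x)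
  refine key.congr_of_eventuallyEq ?_
  filter_upwards [hI] with τ hτ
  have hsub : Set.Icc t0 τ ⊆ Set.Icc t0 t1 := Set.Icc_subset_Icc le_rfl hτ.2
  have := h.sub_eq hG ht0 hτ.1 (hτ.2.trans ht1) (fun n t ht => hK n t (hsub ht)) hj hr x
  linarith

lemma Approx.contDiffOn (h : Approx G s M T φ d u v) {r : ℕ} (hG : G ∈ ordLE r) (hr : 1 ≤ r) :
    ContDiffOn ℝ (⊤ : ℕ∞) (Function.uncurry (jetLim u 0)) (Set.Ioo 0 T ×ˢ Set.univ) := by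
  have hloc : ∀ z ∈ Set.Ioo 0 T ×ˢ (Set.univ : Set ℝ), ∀ m, ∃ K, ∀ n, ∀ t ∈ Set.Icc (z.1 / 2) T,
      SobLE m K (u n t) := fun z hz m => h.smooth _ (half_pos hz.1.1) m
  have hC : ∀ z ∈ Set.Ioo 0 T ×ˢ (Set.univ : Set ℝ), CauchyTrig (Set.Icc (z.1 / 2) T) u :=
    fun z hz => h.cauchy.mono (Set.Icc_subset_Icc (half_pos hz.1.1).le le_rfl)
  have hmem : ∀ z ∈ Set.Ioo 0 T ×ˢ (Set.univ : Set ℝ), z.1 ∈ Set.Ioo (z.1 / 2) T :=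
    fun z hz => ⟨half_lt_self hz.1.1, hz.1.2⟩
  refine contDiffOn_infty.2 fun n => ?_
  refine contDiffOn_of_evolution (Y := jetLim u) (q := fun j => totalD^[j] G)
    (isOpen_Ioo.prod isOpen_univ) (fun j z hz => ?_) (fun j z hz => ?_) (fun j z hz => ?_) n 0
  · obtain ⟨K, hK⟩ := hloc z hz (j + 2)
    have := (hC z hz).continuousOn hK (fun n => (h.curve n).cu) (j := j) le_rfl
    refine (this.continuousAt ?_).continuousWithinAt
    exact prod_mem_nhds (Icc_mem_nhds (hmem z hz).1 (hmem z hz).2) univ_mem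
  · obtain ⟨K, hK⟩ := hloc z hz (j + 3)
    exact (hC z hz).hasDerivAt hK le_rfl (Set.Ioo_subset_Icc_self (hmem z hz)) z.2
  · obtain ⟨K, hK⟩ := hloc z hz (r + j + 2)
    rw [← (hC z hz).ev_eq hK (iterate_totalD_mem_ordLE hG j) le_rfl
      (Set.Ioo_subset_Icc_self (hmem z hz)) z.2]
    exact h.hasDerivAt hG (half_pos hz.1.1).le le_rfl hK le_rfl hr z.2 (hmem z hz)

end

end

section

open MvPolynomial Real Filter Topology MeasureTheory

lemma integral_swap_of_continuousOn {F : ℝ → ℝ → ℝ} {a b c d : ℝ} (hab : a ≤ b) (hcd : c ≤ d)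
    (hF : ContinuousOn (fun z : ℝ × ℝ => F z.1 z.2) (Set.Icc a b ×ˢ Set.univ)) :
    ∫ x in a..b, ∫ y in c..d, F x y = ∫ y in c..d, ∫ x in a..b, F x y := by
  simp only [intervalIntegral.integral_of_le hab, intervalIntegral.integral_of_le hcd]
  refine integral_integral_swap ?_
  rw [Measure.prod_restrict]
  exact ((hF.mono (Set.prod_mono subset_rfl (Set.subset_univ (Set.Icc c d)))).integrableOn_compact
    (isCompact_Icc.prod isCompact_Icc)).mono_set
    (Set.prod_mono Set.Ioc_subset_Icc_self Set.Ioc_subset_Icc_self)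

lemma hasDerivAt_jet_of_contDiff {f : ℝ → ℝ} {m : ℕ} (hf : ContDiff ℝ m f) {j : ℕ} (hj : j < m)
    (x : ℝ) : HasDerivAt (fun x => jet f x j) (jet f x (j + 1)) x := by
  simpa only [jet, iteratedDeriv_succ] using
    (hf.differentiable_iteratedDeriv j (by exact_mod_cast hj) x).hasDerivAt

lemma continuous_jet_of_contDiff {f : ℝ → ℝ} {m : ℕ} (hf : ContDiff ℝ m f) {j : ℕ} (hj : j ≤ m) :
    Continuous fun x => jet f x j :=
  hf.continuous_iteratedDeriv j (by exact_mod_cast hj)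

lemma jet_periodic_of_periodic {f : ℝ → ℝ} (hf : Function.Periodic f (2 * π)) (j : ℕ) :
    Function.Periodic (fun x => jet f x j) (2 * π) := fun x => by
  have h := iteratedDeriv_comp_add_const j f (2 * π)
  rw [show (fun z => f (z + 2 * π)) = f from funext hf] at h
  exact (congrFun h x).symm

lemma integral_mul_test {γ0 γ1 γ2 : ℝ} {f n ψ ψ' : ℝ → ℝ} (hf : ContDiff ℝ 5 f)
    (hfp : Function.Periodic f (2 * π)) (hn : Continuous n) (hψ : SmoothPer ψ)
    (hψ' : Continuous ψ') :
    ∫ x in (0:ℝ)..(2 * π), (f x * (ψ' x + γ0 * iteratedDeriv 5 ψ x + γ1 * iteratedDeriv 3 ψ x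
        + γ2 * deriv ψ x) + n x * ψ x) =
      ∫ x in (0:ℝ)..(2 * π), (f x * ψ' x + (n x + (-γ0 * jet f x 5 + (-γ1 * jet f x 3
        + -γ2 * jet f x 1))) * ψ x) := by
  have hf' : ContDiff ℝ (5 : ℕ) f := hf
  have cf : ∀ j ≤ 5, Continuous fun x => jet f x j := fun j hj => continuous_jet_of_contDiff hf' hj
  have cψ := hψ.continuous
  have pf := jet_periodic_of_periodic hfp
  have pψ := hψ.periodic
  have df : ∀ j < 5, ∀ x, HasDerivAt (fun x => jet f x j) (jet f x (j + 1)) x :=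
    fun j hj x => hasDerivAt_jet_of_contDiff hf' hj x
  have dψ := hψ.hasDerivAt
  have e0 : ∀ x, ψ x = jet ψ x 0 := fun x => by simp [jet]
  have e1 : ∀ x, deriv ψ x = jet ψ x 1 := fun x => by simp [jet]
  have e3 : ∀ j x, iteratedDeriv j ψ x = jet ψ x j := fun j x => rfl
  have e4 : ∀ x, f x = jet f x 0 := fun x => by simp [jet]
  simp only [e1, e3, e0, e4]
  have c0 := cf 0 (by norm_num)
  have c1 := cf 1 (by norm_num)
  have c3 := cf 3 (by norm_num)
  have c5 := cf 5 (by norm_num)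
  have b0 := cψ 0
  have b1 := cψ 1
  have b3 := cψ 3
  have b5 := cψ 5
  refine integral_eq_of_hasDerivAt (F := fun x =>
    γ0 * (jet f x 0 * jet ψ x 4 - jet f x 1 * jet ψ x 3 + jet f x 2 * jet ψ x 2
      - jet f x 3 * jet ψ x 1 + jet f x 4 * jet ψ x 0)
    + γ1 * (jet f x 0 * jet ψ x 2 - jet f x 1 * jet ψ x 1 + jet f x 2 * jet ψ x 0)
    + γ2 * (jet f x 0 * jet ψ x 0)) (by fun_prop) (by fun_prop) (fun x => ?_) (fun x => ?_)
  · have pf' : ∀ j, jet f (x + 2 * π) j = jet f x j := fun j => pf j x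
    have pψ' : ∀ j, jet ψ (x + 2 * π) j = jet ψ x j := fun j => pψ j x
    simp only [pf', pψ']
  · have d0 := df 0 (by norm_num) x
    have d1 := df 1 (by norm_num) x
    have d2 := df 2 (by norm_num) x
    have d3 := df 3 (by norm_num) x
    have d4 := df 4 (by norm_num) x
    refine ((((((((d0.fun_mul (dψ 4 x)).fun_sub (d1.fun_mul (dψ 3 x))).fun_add
      (d2.fun_mul (dψ 2 x))).fun_sub (d3.fun_mul (dψ 1 x))).fun_add (d4.fun_mul (dψ 0 x))).const_mul
      γ0).fun_add ((((d0.fun_mul (dψ 2 x)).fun_sub (d1.fun_mul (dψ 1 x))).fun_add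
      (d2.fun_mul (dψ 0 x))).const_mul γ1)).fun_add
      ((d0.fun_mul (dψ 0 x)).const_mul γ2)).congr_deriv ?_
    ring

lemma weak_of_strong {γ0 γ1 γ2 T : ℝ} (hT : 0 ≤ T) {U n g ψ : ℝ → ℝ → ℝ}
    (hU : ∀ t ∈ Set.Icc 0 T, ContDiff ℝ 5 (U t) ∧ Function.Periodic (U t) (2 * π))
    (hc : ContinuousOn (fun z : ℝ × ℝ => U z.1 z.2) (Set.Icc 0 T ×ˢ Set.univ))
    (hn : ∀ t ∈ Set.Icc 0 T, Continuous (n t))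
    (hg : ContinuousOn (fun z : ℝ × ℝ => g z.1 z.2) (Set.Icc 0 T ×ˢ Set.univ))
    (hgn : ∀ t ∈ Set.Icc 0 T, ∀ x, g t x = n t x + (-γ0 * jet (U t) x 5 + (-γ1 * jet (U t) x 3
        + -γ2 * jet (U t) x 1)))
    (ht : ∀ t ∈ Set.Ioo 0 T, ∀ x, HasDerivAt (fun t => U t x) (g t x) t)
    (hψ : ContDiff ℝ (⊤ : ℕ∞) (Function.uncurry ψ))
    (hψp : ∀ t : ℝ, Function.Periodic (ψ t) (2 * π))
    (hψ0 : ∀ t : ℝ, t ∉ Set.Ioo 0 T → ∀ x : ℝ, ψ t x = 0) :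
    (∫ t in (0:ℝ)..T, ∫ x in (0:ℝ)..(2 * π),
      (U t x * (deriv (fun τ : ℝ => ψ τ x) t + γ0 * iteratedDeriv 5 (ψ t) x
        + γ1 * iteratedDeriv 3 (ψ t) x + γ2 * deriv (ψ t) x) + n t x * ψ t x)) = 0 := by
  have hψs : ∀ t, SmoothPer (ψ t) := fun t =>
    ⟨hψ.comp (f := fun x : ℝ => (t, x)) (by fun_prop), hψp t⟩
  have hψc : Continuous fun z : ℝ × ℝ => ψ z.1 z.2 := hψ.continuous
  have hψd : ∀ t x, HasDerivAt (fun τ => ψ τ x) (fderiv ℝ (Function.uncurry ψ) (t, x) (1, 0)) t :=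
    fun t x => ((hψ.differentiable (by simp)) (t, x)).hasFDerivAt.comp_hasDerivAt t
      (f := fun τ : ℝ => (τ, x)) ((hasDerivAt_id t).prodMk (hasDerivAt_const t x))
  have hψt : Continuous fun z : ℝ × ℝ => deriv (fun τ => ψ τ z.2) z.1 := by
    simp only [fun z : ℝ × ℝ => (hψd z.1 z.2).deriv]
    exact (hψ.continuous_fderiv (by simp)).clm_apply continuous_const
  have e : ∀ t ∈ Set.uIcc 0 T, (∫ x in (0:ℝ)..(2 * π),
      (U t x * (deriv (fun τ : ℝ => ψ τ x) t + γ0 * iteratedDeriv 5 (ψ t) x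
        + γ1 * iteratedDeriv 3 (ψ t) x + γ2 * deriv (ψ t) x) + n t x * ψ t x)) =
      ∫ x in (0:ℝ)..(2 * π), (U t x * deriv (fun τ => ψ τ x) t + g t x * ψ t x) := by
    intro t ht
    rw [Set.uIcc_of_le hT] at ht
    simp only [hgn t ht]
    exact integral_mul_test (hU t ht).1 (hU t ht).2 (hn t ht) (hψs t)
      (hψt.comp (f := fun x : ℝ => (t, x)) (by fun_prop))
  have hcont : ContinuousOn (fun z : ℝ × ℝ =>
      U z.1 z.2 * deriv (fun τ => ψ τ z.2) z.1 + g z.1 z.2 * ψ z.1 z.2)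
      (Set.Icc 0 T ×ˢ Set.univ) :=
    (hc.mul hψt.continuousOn).add (hg.mul hψc.continuousOn)
  have hsec : ∀ {F : ℝ → ℝ → ℝ}, ContinuousOn (fun z : ℝ × ℝ => F z.1 z.2)
      (Set.Icc 0 T ×ˢ Set.univ) → ∀ x, ContinuousOn (fun t => F t x) (Set.Icc 0 T) :=
    fun hF x => hF.comp (f := fun t : ℝ => (t, x)) (by fun_prop) fun t ht => ⟨ht, Set.mem_univ _⟩
  rw [intervalIntegral.integral_congr e, integral_swap_of_continuousOn hT two_pi_nonneg
    (F := fun t x => U t x * deriv (fun τ => ψ τ x) t + g t x * ψ t x) hcont]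
  refine (intervalIntegral.integral_congr (g := fun _ => (0:ℝ)) fun x _ => ?_).trans (by simp)
  have h0 : ψ 0 x = 0 := hψ0 0 (by simp) x
  have h1 : ψ T x = 0 := hψ0 T (by simp) x
  have key := intervalIntegral.integral_eq_sub_of_hasDerivAt_of_le hT
    (f := fun t => U t x * ψ t x)
    (f' := fun t => U t x * deriv (fun τ => ψ τ x) t + g t x * ψ t x)
    ((hsec hc x).mul (hsec hψc.continuousOn x))
    (fun t htt => ((ht t htt x).fun_mul ((hψd t x).differentiableAt.hasDerivAt)).congr_deriv (by ring))
    ((hsec (F := fun t x => U t x * deriv (fun τ => ψ τ x) t + g t x * ψ t x) hcont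
      x).mono (by rw [Set.uIcc_of_le hT])).intervalIntegrable
  simpa [h0, h1] using key

end

section

open MvPolynomial Real Filter Topology

section

variable {G : MvPolynomial ℕ ℝ} {s : ℕ} {M T : ℝ} {φ : ℝ → ℝ} {d : ℕ → ℕ} {u v : ℕ → ℝ → ℝ → ℝ}

lemma Approx.isSolution {γ0 γ1 γ2 : ℝ} {j0 : ℕ} {lam : Fin j0 → ℝ} {a b c e : Fin j0 → ℕ}
    (h : Approx (rhs γ0 γ1 γ2 (nonlin j0 lam a b c e)) s M T φ d u v) (hs : 7 ≤ s) {T' : ℝ}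
    (hT : 0 ≤ T') (hT' : T' ≤ T) :
    IsSolution γ0 γ1 γ2 j0 lam a b c e 0 T' (jetLim u 0) := by
  have hN := nonlin_mem j0 lam a b c e
  have hG := rhs_mem γ0 γ1 γ2 hN
  have hsub : Set.Icc 0 T' ⊆ Set.Icc 0 T := Set.Icc_subset_Icc le_rfl hT'
  have hC := h.cauchy.mono hsub
  have hK : ∀ n, ∀ t ∈ Set.Icc 0 T', SobLE s M (u n t) := fun n t ht => h.bound n t (hsub ht)
  have hcu : ∀ n j, Continuous fun z : ℝ × ℝ => jet (u n z.1) z.2 j := fun n => (h.curve n).cu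
  have hU : ∀ t ∈ Set.Icc 0 T', ContDiff ℝ 5 (jetLim u 0 t) ∧
      Function.Periodic (jetLim u 0 t) (2 * π) := fun t ht =>
    ⟨hC.contDiff (j := 5) hK (by omega) ht, jetLim_periodic hC 0 t⟩
  refine ⟨fun t ht => ⟨(hU t ht).1.of_le (by norm_num), (hU t ht).2⟩, fun ψ hψ hψp hψ0 => ?_⟩
  refine weak_of_strong (g := fun t => ev (rhs γ0 γ1 γ2 (nonlin j0 lam a b c e)) (jetLim u 0 t)) hT
    hU (hC.continuousOn hK hcu (by omega)) (fun t ht => ?_)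
    (hC.continuousOn_ev hK hcu hG (by omega)) (fun t _ x => ?_) (fun t ht x => ?_) hψ hψp hψ0
  · rw [← ev_nonlin]
    exact continuousOn_univ.1 ((hC.continuousOn_ev hK hcu hN (by omega)).comp
      (f := fun x : ℝ => (t, x)) (by fun_prop) fun x _ => ⟨ht, Set.mem_univ _⟩)
  · rw [ev_rhs, ev_nonlin]
  · exact h.hasDerivAt hG (j := 0) le_rfl hT' hK (by omega) (by norm_num) x ht

end

lemma weight_le (s : ℕ) (x : ℝ) : (1 + x ^ 2) ^ s ≤ 2 ^ s * (1 + x ^ (2 * s)) := by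
  rw [pow_mul]
  have h0 : 0 ≤ (x ^ 2) ^ s := by positivity
  rcases le_total (x ^ 2) 1 with h | h
  · calc (1 + x ^ 2) ^ s ≤ 2 ^ s := by gcongr; linarith
      _ = 2 ^ s * 1 := (mul_one _).symm
      _ ≤ _ := by gcongr; linarith
  · calc (1 + x ^ 2) ^ s ≤ (2 * x ^ 2) ^ s := by gcongr; linarith
      _ = 2 ^ s * (x ^ 2) ^ s := mul_pow _ _ _
      _ ≤ _ := by gcongr; linarith

lemma weight_le_of_ne_zero (s : ℕ) {k : ℤ} (hk : k ≠ 0) :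
    (1 + (k : ℝ) ^ 2) ^ s ≤ 2 ^ s * (k : ℝ) ^ (2 * s) := by
  have h : (1 : ℝ) ≤ (k : ℝ) ^ 2 := by
    exact_mod_cast (by positivity : 0 < k ^ 2)
  rw [pow_mul, ← mul_pow]
  gcongr
  linarith

lemma IsTrig.sum_le {n : ℕ} {u : ℝ → ℝ} (h : IsTrig n u) (j : ℕ) (S : Finset ℤ) :
    2 * π * ∑ k ∈ S, (k : ℝ) ^ (2 * j) * ‖fc u k‖ ^ 2 ≤ sob j u := by
  rw [h.sob_eq]
  refine mul_le_mul_of_nonneg_left ?_ two_pi_nonneg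
  have hpos : ∀ k : ℤ, 0 ≤ (k : ℝ) ^ (2 * j) * ‖fc u k‖ ^ 2 := fun k => by
    rw [pow_mul]; positivity
  refine (Finset.sum_le_sum_of_subset_of_nonneg (Finset.subset_union_left
    (s₂ := Finset.Icc (-n : ℤ) n)) fun k _ _ => hpos k).trans_eq ?_
  refine (Finset.sum_subset Finset.subset_union_right fun k _ hk => ?_).symm
  rw [h.fc_eq_zero hk]
  simp

section

variable {A : Set ℝ} {w : ℕ → ℝ → ℝ → ℝ} {m : ℕ} {K : ℝ}

lemma CauchyTrig.tendsto_sum (h : CauchyTrig A w) (hK : ∀ n, ∀ t ∈ A, SobLE m K (w n t))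
    (hm : 2 ≤ m) {t : ℝ} (ht : t ∈ A) (j : ℕ) (S : Finset ℤ) :
    Tendsto (fun n => 2 * π * ∑ k ∈ S, (k : ℝ) ^ (2 * j) * ‖fc (w n t) k‖ ^ 2) atTop
      (𝓝 (2 * π * ∑ k ∈ S, (k : ℝ) ^ (2 * j) * ‖fc (jetLim w 0 t) k‖ ^ 2)) := by
  refine (tendsto_finsetSum S fun k _ => ?_).const_mul _
  have := h.tendsto_fc hK (j := 0) hm ht k
  simp only [jet_zero] at this
  exact (this.norm.pow 2).const_mul _

lemma CauchyTrig.sum_le (h : CauchyTrig A w) (hK : ∀ n, ∀ t ∈ A, SobLE m K (w n t))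
    (hm : 2 ≤ m) {t : ℝ} (ht : t ∈ A) {j : ℕ} (hj : j ≤ m) (S : Finset ℤ) :
    2 * π * ∑ k ∈ S, (k : ℝ) ^ (2 * j) * ‖fc (jetLim w 0 t) k‖ ^ 2 ≤ K := by
  refine le_of_tendsto (h.tendsto_sum hK hm ht j S) (Eventually.of_forall fun n => ?_)
  obtain ⟨d, hd⟩ := h.trig n
  exact ((hd t).sum_le j S).trans (hK n t ht j hj)

lemma CauchyTrig.memHs (h : CauchyTrig A w) (hK : ∀ n, ∀ t ∈ A, SobLE m K (w n t))
    (hm : 2 ≤ m) {t : ℝ} (ht : t ∈ A) : MemHs m (jetLim w 0 t) := by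
  refine ⟨h.continuous_jetLim hK hm ht, jetLim_periodic h 0 t, ?_⟩
  refine summable_of_sum_le (c := 2 ^ m * (K / (2 * π) + K / (2 * π))) (fun k => by positivity)
    fun S => ?_
  have h0 := h.sum_le hK hm ht (Nat.zero_le m) S
  have h1 := h.sum_le hK hm ht le_rfl S
  rw [mul_comm, ← le_div_iff₀ two_pi_pos] at h0 h1
  refine le_trans ?_ (mul_le_mul_of_nonneg_left (add_le_add h0 h1) (by positivity))
  rw [← Finset.sum_add_distrib, Finset.mul_sum]
  refine Finset.sum_le_sum fun k _ => ?_
  refine (mul_le_mul_of_nonneg_right (weight_le m k) (by positivity)).trans_eq ?_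
  rw [mul_zero, pow_zero]
  ring

lemma CauchyTrig.continuousWithinAt_fc (h : CauchyTrig A w)
    (hK : ∀ n, ∀ t ∈ A, SobLE m K (w n t))
    (hc : ∀ n j, Continuous fun z : ℝ × ℝ => jet (w n z.1) z.2 j) (hm : 2 ≤ m) {t : ℝ}
    (ht : t ∈ A) (k : ℤ) : ContinuousWithinAt (fun t => fc (jetLim w 0 t) k) A t := by
  simp only [fc_eq]
  refine ContinuousWithinAt.mul continuousWithinAt_const ?_
  refine intervalIntegral.continuousWithinAt_of_dominated_interval (bound := fun _ => 1 + 4 * K)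
    (eventually_mem_nhdsWithin.mono fun τ hτ => ?_)
    (eventually_mem_nhdsWithin.mono fun τ hτ => Eventually.of_forall fun x _ => ?_)
    intervalIntegrable_const (Eventually.of_forall fun x _ => ?_)
  · have := h.continuous_jetLim hK hm hτ
    exact (by fun_prop : Continuous fun x => (jetLim w 0 τ x : ℂ) * ek (-k) x).aestronglyMeasurable
  · rw [norm_mul, norm_ek, mul_one, Complex.norm_real]
    exact le_of_tendsto (h.tendsto hK hm hτ x).abs
      (Eventually.of_forall fun n => (h.smoothPer n τ).abs_jet_le (hK n τ hτ) (by omega) x)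
  · have := (h.continuousOn hK hc hm).comp (f := fun t : ℝ => (t, x)) (by fun_prop)
      (fun t ht => ⟨ht, Set.mem_univ _⟩) t ht
    exact (Complex.continuous_ofReal.continuousAt.comp_continuousWithinAt this).mul
      continuousWithinAt_const

end

/-- Convergence of the Fourier coefficients together with uniformly small tails gives
convergence in `H^s`. -/
lemma exists_hsNorm_sub_lt {s : ℕ} {A : Set ℝ} {U : ℝ → ℝ → ℝ} {t0 : ℝ} (ht0 : t0 ∈ A)
    (hU : ∀ t ∈ A, Continuous (U t))
    (hfc : ∀ k, ContinuousWithinAt (fun t => fc (U t) k) A t0)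
    (htail : ∀ η > 0, ∃ S : Finset ℤ, ∀ᶠ t in 𝓝[A] t0, ∀ F : Finset ℤ, Disjoint F S →
      ∑ k ∈ F, (k : ℝ) ^ (2 * s) * ‖fc (U t) k‖ ^ 2 ≤ η) {ε : ℝ} (hε : 0 < ε) :
    ∃ δ > 0, ∀ t ∈ A, |t - t0| < δ → hsNorm s (fun x => U t x - U t0 x) < ε := by
  suffices hev : ∀ᶠ t in 𝓝[A] t0, hsNorm s (fun x => U t x - U t0 x) < ε by
    obtain ⟨δ, hδ, h⟩ := Metric.mem_nhdsWithin_iff.1 hev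
    exact ⟨δ, hδ, fun t ht hd => h ⟨by rwa [Metric.mem_ball, Real.dist_eq], ht⟩⟩
  obtain ⟨S, hS⟩ := htail (ε ^ 2 / (16 * 2 ^ s)) (by positivity)
  have hS0 := hS.self_of_nhdsWithin ht0
  set S' := insert 0 S
  have hlow : Tendsto (fun t => ∑ k ∈ S', (1 + (k : ℝ) ^ 2) ^ s * ‖fc (U t) k - fc (U t0) k‖ ^ 2)
      (𝓝[A] t0) (𝓝 0) := by
    have : Tendsto (fun t => ∑ k ∈ S', (1 + (k : ℝ) ^ 2) ^ s * ‖fc (U t) k - fc (U t0) k‖ ^ 2)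
        (𝓝[A] t0) (𝓝 (∑ k ∈ S', (1 + (k : ℝ) ^ 2) ^ s * ‖fc (U t0) k - fc (U t0) k‖ ^ 2)) :=
      tendsto_finsetSum _ fun k _ => (((hfc k).sub tendsto_const_nhds).norm.pow 2).const_mul _
    simpa using this
  filter_upwards [hS, hlow.eventually_lt_const (show 0 < ε ^ 2 / 4 by positivity),
    eventually_mem_nhdsWithin] with t htS htlow htA
  rw [hsNorm, Real.sqrt_lt' hε]
  refine lt_of_le_of_lt (Real.tsum_le_of_sum_le (c := ε ^ 2 / 2) (fun k => by positivity)
    fun F => ?_) (by linarith [pow_pos hε 2])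
  simp only [fc_sub (hU t htA) (hU t0 ht0)]
  have hdisj : Disjoint (F \ S') S := Finset.sdiff_disjoint.mono_right
    (Finset.subset_insert _ _)
  have h1 := htS _ hdisj
  have h2 := hS0 _ hdisj
  have h3 : ∑ k ∈ F \ S', (1 + (k : ℝ) ^ 2) ^ s * ‖fc (U t) k - fc (U t0) k‖ ^ 2 ≤
      2 ^ s * 2 * (∑ k ∈ F \ S', (k : ℝ) ^ (2 * s) * ‖fc (U t) k‖ ^ 2 +
        ∑ k ∈ F \ S', (k : ℝ) ^ (2 * s) * ‖fc (U t0) k‖ ^ 2) := by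
    rw [← Finset.sum_add_distrib, Finset.mul_sum]
    refine Finset.sum_le_sum fun k hk => ?_
    have hk0 : k ≠ 0 := by
      rintro rfl
      exact (Finset.mem_sdiff.1 hk).2 (Finset.mem_insert_self _ _)
    have hn : ‖fc (U t) k - fc (U t0) k‖ ^ 2 ≤ 2 * (‖fc (U t) k‖ ^ 2 + ‖fc (U t0) k‖ ^ 2) := by
      have := norm_sub_le (fc (U t) k) (fc (U t0) k)
      nlinarith [sq_nonneg (‖fc (U t) k‖ - ‖fc (U t0) k‖), norm_nonneg (fc (U t) k - fc (U t0) k)]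
    refine (mul_le_mul (weight_le_of_ne_zero s hk0) hn (by positivity)
      (by rw [pow_mul]; positivity)).trans_eq ?_
    ring
  have h4 : ∑ k ∈ F ∩ S', (1 + (k : ℝ) ^ 2) ^ s * ‖fc (U t) k - fc (U t0) k‖ ^ 2 ≤
      ∑ k ∈ S', (1 + (k : ℝ) ^ 2) ^ s * ‖fc (U t) k - fc (U t0) k‖ ^ 2 :=
    Finset.sum_le_sum_of_subset_of_nonneg Finset.inter_subset_right fun k _ _ => by positivity
  have h5 : 2 ^ s * 2 * (∑ k ∈ F \ S', (k : ℝ) ^ (2 * s) * ‖fc (U t) k‖ ^ 2 +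
        ∑ k ∈ F \ S', (k : ℝ) ^ (2 * s) * ‖fc (U t0) k‖ ^ 2) ≤
      2 ^ s * 2 * (ε ^ 2 / (16 * 2 ^ s) + ε ^ 2 / (16 * 2 ^ s)) :=
    mul_le_mul_of_nonneg_left (add_le_add h1 h2) (by positivity)
  have h6 : (2:ℝ) ^ s * 2 * (ε ^ 2 / (16 * 2 ^ s) + ε ^ 2 / (16 * 2 ^ s)) = ε ^ 2 / 4 := by
    field_simp
    norm_num
  rw [← Finset.sum_inter_add_sum_sdiff F S']
  linarith

section

variable {G : MvPolynomial ℕ ℝ} {s : ℕ} {M T : ℝ} {φ : ℝ → ℝ} {d : ℕ → ℕ} {u v : ℕ → ℝ → ℝ → ℝ}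

lemma Approx.jetLim_zero (h : Approx G s M T φ d u v) (hφ : MemHs s φ) (hs : 2 ≤ s)
    (hT : 0 ≤ T) : jetLim u 0 0 = φ := by
  funext x
  have h1 := h.cauchy.tendsto h.bound hs (j := 0) (Set.left_mem_Icc.2 hT) x
  simp only [jet_zero, h.zero] at h1
  exact tendsto_nhds_unique h1 ((hφ.tendsto_trunc hs x).comp h.hd)

lemma Approx.tail_of_pos (h : Approx G s M T φ d u v) (hs : 2 ≤ s) {t0 : ℝ} (ht0 : 0 < t0) {η : ℝ}
    (hη : 0 < η) : ∃ S : Finset ℤ, ∀ᶠ t in 𝓝[Set.Icc 0 T] t0, ∀ F : Finset ℤ, Disjoint F S →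
      ∑ k ∈ F, (k : ℝ) ^ (2 * s) * ‖fc (jetLim u 0 t) k‖ ^ 2 ≤ η := by
  obtain ⟨K, hK⟩ := h.smooth _ (half_pos ht0) (s + 1)
  have hC : CauchyTrig (Set.Icc (t0 / 2) T) u :=
    h.cauchy.mono (Set.Icc_subset_Icc (half_pos ht0).le le_rfl)
  obtain ⟨n, hn⟩ := exists_nat_gt (K / (2 * π) / η)
  refine ⟨Finset.Icc (-n : ℤ) n, ?_⟩
  filter_upwards [self_mem_nhdsWithin,
    mem_nhdsWithin_of_mem_nhds (Ioi_mem_nhds (half_lt_self ht0))] with t htA ht F hF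
  have ht' : t ∈ Set.Icc (t0 / 2) T := ⟨le_of_lt ht, htA.2⟩
  have h1 := hC.sum_le hK (by omega) ht' le_rfl F
  rw [mul_comm, ← le_div_iff₀ two_pi_pos] at h1
  have h2 : (n + 1 : ℝ) * ∑ k ∈ F, (k : ℝ) ^ (2 * s) * ‖fc (jetLim u 0 t) k‖ ^ 2 ≤
      ∑ k ∈ F, (k : ℝ) ^ (2 * (s + 1)) * ‖fc (jetLim u 0 t) k‖ ^ 2 := by
    rw [Finset.mul_sum]
    refine Finset.sum_le_sum fun k hk => ?_
    have hk' : k ∉ Finset.Icc (-n : ℤ) n := Finset.disjoint_left.1 hF hk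
    have hnk : (n + 1 : ℝ) ≤ (k : ℝ) ^ 2 := by
      have : (n + 1 : ℤ) ≤ k.natAbs := by
        rw [Finset.mem_Icc] at hk'
        omega
      have h3 : ((k.natAbs : ℤ)) ^ 2 = k ^ 2 := Int.natAbs_sq k
      have h4 : (n + 1 : ℤ) ≤ k ^ 2 := by nlinarith
      exact_mod_cast h4
    rw [show 2 * (s + 1) = 2 + 2 * s by ring, pow_add, mul_assoc]
    refine mul_le_mul_of_nonneg_right hnk ?_
    rw [pow_mul]
    positivity
  rw [div_lt_iff₀ hη] at hn
  have hn0 : (0:ℝ) ≤ n := Nat.cast_nonneg n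
  by_contra! hcon
  nlinarith

lemma Approx.tail_zero (h : Approx G s M T φ d u v) (hφ : MemHs s φ) (hs : 2 ≤ s) (hT : 0 ≤ T)
    {η : ℝ} (hη : 0 < η) :
    ∃ S : Finset ℤ, ∀ᶠ t in 𝓝[Set.Icc 0 T] 0, ∀ F : Finset ℤ, Disjoint F S →
      ∑ k ∈ F, (k : ℝ) ^ (2 * s) * ‖fc (jetLim u 0 t) k‖ ^ 2 ≤ η := by
  have hpos : ∀ (f : ℝ → ℝ) (k : ℤ), 0 ≤ (k : ℝ) ^ (2 * s) * ‖fc f k‖ ^ 2 := fun f k => by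
    rw [pow_mul]
    positivity
  have hsum : Summable fun k : ℤ => (k : ℝ) ^ (2 * s) * ‖fc φ k‖ ^ 2 :=
    summable_of_sum_le (hpos φ) fun S => hφ.sum_le le_rfl S
  set E := ∑' k : ℤ, (k : ℝ) ^ (2 * s) * ‖fc φ k‖ ^ 2
  obtain ⟨S, hS⟩ := (hsum.hasSum.eventually_const_lt (show E - η / 3 < E by linarith)).exists
  obtain ⟨τ, hτ, hmod⟩ := h.modulus (2 * π * (η / 3)) (by have := two_pi_pos; positivity)
  refine ⟨S, ?_⟩
  have hm0 : (0 : ℝ) ∈ Set.Icc 0 T := Set.left_mem_Icc.2 hT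
  have hcont : Tendsto (fun t => ∑ k ∈ S, (k : ℝ) ^ (2 * s) * ‖fc (jetLim u 0 t) k‖ ^ 2)
      (𝓝[Set.Icc 0 T] 0) (𝓝 (∑ k ∈ S, (k : ℝ) ^ (2 * s) * ‖fc (jetLim u 0 0) k‖ ^ 2)) :=
    tendsto_finsetSum _ fun k _ => ((h.cauchy.continuousWithinAt_fc h.bound
      (fun n => (h.curve n).cu) hs hm0 k).norm.pow 2).const_mul _
  rw [h.jetLim_zero hφ hs hT] at hcont
  filter_upwards [self_mem_nhdsWithin, mem_nhdsWithin_of_mem_nhds (Iio_mem_nhds hτ),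
    hcont.eventually_const_lt (show E - η / 3 - η / 3 < _ by linarith)] with t htA htτ htS F hF
  have hle : 2 * π * ∑ k ∈ F ∪ S, (k : ℝ) ^ (2 * s) * ‖fc (jetLim u 0 t) k‖ ^ 2 ≤
      2 * π * E + 2 * π * (η / 3) := by
    refine le_of_tendsto (h.cauchy.tendsto_sum h.bound hs htA s (F ∪ S))
      (Eventually.of_forall fun n => ?_)
    refine ((h.trig n t).sum_le s _).trans ((hmod n t htA (le_of_lt htτ)).trans ?_)
    rw [h.zero, sob_trunc]
    have := mul_le_mul_of_nonneg_left (hsum.sum_le_tsum (Finset.Icc (-d n : ℤ) (d n))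
      fun k _ => hpos φ k) two_pi_nonneg
    linarith
  rw [← mul_add, mul_le_mul_iff_right₀ two_pi_pos, Finset.sum_union hF] at hle
  linarith

lemma Approx.contInHs (h : Approx G s M T φ d u v) (hφ : MemHs s φ) (hs : 2 ≤ s) :
    ContInHs s (Set.Icc 0 T) (jetLim u 0) := by
  intro t0 ht0 ε hε
  refine exists_hsNorm_sub_lt ht0 (fun t ht => h.cauchy.continuous_jetLim h.bound hs ht)
    (fun k => h.cauchy.continuousWithinAt_fc h.bound (fun n => (h.curve n).cu) hs ht0 k)
    (fun η hη => ?_) hε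
  rcases ht0.1.eq_or_lt with h0 | h0
  · rw [← h0]
    exact h.tail_zero hφ hs (ht0.1.trans ht0.2) hη
  · exact h.tail_of_pos hs h0 hη

end

/-- Galerkin approximations exist on a time interval depending only on the norm of order `12` and
the parabolicity of the data, and a subsequence converges. -/
theorem exists_approx {γ0 : ℝ} (γ1 γ2 : ℝ) (hγ0 : γ0 ≠ 0) {N : MvPolynomial ℕ ℝ}
    (hN : N ∈ ordLE 3) (M0 : ℝ) {δ : ℝ} (hδ : 0 < δ) :
    ∃ T : ℝ, 0 < T ∧ ∀ (s : ℕ) (φ : ℝ → ℝ), 12 ≤ s → MemHs s φ → 2 * π * hsNorm 12 φ ^ 2 ≤ M0 →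
      2 * δ ≤ mean (pderiv 2 N) φ → ∃ M d u v, Approx (rhs γ0 γ1 γ2 N) s M T φ d u v ∧
        ∀ n, ∀ t ∈ Set.Icc 0 T, δ ≤ mean (pderiv 2 N) (u n t) := by
  obtain ⟨T, hT, hT1, M, R, H⟩ := exists_time γ1 γ2 hγ0 hN M0 hδ
  refine ⟨T, hT, fun s φ hs hφ hM0 hmean => ?_⟩
  have hφ12 : MemHs 12 φ := hφ.mono hs
  have hm0 : (0 : ℝ) ∈ Set.Icc 0 T := Set.left_mem_Icc.2 hT.le
  obtain ⟨n0, hn0⟩ := eventually_atTop.1 ((hφ12.tendsto_mean_trunc (pderiv_mem_ordLE hN 2)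
    (by norm_num)).eventually_const_le (show 9 / 5 * δ < _ by linarith))
  choose c d hcd hd hc0 hgal using fun n : ℕ =>
    exists_galerkin (rhs_mem γ0 γ1 γ2 hN) (n + n0) R φ
  set U : ℕ → ℝ → ℝ → ℝ := fun n t => trig (n + n0) (c n t) with hU
  set V : ℕ → ℝ → ℝ → ℝ := fun n t => trig (n + n0) (d n t) with hV
  have hUV : ∀ n, Curve (U n) (V n) := fun n => curve_trig _ (hcd n) (hd n)
  have htrig : ∀ n t, IsTrig (n + n0) (U n t) := fun n t => ⟨_, rfl⟩
  have hU0 : ∀ n, U n 0 = trunc (n + n0) φ := hc0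
  have hflow : ∀ n, ∀ t ∈ Set.Icc (0:ℝ) 1, sob 0 (U n t) ≤ R →
      ∃ f, Flow γ0 γ1 γ2 N (U n t) (V n t) f := fun n t ht hR => by
    have e : V n t = _ := hgal n t ht hR
    rw [e]
    exact ⟨_, (htrig n t).flow γ0 γ1 γ2 N⟩
  have hH : ∀ n, ∀ t ∈ Set.Icc 0 T, sob 0 (U n t) ≤ R ∧ SobLE 12 M (U n t) ∧
      11 / 10 * δ ≤ mean (pderiv 2 N) (U n t) := fun n => by
    refine H _ _ (hUV n) (fun t => ⟨_, htrig n t⟩) (hflow n) ?_ ?_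
    · rw [hU0]
      exact (hφ12.sobLE_trunc _).mono le_rfl hM0
    · rw [hU0]
      exact hn0 _ (Nat.le_add_left _ _)
  have hT1' : ∀ t ∈ Set.Icc 0 T, t ∈ Set.Icc (0:ℝ) 1 := fun t ht => ⟨ht.1, ht.2.trans hT1⟩
  have htraj : ∀ n, Traj γ0 γ1 γ2 N δ T (U n) (V n) := fun n =>
    ⟨hUV n, ⟨_, htrig n⟩, fun t ht => hflow n t (hT1' t ht) (hH n t ht).1,
      fun t ht => by linarith [(hH n t ht).2.2]⟩
  have hM : ∀ n, ∀ t ∈ Set.Icc 0 T, SobLE 12 M (U n t) := fun n t ht => (hH n t ht).2.1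
  obtain ⟨K, hK⟩ := exists_persistence γ1 γ2 hγ0 hN (M := M) hδ hT1 (2 * π * hsNorm s φ ^ 2) hs
  have hb : ∀ n, ∀ t ∈ Set.Icc 0 T, SobLE s K (U n t) := fun n =>
    hK _ _ (htraj n) (hM n) (by rw [hU0]; exact hφ.sobLE_trunc _)
  have hK0 : 0 ≤ K := (sob_nonneg 0 _).trans (hb 0 0 hm0 0 (Nat.zero_le _))
  have hM' : 0 ≤ M := (sob_nonneg 0 _).trans (hM 0 0 hm0 0 (Nat.zero_le _))
  obtain ⟨B, hB, hlip⟩ := exists_lipschitz_time γ1 γ2 γ0 hN δ T M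
  have hb1 : ∀ n, ∀ t ∈ Set.Icc 0 T, ∀ x, |U n t x| ≤ B + (1 + 4 * M) := fun n t ht x => by
    have := (htrig n t).smoothPer.abs_jet_le (hM n t ht) (j := 0) (by norm_num) x
    rw [jet_zero] at this
    linarith
  have hb2 : ∀ n, ∀ t ∈ Set.Icc 0 T, ∀ t' ∈ Set.Icc 0 T, ∀ x,
      |U n t x - U n t' x| ≤ (B + (1 + 4 * M)) * |t - t'| := fun n t ht t' ht' x => by
    have h1 : |U n t x - U n t' x| ≤ B * |t - t'| := by
      rcases le_total t t' with h | h
      · rw [abs_sub_comm, abs_sub_comm t, abs_of_nonneg (sub_nonneg.2 h)]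
        exact hlip _ _ (htraj n) (hM n) t t' ht.1 h ht'.2 x
      · rw [abs_of_nonneg (sub_nonneg.2 h)]
        exact hlip _ _ (htraj n) (hM n) t' t ht'.1 h ht.2 x
    refine h1.trans (mul_le_mul_of_nonneg_right ?_ (abs_nonneg _))
    linarith
  have hb3 : ∀ n, ∀ t ∈ Set.Icc 0 T, ∀ x y, |U n t x - U n t y| ≤ (B + (1 + 4 * M)) * |x - y| :=
      fun n t ht x y => by
    have hs := (htrig n t).smoothPer
    have h1 := convex_univ.norm_image_sub_le_of_norm_hasDerivWithin_le (C := 1 + 4 * M)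
      (fun x _ => (hs.hasDerivAt 0 x).hasDerivWithinAt)
      (fun x _ => hs.abs_jet_le (hM n t ht) (by norm_num) x) (Set.mem_univ y) (Set.mem_univ x)
    simp only [jet_zero, Real.norm_eq_abs] at h1
    refine h1.trans (mul_le_mul_of_nonneg_right ?_ (abs_nonneg _))
    linarith
  obtain ⟨θ, hθ, hconv⟩ := exists_subseq (fun n t => (htrig n t).smoothPer.2) hb1 hb2 hb3
  refine ⟨K, fun n => θ n + n0, fun n => U (θ n), fun n => V (θ n), ?_,
    fun n t ht => (htraj (θ n)).mean_ge t ht⟩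
  refine ⟨tendsto_atTop_mono (fun n => Nat.le_add_right _ _) hθ.tendsto_atTop, fun n => hUV _, fun n => htrig _,
    fun n => hU0 _, fun n t ht => hgal _ t (hT1' t ht) (hH _ t ht).1, fun n => hb _,
    fun τ hτ m => ?_, fun ε hε => ?_, fun n => ⟨_, htrig _⟩, fun ε hε => ?_⟩
  · obtain ⟨K', hK'⟩ := exists_smoothing γ1 γ2 hγ0 hN (M := M) hδ hT1 (le_max_right m 12) τ hτ
    exact ⟨K', fun n t ht => (hK' _ _ (htraj _) (hM _) t ht).mono (le_max_left _ _) le_rfl⟩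
  · obtain ⟨τ, hτ, h⟩ := exists_modulus γ1 γ2 hγ0 hN hδ hT1 hK0 hs hε
    exact ⟨τ, hτ, fun n => h _ _ (htraj _) (hb _)⟩
  · obtain ⟨n1, hn1⟩ := hconv (√(ε / (2 * π))) (Real.sqrt_pos.2 (div_pos hε two_pi_pos))
    refine ⟨n1, fun n hn k hk t ht => ?_⟩
    have c1 := (htrig (θ n) t).smoothPer.1.continuous
    have c2 := (htrig (θ k) t).smoothPer.1.continuous
    refine (sob_zero_le (c1.sub c2) (hn1 n hn k hk t ht)).trans_eq ?_
    have := two_pi_pos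
    rw [Real.sq_sqrt (by positivity)]
    field_simp

end

/-- **L.W.P. (existence) for parabolic resonance type, positive case.**
Let `s ≥ 13`. There is a time `T > 0` depending only on `P_N(φ)` and `‖φ‖_{H^{12}}` such that
for every real-valued `φ ∈ H^s(𝕋)` with `P_N(φ) > 0` there is a solution `u` on `[0,T]` with
`u(0) = φ`, `u ∈ C([0,T];H^s(𝕋)) ∩ C^∞((0,T] × 𝕋)` and `P_N(u(t)) ≥ P_N(φ)/2` on `[0,T]`. -/
theorem lwp_parabolic_existence
    (γ0 γ1 γ2 : ℝ) (hγ0 : γ0 ≠ 0)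
    (j0 : ℕ) (lam : Fin j0 → ℝ) (a b c d : Fin j0 → ℕ)
    (hp : ∀ j : Fin j0, 2 ≤ a j + b j + c j + d j)
    (s : ℕ) (hs : 13 ≤ s) :
    ∃ Tf : ℝ → ℝ → ℝ, (∀ r₁ r₂ : ℝ, 0 < Tf r₁ r₂) ∧
      ∀ φ : ℝ → ℝ, MemHs s φ → 0 < PN j0 lam a b c d φ →
        ∃ u : ℝ → ℝ → ℝ,
          u 0 = φ ∧
          IsSolution γ0 γ1 γ2 j0 lam a b c d 0
            (Tf (PN j0 lam a b c d φ) (hsNorm 12 φ)) u ∧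
          (∀ t ∈ Set.Icc (0:ℝ) (Tf (PN j0 lam a b c d φ) (hsNorm 12 φ)), MemHs s (u t)) ∧
          ContInHs s (Set.Icc (0:ℝ) (Tf (PN j0 lam a b c d φ) (hsNorm 12 φ))) u ∧
          ContDiffOn ℝ (⊤ : ℕ∞) (Function.uncurry u)
            (Set.Ioc (0:ℝ) (Tf (PN j0 lam a b c d φ) (hsNorm 12 φ)) ×ˢ (Set.univ : Set ℝ)) ∧
          (∀ t ∈ Set.Icc (0:ℝ) (Tf (PN j0 lam a b c d φ) (hsNorm 12 φ)),
            PN j0 lam a b c d φ / 2 ≤ PN j0 lam a b c d (u t)) := by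
  have hN := nonlin_mem j0 lam a b c d
  have key : ∀ r₁ r₂ : ℝ, ∃ T : ℝ, 0 < T ∧ (0 < r₁ → ∀ (s : ℕ) (φ : ℝ → ℝ), 12 ≤ s → MemHs s φ →
      2 * Real.pi * hsNorm 12 φ ^ 2 ≤ 2 * Real.pi * r₂ ^ 2 →
      2 * (r₁ / 2) ≤ mean (MvPolynomial.pderiv 2 (nonlin j0 lam a b c d)) φ → ∃ M D u v,
        Approx (rhs γ0 γ1 γ2 (nonlin j0 lam a b c d)) s M T φ D u v ∧ ∀ n, ∀ t ∈ Set.Icc 0 T,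
          r₁ / 2 ≤ mean (MvPolynomial.pderiv 2 (nonlin j0 lam a b c d)) (u n t)) := fun r₁ r₂ => by
    by_cases hr : 0 < r₁
    · obtain ⟨T, hT, H⟩ := exists_approx γ1 γ2 hγ0 hN (2 * Real.pi * r₂ ^ 2) (half_pos hr)
      exact ⟨T, hT, fun _ => H⟩
    · exact ⟨1, one_pos, fun h => (hr h).elim⟩
  choose Tf hTf H using key
  refine ⟨fun r₁ r₂ => Tf r₁ r₂ / 2, fun r₁ r₂ => half_pos (hTf r₁ r₂), fun φ hφ hpos => ?_⟩
  have hmean := mean_nonlin j0 lam a b c d (hφ.contDiff (j := 3) (by omega))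
  obtain ⟨M, D, u, v, h, hge⟩ := H _ (hsNorm 12 φ) hpos s φ (by omega) hφ le_rfl
    (by rw [hmean]; linarith)
  have hT := hTf (PN j0 lam a b c d φ) (hsNorm 12 φ)
  simp only
  set T := Tf (PN j0 lam a b c d φ) (hsNorm 12 φ)
  have hsub : Set.Icc 0 (T / 2) ⊆ Set.Icc 0 T := Set.Icc_subset_Icc le_rfl (by linarith)
  refine ⟨jetLim u 0, h.jetLim_zero hφ (by omega) hT.le,
    h.isSolution (by omega) (by linarith) (by linarith),
    fun t ht => h.cauchy.memHs h.bound (by omega) (hsub ht),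
    fun t₀ ht₀ ε hε => ?_, ?_, fun t ht => ?_⟩
  · obtain ⟨δ, hδ, hc⟩ := h.contInHs hφ (by omega) t₀ (hsub ht₀) ε hε
    exact ⟨δ, hδ, fun t ht => hc t (hsub ht)⟩
  · refine (h.contDiffOn (rhs_mem γ0 γ1 γ2 hN) (by norm_num)).mono (Set.prod_mono ?_ le_rfl)
    exact fun t ht => ⟨ht.1, ht.2.trans_lt (by linarith)⟩
  · rw [← mean_nonlin j0 lam a b c d (h.cauchy.contDiff h.bound (j := 3) (by omega) (hsub ht))]
    exact ge_of_tendsto (h.cauchy.tendsto_mean h.bound (pderiv_mem_ordLE hN 2) (by omega) (hsub ht))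
      (Filter.Eventually.of_forall fun n => hge n t (hsub ht))

end FifthOrderStmt2
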